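/- arXiv:0706.3842 — 3 statements merged into one kernel-verified Lean document; each statement's English description precedes it below -/
import Mathlib

section
/- Let R = ⨁_{n≥0} R_n be a Noetherian graded ring with R_0 a field of characteristic p > 0, and assume R has finite graded F-representation type by finitely generated ℚ-graded R-modules M_1, …, M_s. Then for every element x ∈ R and for every i = 1, …, s, the descending chain of R-submodules of M_i given by I_1(x^{p-1}, M_i) ⊇ I_2(x^{p²-1}, M_i) ⊇ I_3(x^{p³-1}, M_i) ⊇ ⋯ stabilizes, i.e., there exists e₀ such that I_e(x^{pᵉ-1}, M_i) = I_{e₀}(x^{p^{e₀}-1}, M_i) for all e ≥ e₀. -/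
/-!
Statement 0: Let `R` be a Noetherian graded ring with `R₀` a field of characteristic
`p > 0` having finite graded F-representation type by finitely generated `ℚ`-graded
modules `M_1, …, M_s`.  Then for every `x ∈ R` and every `i`, the descending chain
`I_1(x^{p-1}, M_i) ⊇ I_2(x^{p²-1}, M_i) ⊇ ⋯` stabilizes.
-/

open scoped DirectSum

universe u v

section Defs

/-- The submodule `I_e(𝔞, M) = Hom_R(ᵉR, M) · 𝔞 ⊆ M`.  An additive map `φ : R →+ M` is an
`R`-linear map `ᵉR → M` precisely when `φ (r ^ p ^ e * y) = r • φ y` for all `r, y ∈ R`. -/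
def frobIe (p e : ℕ) (R : Type u) (M : Type v) [CommRing R] [AddCommGroup M]
    [Module R M] (a : Ideal R) : Submodule R M :=
  Submodule.span R
    {m | ∃ φ : R →+ M, (∀ r y : R, φ (r ^ p ^ e * y) = r • φ y) ∧ ∃ y ∈ a, φ y = m}

end Defs

section Filtration

variable {k : Type*} [Field k]

/-- The submodule of elements all of whose homogeneous components have degree at most `β`. -/
def degLE {ι V : Type*} [LE ι] [AddCommGroup V] [Module k V] (𝒱 : ι → Submodule k V) (β : ι) :
    Submodule k V :=
  ⨆ γ : {γ : ι // γ ≤ β}, 𝒱 γ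

section

variable {ι V : Type*} [AddCommGroup V] [Module k V] (𝒱 : ι → Submodule k V)

lemma le_degLE [LE ι] {γ β : ι} (h : γ ≤ β) : 𝒱 γ ≤ degLE 𝒱 β :=
  le_iSup (fun γ : {γ : ι // γ ≤ β} => 𝒱 γ) ⟨γ, h⟩

lemma degLE_le [LE ι] {β : ι} {W : Submodule k V} (h : ∀ γ ≤ β, 𝒱 γ ≤ W) : degLE 𝒱 β ≤ W :=
  iSup_le fun γ => h γ γ.2

lemma degLE_mono [Preorder ι] : Monotone (degLE 𝒱) := fun _ _ h =>
  degLE_le 𝒱 fun _ hγ => le_degLE 𝒱 (hγ.trans h)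

lemma exists_mem_degLE [LinearOrder ι] [Nonempty ι] (h : ⨆ γ, 𝒱 γ = ⊤) (v : V) :
    ∃ β, v ∈ degLE 𝒱 β := by
  have hv : v ∈ ⨆ γ, 𝒱 γ := h ▸ Submodule.mem_top
  refine Submodule.iSup_induction 𝒱 (motive := fun v => ∃ β, v ∈ degLE 𝒱 β) hv
    (fun γ v hv => ⟨γ, le_degLE 𝒱 le_rfl hv⟩) ⟨Classical.arbitrary ι, zero_mem _⟩ ?_
  rintro v w ⟨β, hβ⟩ ⟨γ, hγ⟩
  exact ⟨max β γ, add_mem (degLE_mono 𝒱 (le_max_left _ _) hβ)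
    (degLE_mono 𝒱 (le_max_right _ _) hγ)⟩

lemma iSupIndep.eq_of_le_of_iSup_eq_top {𝒲 : ι → Submodule k V} (hind : iSupIndep 𝒱)
    (hle : ∀ γ, 𝒲 γ ≤ 𝒱 γ) (htop : ⨆ γ, 𝒲 γ = ⊤) (γ : ι) : 𝒲 γ = 𝒱 γ := by
  refine (hle γ).antisymm fun v hv => ?_
  have hsup : v ∈ 𝒲 γ ⊔ ⨆ (j) (_ : j ≠ γ), 𝒱 j := by
    have : (⊤ : Submodule k V) ≤ 𝒲 γ ⊔ ⨆ (j) (_ : j ≠ γ), 𝒱 j := by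
      rw [← htop]
      refine iSup_le fun j => ?_
      rcases eq_or_ne j γ with rfl | hj
      · exact le_sup_left
      · exact (hle j).trans ((le_iSup₂ (f := fun j (_ : j ≠ γ) => 𝒱 j) j hj).trans le_sup_right)
    exact this Submodule.mem_top
  obtain ⟨w, hw, w', hw', rfl⟩ := Submodule.mem_sup.mp hsup
  have h0 : w' = 0 := by
    refine Submodule.disjoint_def.mp (hind γ) w' ?_ hw'
    simpa using sub_mem hv (hle γ hw)
  simpa [h0] using hw

end

section GradedRing

variable {R : Type*} [CommRing R] [Algebra k R] (𝒜 : ℕ → Submodule k R) [GradedAlgebra 𝒜]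

lemma degLE_mul_mem {a b : ℕ} {x y : R} (hx : x ∈ degLE 𝒜 a) (hy : y ∈ degLE 𝒜 b) :
    x * y ∈ degLE 𝒜 (a + b) := by
  have : degLE 𝒜 a * degLE 𝒜 b ≤ degLE 𝒜 (a + b) := by
    unfold degLE
    rw [Submodule.iSup_mul]
    refine iSup_le fun i => ?_
    rw [Submodule.mul_iSup]
    refine iSup_le fun j => Submodule.mul_le.mpr fun u hu v hv => ?_
    exact le_degLE 𝒜 (add_le_add i.2 j.2) (SetLike.mul_mem_graded hu hv)
  exact this (Submodule.mul_mem_mul hx hy)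

lemma degLE_pow_mem {a : ℕ} {x : R} (hx : x ∈ degLE 𝒜 a) (q : ℕ) :
    x ^ q ∈ degLE 𝒜 (q * a) := by
  induction q with
  | zero => simpa using le_degLE 𝒜 le_rfl (SetLike.one_mem_graded 𝒜)
  | succ q ih =>
    rw [pow_succ, Nat.succ_mul]
    exact degLE_mul_mem 𝒜 ih hx

/-- The graded pieces of a Noetherian graded algebra with `𝒜 0 = k` are finite-dimensional. -/
lemma finite_gradedPiece [IsNoetherianRing R] (h0 : 𝒜 0 = Submodule.span k {1}) (n : ℕ) :
    Module.Finite k (𝒜 n) := by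
  have key : ∀ V : Submodule k (𝒜 n), ∀ w ∈ Ideal.span (Set.image Subtype.val (V : Set (𝒜 n))),
      ∀ r : R, DirectSum.decompose 𝒜 (r * w) n ∈ V := by
    intro V w hw
    induction hw using Submodule.span_induction with
    | mem w hw =>
      obtain ⟨v, hv, rfl⟩ := hw
      intro r
      have hr : (DirectSum.decompose 𝒜 r 0 : R) ∈ Submodule.span k {1} := h0 ▸ Subtype.prop _
      obtain ⟨c, hc⟩ := Submodule.mem_span_singleton.mp hr
      have : DirectSum.decompose 𝒜 (r * (v : R)) n = c • v := by
        ext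
        rw [DirectSum.coe_decompose_mul_of_right_mem_of_le 𝒜 v.2 le_rfl, Nat.sub_self, ← hc]
        simp
      exact this ▸ V.smul_mem c hv
    | zero => simp
    | add v w _ _ hv hw =>
      intro r
      rw [mul_add, DirectSum.decompose_add]
      exact add_mem (hv r) (hw r)
    | smul a w _ hw =>
      intro r
      rw [smul_eq_mul, ← mul_assoc]
      exact hw _
  have hmem : ∀ (V : Submodule k (𝒜 n)) (v : 𝒜 n),
      (v : R) ∈ Ideal.span (Set.image Subtype.val (V : Set (𝒜 n))) → v ∈ V := by
    intro V v hv
    simpa using key V v hv 1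
  have hmono : StrictMono fun V : Submodule k (𝒜 n) =>
      Ideal.span (Set.image Subtype.val (V : Set (𝒜 n))) := by
    refine Monotone.strictMono_of_injective
      (fun V W h => Ideal.span_mono (Set.image_mono h)) fun V W h => ?_
    refine le_antisymm (fun v hv => hmem W v ?_) fun v hv => hmem V v ?_
    · exact (show Ideal.span _ = Ideal.span _ from h) ▸ Ideal.subset_span ⟨v, hv, rfl⟩
    · exact (show Ideal.span _ = Ideal.span _ from h) ▸ Ideal.subset_span ⟨v, hv, rfl⟩
  have : IsNoetherian k (𝒜 n) := isNoetherian_iff'.mpr hmono.wellFoundedGT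
  infer_instance

end GradedRing

section GradedModule

variable {R : Type*} [CommRing R] [Algebra k R] (𝒜 : ℕ → Submodule k R)
  {M : Type*} [AddCommGroup M] [Module R M] [Module k M] [IsScalarTower k R M]
  (ℳ : ℚ → Submodule k M)

lemma smul_mem_degLE
    (hsmul : ∀ (n : ℕ) (α : ℚ) (r : R) (m : M), r ∈ 𝒜 n → m ∈ ℳ α → r • m ∈ ℳ ((n : ℚ) + α))
    {n : ℕ} {r : R} (hr : r ∈ 𝒜 n) {β : ℚ} {m : M} (hm : m ∈ degLE ℳ β) :
    r • m ∈ degLE ℳ ((n : ℚ) + β) := by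
  have : degLE ℳ β ≤ (degLE ℳ ((n : ℚ) + β)).comap (Algebra.lsmul k k M r) :=
    degLE_le ℳ fun γ hγ m hm =>
      le_degLE ℳ (by gcongr) (hsmul n γ r m hr hm)
  exact this hm

variable [GradedAlgebra 𝒜]

/-- A finitely generated graded module has finitely many homogeneous generators, whose multiples
by homogeneous ring elements span each filtration step over the base field. -/
lemma exists_homogeneous_generators [Module.Finite R M] (hinternal : DirectSum.IsInternal ℳ)
    (hsmul : ∀ (n : ℕ) (α : ℚ) (r : R) (m : M), r ∈ 𝒜 n → m ∈ ℳ α → r • m ∈ ℳ ((n : ℚ) + α)) :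
    ∃ (T : Finset M) (δ : M → ℚ), ∀ β, degLE ℳ β ≤ ⨆ t : T, ⨆ n : {n : ℕ // (n : ℚ) + δ t ≤ β},
      (𝒜 n).map ((LinearMap.toSpanSingleton R M t).restrictScalars k) := by
  have hspan : Submodule.span R {m : M | ∃ γ, m ∈ ℳ γ} = ⊤ := by
    refine eq_top_iff.mpr fun m _ => ?_
    have hm : m ∈ ⨆ γ, ℳ γ := hinternal.submodule_iSup_eq_top ▸ Submodule.mem_top
    have hle : ⨆ γ, ℳ γ ≤ (Submodule.span R {m : M | ∃ γ, m ∈ ℳ γ}).restrictScalars k :=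
      iSup_le fun γ m hm => Submodule.subset_span ⟨γ, hm⟩
    exact hle hm
  have hfg : (Submodule.span R {m : M | ∃ γ, m ∈ ℳ γ}).FG := hspan ▸ Module.Finite.fg_top
  obtain ⟨T, hT, hTspan⟩ := (Submodule.fg_span_iff_fg_span_finset_subset _).mp hfg
  choose! δ hδ using (show ∀ m ∈ T, ∃ γ, m ∈ ℳ γ from fun m hm => hT hm)
  refine ⟨T, δ, fun β => ?_⟩
  let 𝒲 : ℚ → Submodule k M := fun γ => ⨆ t : T, ⨆ n : {n : ℕ // (n : ℚ) + δ t = γ},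
    (𝒜 n).map ((LinearMap.toSpanSingleton R M t).restrictScalars k)
  have hle : ∀ γ, 𝒲 γ ≤ ℳ γ := by
    refine fun γ => iSup_le fun t => iSup_le fun n => ?_
    rintro _ ⟨r, hr, rfl⟩
    have := hsmul n _ r t hr (hδ t t.2)
    rw [n.2] at this
    simpa using this
  have hmem : ∀ t ∈ T, ∀ r : R, r • t ∈ ⨆ γ, 𝒲 γ := by
    intro t ht r
    have hr : r ∈ ⨆ n, 𝒜 n :=
      (DirectSum.Decomposition.isInternal 𝒜).submodule_iSup_eq_top ▸ Submodule.mem_top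
    have : ⨆ n, 𝒜 n ≤
        (⨆ γ, 𝒲 γ).comap ((LinearMap.toSpanSingleton R M t).restrictScalars k) := by
      refine iSup_le fun n => Submodule.map_le_iff_le_comap.mp ?_
      exact le_iSup_of_le ((n : ℚ) + δ t) (le_iSup_of_le ⟨t, ht⟩ (le_iSup_of_le ⟨n, rfl⟩ le_rfl))
    simpa using this hr
  have htop : ⨆ γ, 𝒲 γ = ⊤ := by
    refine eq_top_iff.mpr fun m _ => ?_
    have hm : m ∈ Submodule.span R (T : Set M) := by
      rw [← hTspan, hspan]
      exact Submodule.mem_top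
    obtain ⟨f, -, rfl⟩ := Submodule.mem_span_finset.mp hm
    exact sum_mem fun t ht => hmem t ht (f t)
  refine degLE_le ℳ fun γ hγ => ?_
  rw [← iSupIndep.eq_of_le_of_iSup_eq_top ℳ hinternal.submodule_iSupIndep hle htop γ]
  refine iSup_mono fun t => iSup_le fun n => ?_
  exact le_iSup (fun n : {n : ℕ // (n : ℚ) + δ t ≤ β} =>
    (𝒜 n).map ((LinearMap.toSpanSingleton R M (t : M)).restrictScalars k)) ⟨n, n.2.trans_le hγ⟩

lemma finite_degLE [IsNoetherianRing R] (h0 : 𝒜 0 = Submodule.span k {1}) [Module.Finite R M]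
    (hinternal : DirectSum.IsInternal ℳ)
    (hsmul : ∀ (n : ℕ) (α : ℚ) (r : R) (m : M), r ∈ 𝒜 n → m ∈ ℳ α → r • m ∈ ℳ ((n : ℚ) + α))
    (β : ℚ) : Module.Finite k (degLE ℳ β) := by
  obtain ⟨T, δ, h⟩ := exists_homogeneous_generators 𝒜 ℳ hinternal hsmul
  have hfin : ∀ t : T, Finite {n : ℕ // (n : ℚ) + δ t ≤ β} := fun t => by
    refine Set.Finite.subset (Set.finite_Iic ⌈β - δ t⌉₊) fun n hn => ?_
    have h1 : (n : ℚ) + δ t ≤ β := hn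
    have h2 : (n : ℚ) ≤ ⌈β - δ t⌉₊ := (le_sub_iff_add_le.mpr h1).trans (Nat.le_ceil _)
    exact_mod_cast h2
  have hA := finite_gradedPiece 𝒜 h0
  have : Module.Finite k (⨆ t : T, ⨆ n : {n : ℕ // (n : ℚ) + δ t ≤ β},
      (𝒜 n).map ((LinearMap.toSpanSingleton R M (t : M)).restrictScalars k) :
        Submodule k M) := inferInstance
  exact Submodule.finiteDimensional_of_le (h β)

/-- A linear map out of a finitely generated graded module raises degrees by a bounded amount. -/
lemma exists_degree_bound {M' : Type*} [AddCommGroup M'] [Module R M'] [Module k M']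
    [IsScalarTower k R M'] (ℳ' : ℚ → Submodule k M') [Module.Finite R M]
    (hinternal : DirectSum.IsInternal ℳ)
    (hsmul : ∀ (n : ℕ) (α : ℚ) (r : R) (m : M), r ∈ 𝒜 n → m ∈ ℳ α → r • m ∈ ℳ ((n : ℚ) + α))
    (hinternal' : DirectSum.IsInternal ℳ')
    (hsmul' : ∀ (n : ℕ) (α : ℚ) (r : R) (m : M'),
      r ∈ 𝒜 n → m ∈ ℳ' α → r • m ∈ ℳ' ((n : ℚ) + α))
    (g : M →ₗ[R] M') : ∃ c : ℚ, ∀ β, ∀ m ∈ degLE ℳ β, g m ∈ degLE ℳ' (β + c) := by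
  obtain ⟨T, δ, h⟩ := exists_homogeneous_generators 𝒜 ℳ hinternal hsmul
  choose ε hε using fun m : M => exists_mem_degLE ℳ' hinternal'.submodule_iSup_eq_top (g m)
  obtain ⟨c, hc⟩ := (T.image fun t => ε t - δ t).bddAbove
  refine ⟨c, fun β m hm => ?_⟩
  have hle : degLE ℳ β ≤ (degLE ℳ' (β + c)).comap (g.restrictScalars k) := by
    refine (h β).trans (iSup_le fun t => iSup_le fun n => ?_)
    rintro _ ⟨r, hr, rfl⟩
    have hct : ε t - δ t ≤ c := hc (by simpa using ⟨t, t.2, rfl⟩)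
    have hn := n.2
    have := degLE_mono ℳ' (show (n : ℚ) + ε t ≤ β + c by linarith)
      (smul_mem_degLE 𝒜 ℳ' hsmul' hr (hε t))
    simpa using this
  exact hle hm

end GradedModule

section DegreeScaling

variable {R : Type*} [CommRing R] [Algebra k R] (𝒜 : ℕ → Submodule k R)
  {M : Type*} [AddCommGroup M] [Module k M] (ℳ : ℚ → Submodule k M)

lemma map_mem_degLE {q : ℚ} (hq : 0 < q) {α D : ℚ} (f : R →+ M)
    (hf : ∀ (d : ℕ) (y : R), y ∈ 𝒜 d → f y ∈ ℳ (α + (d : ℚ) / q))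
    {n : ℕ} (hn : (n : ℚ) ≤ q * D) {y : R} (hy : y ∈ degLE 𝒜 n) : f y ∈ degLE ℳ (α + D) := by
  refine Submodule.iSup_induction _ (motive := fun y => f y ∈ degLE ℳ (α + D)) hy
    (fun d y hy => le_degLE ℳ ?_ (hf d y hy)) (by simp) fun y z hy hz => ?_
  · have h1 : ((d : ℕ) : ℚ) ≤ n := by exact_mod_cast d.2
    have : ((d : ℕ) : ℚ) / q ≤ D := by
      rw [div_le_iff₀' hq]
      exact h1.trans hn
    linarith
  · rw [map_add]
    exact add_mem hy hz

/-- If an additive map sends the degree `d` piece of `R` into degree `α + d / q`, and hits a nonzero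
homogeneous element of degree `β`, then `α ≤ β`. -/
lemma shift_le_of_apply_mem [GradedAlgebra 𝒜] {q : ℚ} (hq : 0 ≤ q) {α β : ℚ}
    (hind : iSupIndep ℳ) (f : R →+ M)
    (hf : ∀ (d : ℕ) (y : R), y ∈ 𝒜 d → f y ∈ ℳ (α + (d : ℚ) / q))
    {y : R} (hy : f y ∈ ℳ β) (hne : f y ≠ 0) : α ≤ β := by
  classical
  by_contra! hlt
  refine hne (Submodule.disjoint_def.mp (hind β) _ hy ?_)
  rw [← DirectSum.sum_support_decompose 𝒜 y, map_sum]
  refine sum_mem fun d _ => ?_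
  have hd : α + (d : ℚ) / q ≠ β := by
    have : 0 ≤ (d : ℚ) / q := by positivity
    linarith
  exact le_iSup₂ (f := fun j (_ : j ≠ β) => ℳ j) _ hd (hf d _ (Subtype.prop _))

end DegreeScaling

end Filtration

section FrobeniusImages

variable {R : Type*} [CommRing R] {M : Type*} [AddCommGroup M] [Module R M]

lemma apply_mem_frobIe {p e : ℕ} {φ : R →+ M} (hφ : ∀ r y : R, φ (r ^ p ^ e * y) = r • φ y)
    (a : R) : φ a ∈ frobIe p e R M (Ideal.span {a}) :=
  Submodule.subset_span ⟨φ, hφ, a, Ideal.mem_span_singleton_self a, rfl⟩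

lemma frobIe_span_singleton_le {p e : ℕ} {a : R} {N : Submodule R M}
    (h : ∀ φ : R →+ M, (∀ r y : R, φ (r ^ p ^ e * y) = r • φ y) → φ a ∈ N) :
    frobIe p e R M (Ideal.span {a}) ≤ N := by
  refine Submodule.span_le.mpr ?_
  rintro _ ⟨φ, hφ, y, hy, rfl⟩
  obtain ⟨c, rfl⟩ := Ideal.mem_span_singleton'.mp hy
  refine h (φ.comp (AddMonoidHom.mulLeft c)) fun r y => ?_
  simp only [AddMonoidHom.comp_apply, AddMonoidHom.coe_mulLeft]
  rw [mul_left_comm, hφ]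

lemma frobIe_antitone {p : ℕ} (hp : p.Prime) [CharP R p] (x : R) :
    Antitone fun e => frobIe p e R M (Ideal.span {x ^ (p ^ e - 1)}) := by
  have : Fact p.Prime := ⟨hp⟩
  refine antitone_nat_of_succ_le fun e => frobIe_span_singleton_le fun φ hφ => ?_
  have hexp : p ^ (e + 1) - 1 = (p - 1) + (p ^ e - 1) * p := by
    have h1 : 1 ≤ p ^ e := Nat.one_le_pow _ _ hp.pos
    have h2 : p ≤ p ^ e * p := Nat.le_mul_of_pos_left p h1
    have h3 := hp.pos
    rw [pow_succ, Nat.sub_mul, one_mul]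
    omega
  have := apply_mem_frobIe (p := p) (e := e)
    (φ := φ.comp ((AddMonoidHom.mulLeft (x ^ (p - 1))).comp (frobenius R p).toAddMonoidHom))
    (fun r y => by
      simp only [AddMonoidHom.comp_apply, AddMonoidHom.coe_mulLeft, RingHom.toAddMonoidHom_eq_coe,
        AddMonoidHom.coe_coe, frobenius_def]
      rw [mul_pow, ← pow_mul, ← pow_succ, mul_left_comm, hφ]) (x ^ (p ^ e - 1))
  simpa [frobenius_def, ← pow_mul, ← pow_add, hexp] using this

end FrobeniusImages

/-- A descending chain of submodules generated by elements of a fixed finite-dimensional subspace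
stabilizes. -/
lemma exists_eq_of_antitone_of_generated {k R M : Type*} [Field k] [CommRing R] [Algebra k R]
    [AddCommGroup M] [Module R M] [Module k M] [IsScalarTower k R M] (I : ℕ → Submodule R M)
    (hI : Antitone I) (F : Submodule k M) [Module.Finite k F]
    (hF : ∀ e, I e ≤ Submodule.span R {m | m ∈ I e ∧ m ∈ F}) :
    ∃ n, ∀ e, n ≤ e → I e = I n := by
  let f : ℕ →o (Submodule k F)ᵒᵈ :=
    ⟨fun e => OrderDual.toDual (((I e).restrictScalars k).comap F.subtype),
      fun a b h => OrderDual.toDual_le_toDual.mpr (Submodule.comap_mono (hI h))⟩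
  obtain ⟨n, hn⟩ := IsArtinian.monotone_stabilizes f
  refine ⟨n, fun e he => (hI he).antisymm ((hF n).trans (Submodule.span_le.mpr ?_))⟩
  rintro m ⟨hm, hmF⟩
  have heq : ((I n).restrictScalars k).comap F.subtype =
      ((I e).restrictScalars k).comap F.subtype := hn e he
  have : (⟨m, hmF⟩ : F) ∈ ((I n).restrictScalars k).comap F.subtype := hm
  rw [heq] at this
  exact this

/-- Let `R = ⨁_{n ≥ 0} R_n` be a Noetherian graded ring with
`R_0 = k` a field of characteristic `p > 0`, and assume `R` has finite graded
F-representation type by finitely generated `ℚ`-graded `R`-modules `M_1, …, M_s`: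
for every `e` there are multiplicities `m`, shifts `α` and an isomorphism
`ᵉR ≅ ⨁_{i,j} M_i(α_{ij}^{(e)})` of `ℚ`-graded `R`-modules (where `ᵉR` carries its
`1/pᵉ`-th grading).  Then for every `x ∈ R` and every `i`, the descending chain
`I_1(x^{p-1}, M_i) ⊇ I_2(x^{p²-1}, M_i) ⊇ ⋯` stabilizes: there is `e₀ ≥ 1` with
`I_e(x^{pᵉ-1}, M_i) = I_{e₀}(x^{p^{e₀}}-1}, M_i)` for all `e ≥ e₀`. -/
theorem stmt0 {k : Type u} [Field k] {R : Type u} [CommRing R] [Algebra k R]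
    [IsNoetherianRing R]
    -- the grading of `R`, with `R_0 = k`:
    (𝒜 : ℕ → Submodule k R) [GradedAlgebra 𝒜]
    (h0 : 𝒜 0 = Submodule.span k {1})
    (p : ℕ) (hp : p.Prime) [CharP R p]
    -- the finitely generated `ℚ`-graded modules `M_1, …, M_s`:
    (s : ℕ) (M : Fin s → Type u) [∀ i, AddCommGroup (M i)] [∀ i, Module R (M i)]
    [∀ i, Module k (M i)] [∀ i, IsScalarTower k R (M i)]
    (ℳ : ∀ i, ℚ → Submodule k (M i))
    (hfg : ∀ i, Module.Finite R (M i))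
    (hinternal : ∀ i, DirectSum.IsInternal (ℳ i))
    (hsmul : ∀ (i : Fin s) (n : ℕ) (α : ℚ) (r : R) (m : M i),
      r ∈ 𝒜 n → m ∈ ℳ i α → r • m ∈ ℳ i ((n : ℚ) + α))
    -- finite graded F-representation type by the `M_i`:
    (hFFRT : ∀ e : ℕ, ∃ (m : Fin s → ℕ) (α : ∀ i, Fin (m i) → ℚ)
      (ψ : R ≃+ ⨁ ij : (Σ i : Fin s, Fin (m i)), M ij.1),
        (∀ r y : R, ψ (r ^ p ^ e * y) = r • ψ y) ∧
        ∀ (d : ℕ) (y : R), y ∈ 𝒜 d → ∀ ij,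
          (ψ y) ij ∈ ℳ ij.1 (α ij.1 ij.2 + (d : ℚ) / (p : ℚ) ^ e)) :
    ∀ (x : R) (i : Fin s), ∃ e₀ : ℕ, 1 ≤ e₀ ∧ ∀ e : ℕ, e₀ ≤ e →
      frobIe p e R (M i) (Ideal.span {x ^ (p ^ e - 1)}) =
        frobIe p e₀ R (M i) (Ideal.span {x ^ (p ^ e₀ - 1)}) := by
  intro x i
  choose m α ψ hψ hdeg using hFFRT
  have hG : ∀ j, ∃ G : Finset (M j →ₗ[R] M i), Submodule.span R (G : Set (M j →ₗ[R] M i)) = ⊤ :=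
    fun j => (Module.Finite.fg_top : (⊤ : Submodule R (M j →ₗ[R] M i)).FG)
  choose G hG using hG
  have hbound : ∀ j (g : M j →ₗ[R] M i), ∃ c : ℚ, ∀ β, ∀ z ∈ degLE (ℳ j) β,
      g z ∈ degLE (ℳ i) (β + c) := fun j g =>
    exists_degree_bound 𝒜 (ℳ j) (ℳ i) (hinternal j) (hsmul j) (hinternal i) (hsmul i) g
  choose c hc using hbound
  -- the shifts are bounded above uniformly in `e`
  have hshift : ∀ j, ∃ β : ℚ, Subsingleton (M j) ∨ ∀ e l, α e j l ≤ β := by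
    intro j
    by_cases hj : ∃ β, ∃ z ∈ ℳ j β, z ≠ 0
    · obtain ⟨β, z, hz, hz0⟩ := hj
      refine ⟨β, Or.inr fun e l => ?_⟩
      let f : R →+ M j := (DFinsupp.evalAddMonoidHom (β := fun ij : Σ i, Fin (m e i) => M ij.1)
        ⟨j, l⟩).comp (ψ e).toAddMonoidHom
      have hf : f ((ψ e).symm (DirectSum.of (fun ij : Σ i, Fin (m e i) => M ij.1) ⟨j, l⟩ z))
          = z := by
        change (ψ e ((ψ e).symm (DirectSum.of (fun ij : Σ i, Fin (m e i) => M ij.1) ⟨j, l⟩ z)))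
          ⟨j, l⟩ = z
        rw [AddEquiv.apply_symm_apply]
        exact DirectSum.of_eq_same _ _
      exact shift_le_of_apply_mem 𝒜 (ℳ j) (q := (p : ℚ) ^ e) (by positivity)
        (hinternal j).submodule_iSupIndep f (fun d y hy => hdeg e d y hy ⟨j, l⟩)
        (hf.symm ▸ hz) (hf.symm ▸ hz0)
    · push Not at hj
      refine ⟨0, Or.inl ?_⟩
      have hbot : (⊤ : Submodule k (M j)) = ⊥ := by
        rw [← (hinternal j).submodule_iSup_eq_top]
        exact iSup_eq_bot.mpr fun β => (Submodule.eq_bot_iff _).mpr (hj β)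
      exact (Submodule.subsingleton_iff k).mp (subsingleton_of_bot_eq_top hbot.symm)
  choose β hβ using hshift
  obtain ⟨D, hD⟩ := exists_mem_degLE 𝒜
    (DirectSum.Decomposition.isInternal 𝒜).submodule_iSup_eq_top x
  obtain ⟨N, hN⟩ : ∃ N : ℚ, ∀ j, ∀ g ∈ G j, β j + D + c j g ≤ N := by
    let d : (Σ j, M j →ₗ[R] M i) → ℚ := fun jg => β jg.1 + D + c jg.1 jg.2
    obtain ⟨N, hN⟩ := ((Finset.univ.sigma G).image d).bddAbove
    exact ⟨N, fun j g hg => hN (Finset.mem_coe.mpr (Finset.mem_image.mpr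
      ⟨⟨j, g⟩, Finset.mem_sigma.mpr ⟨Finset.mem_univ j, hg⟩, rfl⟩))⟩
  have hfin : Module.Finite k (degLE (ℳ i) N) :=
    finite_degLE 𝒜 (ℳ i) h0 (hinternal i) (hsmul i) N
  have hanti := frobIe_antitone (M := M i) hp x
  suffices hgenerated : ∀ e, frobIe p e R (M i) (Ideal.span {x ^ (p ^ e - 1)}) ≤
      Submodule.span R {z | z ∈ frobIe p e R (M i) (Ideal.span {x ^ (p ^ e - 1)}) ∧
        z ∈ degLE (ℳ i) N} by
    obtain ⟨n, hn⟩ := exists_eq_of_antitone_of_generated _ hanti (degLE (ℳ i) N) hgenerated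
    exact ⟨max n 1, le_max_right _ _, fun e he =>
      (hn e ((le_max_left _ _).trans he)).trans (hn _ (le_max_left _ _)).symm⟩
  intro e
  refine frobIe_span_singleton_le fun φ hφ => ?_
  set a := x ^ (p ^ e - 1)
  have hq : (0 : ℚ) < (p : ℚ) ^ e := pow_pos (by exact_mod_cast hp.pos) e
  have hadeg : a ∈ degLE 𝒜 ((p ^ e - 1) * D) := degLE_pow_mem 𝒜 hD _
  have hgen : ∀ (ij : Σ j, Fin (m e j)), ∀ g ∈ G ij.1,
      g (ψ e a ij) ∈ frobIe p e R (M i) (Ideal.span {a}) ∧ g (ψ e a ij) ∈ degLE (ℳ i) N := by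
    intro ij g hg
    let f : R →+ M ij.1 := (DFinsupp.evalAddMonoidHom (β := fun ij : Σ i, Fin (m e i) => M ij.1)
        ij).comp (ψ e).toAddMonoidHom
    constructor
    · refine apply_mem_frobIe (φ := g.toAddMonoidHom.comp f) (fun r y => ?_) a
      change g (ψ e (r ^ p ^ e * y) ij) = r • g (ψ e y ij)
      rw [hψ, DirectSum.smul_apply, map_smul]
    · rcases hβ ij.1 with hsub | hle
      · rw [Subsingleton.elim (ψ e a ij) 0, map_zero]
        exact zero_mem _
      · have hz : ψ e a ij ∈ degLE (ℳ ij.1) (α e ij.1 ij.2 + D) := by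
          refine map_mem_degLE 𝒜 (ℳ ij.1) hq f (fun d y hy => hdeg e d y hy ij) ?_ hadeg
          have : (p ^ e - 1) * D ≤ p ^ e * D := Nat.mul_le_mul_right _ (Nat.sub_le _ _)
          exact_mod_cast this
        refine degLE_mono (ℳ i) ?_ (hc ij.1 g _ _ hz)
        have h1 := hN ij.1 g hg
        have h2 := hle e ij.2
        linarith
  set P := Submodule.span R {z | z ∈ frobIe p e R (M i) (Ideal.span {a}) ∧ z ∈ degLE (ℳ i) N}
  let Φ : (⨁ ij : (Σ j : Fin s, Fin (m e j)), M ij.1) →ₗ[R] M i :=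
    { (φ.comp (ψ e).symm.toAddMonoidHom) with
      map_smul' := fun r z => by
        change φ ((ψ e).symm (r • z)) = r • φ ((ψ e).symm z)
        rw [← hφ]
        congr 1
        rw [AddEquiv.symm_apply_eq, hψ, AddEquiv.apply_symm_apply] }
  have hΦ : φ a = Φ (ψ e a) := by
    change φ a = φ ((ψ e).symm (ψ e a))
    rw [AddEquiv.symm_apply_apply]
  classical
  rw [hΦ, ← DirectSum.sum_support_of (ψ e a), map_sum]
  refine sum_mem fun ij _ => ?_
  let h : M ij.1 →ₗ[R] M i := Φ.comp
    (DirectSum.lof R (Σ j : Fin s, Fin (m e j)) (fun ij => M ij.1) ij)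
  have hh : h ∈ Submodule.span R (G ij.1 : Set (M ij.1 →ₗ[R] M i)) := hG ij.1 ▸ Submodule.mem_top
  change h (ψ e a ij) ∈ P
  have hle : Submodule.span R (G ij.1 : Set (M ij.1 →ₗ[R] M i)) ≤
      P.comap (LinearMap.applyₗ (ψ e a ij)) :=
    Submodule.span_le.mpr fun g hg => Submodule.subset_span (hgen ij g hg)
  exact hle hh
end

section
/- Let R = ⨁_{n≥0} R_n be a Noetherian graded ring with k := R_0 a field of characteristic p > 0, and let K be the perfect closure of k. If R_K := R ⊗_k K has finite graded F-representation type, then for every non-zerodivisor x ∈ R, the localization R_x is generated by 1/x as a D_{R/k}-module, i.e., D_{R/k}·(1/x) = R_x. -/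
/-!
Statement 1: Let `R = ⨁_{n≥0} R_n` be a Noetherian graded ring with `k := R_0` a field
of characteristic `p > 0` and `K` the perfect closure of `k`.  If `R_K = R ⊗_k K` has
finite graded F-representation type, then for every non-zerodivisor `x ∈ R` the
localization `R_x` is generated by `1/x` as a `D_{R/k}`-module.
-/

open scoped DirectSum TensorProduct

universe u v

section Defs

variable (k : Type v) (R : Type u) [CommSemiring k] [CommRing R] [Algebra k R]

/-- The `k`-linear differential operators on `R` of order at most `n`:
`D⁻¹ = 0` and `D^{n+1} = {δ | [δ, r] ∈ D^n for all r ∈ R}`. -/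
def diffOpsLe : ℕ → Set (R →ₗ[k] R)
  | 0 => {δ | ∀ r : R,
      δ.comp (LinearMap.mulLeft k r) - (LinearMap.mulLeft k r).comp δ = 0}
  | n + 1 => {δ | ∀ r : R,
      δ.comp (LinearMap.mulLeft k r) - (LinearMap.mulLeft k r).comp δ ∈ diffOpsLe n}

/-- The ring of `k`-linear differential operators `D_{R/k} = ⋃_n D^n_{R/k}`. -/
def DiffOps : Set (R →ₗ[k] R) :=
  {δ | ∃ n : ℕ, δ ∈ diffOpsLe k R n}

/-- A witness for finite *graded* F-representation type of an `ℕ`-graded ring `R`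
(graded by `k₀`-submodules `𝒜`), by finitely generated `ℚ`-graded modules. -/
structure GradedFFRTWitness (p : ℕ) (k₀ : Type v) (S : Type u) [CommSemiring k₀]
    [CommRing S] [Algebra k₀ S] (𝒜 : ℕ → Submodule k₀ S) : Type (max (u + 1) (v + 1)) where
  s : ℕ
  M : Fin s → Type u
  [acg : ∀ i, AddCommGroup (M i)]
  [modR : ∀ i, Module S (M i)]
  [modk : ∀ i, Module k₀ (M i)]
  [tower : ∀ i, IsScalarTower k₀ S (M i)]
  /-- the `ℚ`-grading of each `M i` -/
  ℳ : ∀ i, ℚ → Submodule k₀ (M i)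
  fin : ∀ i, Module.Finite S (M i)
  internal : ∀ i, DirectSum.IsInternal (ℳ i)
  smul_mem : ∀ (i : Fin s) (n : ℕ) (α : ℚ) (r : S) (m : M i),
    r ∈ 𝒜 n → m ∈ ℳ i α → r • m ∈ ℳ i ((n : ℚ) + α)
  /-- for every `e` there are multiplicities `n`, shifts `α` and a degree-preserving
  isomorphism `ᵉS ≅ ⨁_{i,j} M_i(α_{ij})` of `ℚ`-graded `S`-modules. -/
  decomp : ∀ e : ℕ, ∃ (n : Fin s → ℕ) (α : ∀ i, Fin (n i) → ℚ)
    (ψ : S ≃+ ⨁ ij : (Σ i : Fin s, Fin (n i)), M ij.1),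
      (∀ r y : S, ψ (r ^ p ^ e * y) = r • ψ y) ∧
      ∀ (d : ℕ) (y : S), y ∈ 𝒜 d → ∀ ij : Σ i : Fin s, Fin (n i),
        (ψ y) ij ∈ ℳ ij.1 (α ij.1 ij.2 + (d : ℚ) / (p : ℚ) ^ e)

/-- `S` has finite graded F-representation type. -/
def HasGradedFFRT (p : ℕ) (k₀ : Type v) (S : Type u) [CommSemiring k₀] [CommRing S]
    [Algebra k₀ S] (𝒜 : ℕ → Submodule k₀ S) : Prop :=
  Nonempty (GradedFFRTWitness p k₀ S 𝒜)

end Defs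

/-- The left-right action of `R ⊗ R` on `k`-linear endomorphisms of `R`. -/
noncomputable def tensorActEnd (k : Type v) (R : Type u) [CommRing k] [CommRing R] [Algebra k R] :
    R ⊗[k] R →ₐ[k] Module.End k (Module.End k R) :=
  Algebra.TensorProduct.lift
    ((Algebra.lmul k (Module.End k R)).comp (Algebra.lmul k R))
    (AlgHom.ofLinearMap
      ((LinearMap.mul k (Module.End k R)).flip.comp (Algebra.lmul k R).toLinearMap)
      (by ext; simp)
      (by intro r s; rw [mul_comm r s]; ext; simp [mul_assoc]))
    (fun _ _ => (commute_iff_eq _ _).2 (by ext; simp [mul_assoc]))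

section DiffOps

variable {k : Type v} {R : Type u} [CommRing k] [CommRing R] [Algebra k R]

lemma tensorActEnd_tmul (r s : R) (δ : Module.End k R) (z : R) :
    tensorActEnd k R (r ⊗ₜ s) δ z = r * δ (s * z) := by
  rw [tensorActEnd, Algebra.TensorProduct.lift_tmul]
  rfl

lemma tensorActEnd_one_tmul_sub (r : R) (δ : Module.End k R) :
    tensorActEnd k R (1 ⊗ₜ r - r ⊗ₜ 1) δ =
      δ.comp (LinearMap.mulLeft k r) - (LinearMap.mulLeft k r).comp δ := by
  ext z
  simp [tensorActEnd_tmul]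

lemma mem_diffOpsLe_of_ideal_pow {n : ℕ} {δ : R →ₗ[k] R}
    (h : ∀ t ∈ KaehlerDifferential.ideal k R ^ (n + 1), tensorActEnd k R t δ = 0) :
    δ ∈ diffOpsLe k R n := by
  induction n generalizing δ with
  | zero =>
    intro r
    rw [← tensorActEnd_one_tmul_sub]
    exact h _ (by simp)
  | succ n ih =>
    intro r
    rw [← tensorActEnd_one_tmul_sub]
    refine ih fun t ht => ?_
    rw [← Module.End.mul_apply, ← map_mul]
    refine h _ ?_
    rw [pow_succ]
    exact Ideal.mul_mem_mul ht (KaehlerDifferential.one_smul_sub_smul_one_mem_ideal k r)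

/-- In characteristic `p`, an endomorphism of a finitely generated algebra that is linear over
`pᵉ`-th powers is a differential operator. -/
lemma mem_DiffOps_of_pow_linear [Algebra.FiniteType k R] (p : ℕ) (hp : p.Prime) [CharP R p]
    (e : ℕ) (δ : R →ₗ[k] R) (h : ∀ r z : R, δ (r ^ p ^ e * z) = r ^ p ^ e * δ z) :
    δ ∈ DiffOps k R := by
  have : Fact p.Prime := ⟨hp⟩
  have : CharP (R ⊗[k] R) p := by
    refine charP_of_injective_algebraMap (R := R) (fun a b hab => ?_) p
    simpa using congrArg (Algebra.TensorProduct.lmul' k (S := R)) hab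
  let J : Ideal (R ⊗[k] R) :=
    { carrier := {t | tensorActEnd k R t δ = 0}
      add_mem' := fun {a b} ha hb => by
        simp only [Set.mem_ofPred_eq] at *
        simp [ha, hb]
      zero_mem' := by simp
      smul_mem' := fun c t ht => by
        simp only [Set.mem_ofPred_eq] at *
        simp [ht] }
  have hrad : KaehlerDifferential.ideal k R ≤ J.radical := by
    rw [← KaehlerDifferential.span_range_eq_ideal, Ideal.span_le]
    rintro _ ⟨r, rfl⟩
    refine ⟨p ^ e, ?_⟩
    change tensorActEnd k R ((1 ⊗ₜ r - r ⊗ₜ 1) ^ p ^ e) δ = 0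
    rw [sub_pow_char_pow]
    simp only [Algebra.TensorProduct.tmul_pow, one_pow]
    rw [tensorActEnd_one_tmul_sub]
    ext z
    simp [h]
  obtain ⟨n, hn⟩ := Ideal.exists_pow_le_of_le_radical_of_fg hrad
    (KaehlerDifferential.ideal_fg k R)
  exact ⟨n, mem_diffOpsLe_of_ideal_pow fun t ht => hn (Ideal.pow_le_pow_right (n.le_succ) ht)⟩

end DiffOps

section Graded

variable {k : Type v} {R : Type u} [Field k] [CommRing R] [Algebra k R] [IsNoetherianRing R]
  (𝒜 : ℕ → Submodule k R) [GradedAlgebra 𝒜]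

lemma exists_homogeneous_generators_s1 :
    ∃ (T : Finset R) (d : R → ℕ), (∀ t ∈ T, 0 < d t) ∧
      ∀ n, 0 < n → ∀ y ∈ 𝒜 n, ∃ c : R → R,
        (∀ t, c t ∈ 𝒜 (n - d t)) ∧ y = ∑ t ∈ T, c t * t := by
  classical
  let X : Set R := {t | ∃ n, 0 < n ∧ t ∈ 𝒜 n}
  obtain ⟨T, hTX, hT⟩ := (Submodule.fg_span_iff_fg_span_finset_subset X).1
    (IsNoetherian.noetherian (Ideal.span X))
  have hX : ∀ t ∈ T, ∃ n, 0 < n ∧ t ∈ 𝒜 n := fun t ht => hTX ht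
  choose! d hd hdm using hX
  refine ⟨T, d, hd, fun n hn y hy => ?_⟩
  have hyT : y ∈ Submodule.span R (T : Set R) := by
    rw [← hT]
    exact Submodule.subset_span ⟨n, hn, hy⟩
  obtain ⟨a, -, ha⟩ := Submodule.mem_span_finset.1 hyT
  refine ⟨fun t => if d t ≤ n then (DirectSum.decompose 𝒜 (a t) (n - d t) : R) else 0,
    fun t => ?_, ?_⟩
  · dsimp only
    split_ifs
    · exact SetLike.coe_mem _
    · exact zero_mem _
  · have hy' : y = GradedRing.proj 𝒜 n y := by
      rw [GradedRing.proj_apply, DirectSum.decompose_of_mem_same 𝒜 hy]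
    rw [hy', ← ha, map_sum]
    refine Finset.sum_congr rfl fun t ht => ?_
    rw [GradedRing.proj_apply, smul_eq_mul,
      DirectSum.coe_decompose_mul_of_right_mem 𝒜 n (hdm t ht)]
    split_ifs with h <;> simp [h]

lemma finite_graded_piece (h0 : 𝒜 0 = Submodule.span k {1}) (n : ℕ) :
    Module.Finite k (𝒜 n) := by
  obtain ⟨T, d, hd, hT⟩ := exists_homogeneous_generators_s1 𝒜
  induction n using Nat.strong_induction_on with
  | _ n ih =>
    rcases Nat.eq_zero_or_pos n with rfl | hn
    · rw [h0]
      infer_instance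
    · have hfin : Module.Finite k
          (⨆ t : T, (𝒜 (n - d t)).map (LinearMap.mulRight k (t : R)) : Submodule k R) := by
        have (t : T) : Module.Finite k (𝒜 (n - d t)) :=
          ih _ (Nat.sub_lt hn (hd t t.2))
        infer_instance
      refine Submodule.finiteDimensional_of_le (S₂ := ⨆ t : T, (𝒜 (n - d t)).map
        (LinearMap.mulRight k (t : R))) fun y hy => ?_
      obtain ⟨c, hc, rfl⟩ := hT n hn y hy
      refine Submodule.sum_mem _ fun t ht => ?_
      exact Submodule.mem_iSup_of_mem ⟨t, ht⟩ ⟨c t, hc t, by simp⟩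

lemma finiteType_of_graded (h0 : 𝒜 0 = Submodule.span k {1}) : Algebra.FiniteType k R := by
  obtain ⟨T, d, hd, hT⟩ := exists_homogeneous_generators_s1 𝒜
  have key (n : ℕ) : 𝒜 n ≤ Subalgebra.toSubmodule (Algebra.adjoin k (T : Set R)) := by
    induction n using Nat.strong_induction_on with
    | _ n ih =>
      rcases Nat.eq_zero_or_pos n with rfl | hn
      · rw [h0, Submodule.span_le, Set.singleton_subset_iff]
        exact one_mem (Algebra.adjoin k (T : Set R))
      · intro y hy
        obtain ⟨c, hc, rfl⟩ := hT n hn y hy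
        refine Submodule.sum_mem _ fun t ht => ?_
        exact mul_mem (S := Subalgebra k R) (ih _ (Nat.sub_lt hn (hd t ht)) (hc t))
          (Algebra.subset_adjoin ht)
  refine ⟨⟨T, ?_⟩⟩
  rw [← Algebra.toSubmodule_eq_top, ← top_le_iff,
    ← (DirectSum.Decomposition.isInternal 𝒜).submodule_iSup_eq_top]
  exact iSup_le key

end Graded

section GradedModule

variable {K : Type v} {S : Type u} [Field K] [CommRing S] [Algebra K S]

/-- The part of degree at most `C` of a finitely generated `ℚ`-graded module is
finite-dimensional. -/
lemma finite_bounded_degree_part [IsNoetherianRing S] (𝒜 : ℕ → Submodule K S)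
    (htop : ⨆ n, 𝒜 n = ⊤) (hfin : ∀ n, Module.Finite K (𝒜 n))
    {M : Type*} [AddCommGroup M] [Module S M] [Module K M] [IsScalarTower K S M]
    [Module.Finite S M] (ℳ : ℚ → Submodule K M) (hℳ : DirectSum.IsInternal ℳ)
    (hsmul : ∀ (n : ℕ) (α : ℚ) (r : S) (m : M),
      r ∈ 𝒜 n → m ∈ ℳ α → r • m ∈ ℳ ((n : ℚ) + α)) (C : ℚ) :
    Module.Finite K (⨆ β ∈ Set.Iic C, ℳ β : Submodule K M) := by
  classical
  let X : Set M := {m | ∃ β, m ∈ ℳ β}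
  have hX : Submodule.span S X = ⊤ := by
    have : (⊤ : Submodule K M) ≤ (Submodule.span S X).restrictScalars K := by
      rw [← hℳ.submodule_iSup_eq_top]
      exact iSup_le fun β m hm => Submodule.subset_span ⟨β, hm⟩
    exact top_le_iff.1 fun m hm => this (Submodule.mem_top)
  obtain ⟨G, hGX, hG⟩ := (Submodule.fg_span_iff_fg_span_finset_subset X).1
    (IsNoetherian.noetherian (Submodule.span S X))
  rw [hX] at hG
  have hb : ∀ g ∈ G, ∃ β, g ∈ ℳ β := fun g hg => hGX hg
  choose! b hb using hb
  let act (g : M) : S →ₗ[K] M := (LinearMap.toSpanSingleton S M g).restrictScalars K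
  let A : Submodule K M := ⨆ i : {i : G × ℕ // (i.2 : ℚ) + b i.1 ≤ C},
    (𝒜 i.1.2).map (act i.1.1)
  let B : Submodule K M := ⨆ i : {i : G × ℕ // ¬ (i.2 : ℚ) + b i.1 ≤ C},
    (𝒜 i.1.2).map (act i.1.1)
  have hpiece (g : G) (n : ℕ) : (𝒜 n).map (act g) ≤ ℳ ((n : ℚ) + b g) := by
    rintro _ ⟨r, hr, rfl⟩
    exact hsmul n _ r g hr (hb g g.2)
  have hA : A ≤ ⨆ β ∈ Set.Iic C, ℳ β :=
    iSup_le fun i => (hpiece _ _).trans (le_biSup ℳ (show _ ∈ Set.Iic C from i.2))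
  have hB : B ≤ ⨆ β ∈ Set.Ioi C, ℳ β :=
    iSup_le fun i => (hpiece _ _).trans
      (le_biSup ℳ (show _ ∈ Set.Ioi C from not_le.1 i.2))
  have hAB : A ⊔ B = ⊤ := by
    rw [eq_top_iff]
    have hmem (g : G) (s : S) : s • (g : M) ∈ A ⊔ B := by
      have : (⊤ : Submodule K S) ≤ (A ⊔ B).comap (act g) := by
        rw [← htop]
        refine iSup_le fun n r hr => ?_
        by_cases h : (n : ℚ) + b g ≤ C
        · exact Submodule.mem_sup_left
            (Submodule.mem_iSup_of_mem ⟨(g, n), h⟩ (Submodule.mem_map_of_mem hr))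
        · exact Submodule.mem_sup_right
            (Submodule.mem_iSup_of_mem ⟨(g, n), h⟩ (Submodule.mem_map_of_mem hr))
      exact this (Submodule.mem_top (x := s))
    intro m _
    have hm : m ∈ Submodule.span S (G : Set M) := hG ▸ Submodule.mem_top
    obtain ⟨a, -, rfl⟩ := Submodule.mem_span_finset.1 hm
    exact Submodule.sum_mem _ fun g hg => hmem ⟨g, hg⟩ (a g)
  have hST : Disjoint (Set.Ioi C) (Set.Iic C) :=
    Set.disjoint_left.2 fun _ h h' => not_le.2 (Set.mem_Ioi.1 h) (Set.mem_Iic.1 h')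
  have hdisj : Disjoint B (⨆ β ∈ Set.Iic C, ℳ β) :=
    Disjoint.mono_left hB (hℳ.submodule_iSupIndep.disjoint_biSup_biSup hST)
  have hEq : (⨆ β ∈ Set.Iic C, ℳ β) = A := by
    have := sup_inf_assoc_of_le B hA
    rwa [hAB, hdisj.eq_bot, top_inf_eq, sup_bot_eq] at this
  rw [hEq]
  have : Finite {i : G × ℕ // (i.2 : ℚ) + b i.1 ≤ C} :=
    Finite.of_injective
      (β := Σ g : G, Fin (⌊C - b g⌋₊ + 1))
      (fun i => ⟨i.1.1, i.1.2, Nat.lt_succ_of_le (Nat.le_floor (by linarith [i.2]))⟩) (by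
        rintro ⟨⟨g, n⟩, h⟩ ⟨⟨g', n'⟩, h'⟩ hh
        simp only [Sigma.mk.injEq] at hh
        obtain ⟨rfl, hh⟩ := hh
        simpa using hh)
  have (i : {i : G × ℕ // (i.2 : ℚ) + b i.1 ≤ C}) :
      Module.Finite K ((𝒜 i.1.2).map (act i.1.1)) := Module.Finite.map _ _
  exact Submodule.finite_iSup _

lemma exists_pow_mem_bounded_degree (𝒜 : ℕ → Submodule K S) [GradedAlgebra 𝒜] (x : S) :
    ∃ D : ℕ, ∀ m : ℕ, x ^ m ∈ ⨆ n ∈ Set.Iic (m * D), 𝒜 n := by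
  classical
  have hmul (a b : ℕ) : (⨆ n ∈ Set.Iic a, 𝒜 n) * (⨆ n ∈ Set.Iic b, 𝒜 n) ≤
      ⨆ n ∈ Set.Iic (a + b), 𝒜 n := by
    simp only [Submodule.iSup_mul, Submodule.mul_iSup, iSup_le_iff]
    intro j hj i hi
    rw [Submodule.mul_le]
    intro r hr s hs
    exact Submodule.mem_iSup_of_mem (i + j) (Submodule.mem_iSup_of_mem
      (Set.mem_Iic.2 (add_le_add hi hj)) (SetLike.mul_mem_graded hr hs))
  let D := (DirectSum.decompose 𝒜 x).support.sup id
  have hx : x ∈ ⨆ n ∈ Set.Iic D, 𝒜 n := by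
    rw [← DirectSum.sum_support_decompose 𝒜 x]
    refine Submodule.sum_mem _ fun i hi => ?_
    exact Submodule.mem_iSup_of_mem i (Submodule.mem_iSup_of_mem
      (Set.mem_Iic.2 (Finset.le_sup (f := id) hi)) (SetLike.coe_mem _))
  refine ⟨D, fun m => ?_⟩
  induction m with
  | zero =>
    exact Submodule.mem_iSup_of_mem 0 (Submodule.mem_iSup_of_mem
      (Set.mem_Iic.2 (Nat.zero_le _)) (by simpa using SetLike.one_mem_graded 𝒜))
  | succ m ih =>
    rw [pow_succ, add_mul, one_mul]
    exact hmul _ _ (Submodule.mul_mem_mul ih hx)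

end GradedModule

section PowEval

variable {S : Type*} [CommRing S]

/-- The values at `x ^ (pᵉ - 1)` of the `S`-linear maps `ᵉS → M`. -/
def powEval (p e : ℕ) (x : S) (M : Type*) [AddCommGroup M] [Module S M] : Submodule S M where
  carrier := {m | ∃ φ : S →+ M, (∀ r y, φ (r ^ p ^ e * y) = r • φ y) ∧ φ (x ^ (p ^ e - 1)) = m}
  add_mem' := by
    rintro _ _ ⟨φ, hφ, rfl⟩ ⟨φ', hφ', rfl⟩
    exact ⟨φ + φ', fun r y => by simp [hφ, hφ'], rfl⟩
  zero_mem' := ⟨0, by simp, rfl⟩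
  smul_mem' := by
    rintro c _ ⟨φ, hφ, rfl⟩
    exact ⟨(DistribSMul.toAddMonoidHom M c).comp φ, fun r y => by simp [hφ, smul_comm c r], rfl⟩

lemma powEval_antitone (p : ℕ) [Fact p.Prime] [CharP S p] (x : S) (M : Type*) [AddCommGroup M]
    [Module S M] : Antitone fun e => powEval p e x M := by
  refine antitone_nat_of_succ_le fun e => ?_
  rintro _ ⟨φ, hφ, rfl⟩
  refine ⟨φ.comp ((AddMonoidHom.mulLeft (x ^ (p - 1))).comp (frobenius S p).toAddMonoidHom),
    fun r y => ?_, ?_⟩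
  · have : x ^ (p - 1) * (r ^ p ^ e * y) ^ p = r ^ p ^ (e + 1) * (x ^ (p - 1) * y ^ p) := by
      ring
    simp [frobenius_def, this, hφ]
  · have hp : 1 ≤ p := (Fact.out : p.Prime).one_le
    have hq : 1 ≤ p ^ e := Nat.one_le_pow _ _ hp
    have : p - 1 + (p ^ e - 1) * p = p ^ (e + 1) - 1 := by
      rw [Nat.sub_mul, one_mul, pow_succ]
      have := Nat.mul_le_mul_right p hq
      omega
    simp [frobenius_def, ← pow_mul, ← pow_add, this]

lemma powEval_le_span {p e : ℕ} {x : S} {ι : Type*} [Fintype ι] [DecidableEq ι] {N : ι → Type*}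
    [∀ j, AddCommGroup (N j)] [∀ j, Module S (N j)] (ψ : S ≃+ ⨁ j, N j)
    (hψ : ∀ r y : S, ψ (r ^ p ^ e * y) = r • ψ y)
    {M : Type*} [AddCommGroup M] [Module S M] (H : ∀ j, Set (N j →ₗ[S] M))
    (hH : ∀ j, Submodule.span S (H j) = ⊤) (W : Set M)
    (hW : ∀ j, ∀ h ∈ H j, h (ψ (x ^ (p ^ e - 1)) j) ∈ W) :
    powEval p e x M ≤ Submodule.span S (powEval p e x M ∩ W : Set M) := by
  rintro _ ⟨φ, hφ, rfl⟩
  have hψ' (r : S) (v : ⨁ j, N j) : ψ.symm (r • v) = r ^ p ^ e * ψ.symm v := by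
    rw [AddEquiv.symm_apply_eq, hψ, AddEquiv.apply_symm_apply]
  let Φ (j : ι) : N j →ₗ[S] M :=
    { toFun := fun v => φ (ψ.symm (DirectSum.lof S ι N j v))
      map_add' := fun v w => by simp
      map_smul' := fun r v => by simp only [map_smul, hψ', hφ, RingHom.id_apply] }
  have hsum : φ (x ^ (p ^ e - 1)) = ∑ j, Φ j (ψ (x ^ (p ^ e - 1)) j) := by
    change _ = ∑ j, φ (ψ.symm (DirectSum.lof S ι N j (ψ (x ^ (p ^ e - 1)) j)))
    rw [← map_sum, ← map_sum]
    simp only [DirectSum.lof_eq_of, DirectSum.sum_univ_of, AddEquiv.symm_apply_apply]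
  rw [hsum]
  refine Submodule.sum_mem _ fun j _ => ?_
  have hf : Φ j ∈ Submodule.span S (H j) := hH j ▸ Submodule.mem_top
  generalize Φ j = f at hf ⊢
  induction hf using Submodule.span_induction with
  | mem h hh =>
    refine Submodule.subset_span ⟨?_, hW j h hh⟩
    exact ⟨(h.comp (DirectSum.component S ι N j)).toAddMonoidHom.comp ψ.toAddMonoidHom,
      fun r y => by simp [hψ], rfl⟩
  | zero => simp
  | add f g _ _ hf hg => exact add_mem hf hg
  | smul c f _ hf => exact Submodule.smul_mem _ c hf

lemma exists_stable_of_le_span {K : Type*} [Field K] [Algebra K S] {M : Type*} [AddCommGroup M]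
    [Module S M] [Module K M] [IsScalarTower K S M] {N : ℕ → Submodule S M} (hN : Antitone N)
    (W : Submodule K M) [Module.Finite K W]
    (hW : ∀ e, N e ≤ Submodule.span S (N e ∩ W : Set M)) :
    ∃ e₀, ∀ e, e₀ ≤ e → N e₀ ≤ N e := by
  let f : ℕ →o (Submodule K W)ᵒᵈ :=
    ⟨fun e => OrderDual.toDual (((N e).restrictScalars K).comap W.subtype),
      fun a b hab v hv => hN hab hv⟩
  obtain ⟨e₀, he₀⟩ := IsArtinian.monotone_stabilizes f
  refine ⟨e₀, fun e he => (hW e₀).trans (Submodule.span_le.2 ?_)⟩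
  rintro m ⟨hm, hmW⟩
  have : (⟨m, hmW⟩ : W) ∈ OrderDual.ofDual (f e) := he₀ e he ▸ hm
  exact this

end PowEval

section FFRT

variable {K : Type v} {S : Type u} [Field K] [CommRing S] [Algebra K S]

/-- If the homogeneous pieces of degree `d` of `S` land in degree `α + d / q` of `M` under a
surjection, and `M` has a nonzero piece in degree `b`, then `α ≤ b`. -/
lemma shift_le_of_surjective {𝒜 : ℕ → Submodule K S} (htop : ⨆ n, 𝒜 n = ⊤)
    {M : Type*} [AddCommGroup M] [Module K M] {ℳ : ℚ → Submodule K M}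
    (hℳ : iSupIndep ℳ) (π : S →+ M) (hπ : Function.Surjective π) {α q : ℚ} (hq : 0 ≤ q)
    (hdeg : ∀ (d : ℕ) (y : S), y ∈ 𝒜 d → π y ∈ ℳ (α + (d : ℚ) / q))
    {b : ℚ} (hb : ℳ b ≠ ⊥) : α ≤ b := by
  by_contra! h
  have htop' : (⊤ : Submodule K M) ≤ ⨆ β ∈ Set.Ici α, ℳ β := by
    intro m _
    obtain ⟨y, rfl⟩ := hπ m
    have hy : y ∈ ⨆ n, 𝒜 n := htop ▸ Submodule.mem_top
    induction hy using Submodule.iSup_induction' with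
    | mem d y hy =>
      refine Submodule.mem_iSup_of_mem _ (Submodule.mem_iSup_of_mem ?_ (hdeg d y hy))
      exact le_add_of_nonneg_right (div_nonneg (Nat.cast_nonneg d) hq)
    | zero => simp
    | add y z _ _ hy hz =>
      rw [map_add]
      exact add_mem (hy Submodule.mem_top) (hz Submodule.mem_top)
  have hdisj : Disjoint (ℳ b) (⨆ β ∈ Set.Ici α, ℳ β) :=
    hℳ.disjoint_biSup (by simpa using h)
  rw [top_le_iff.1 htop', disjoint_top] at hdisj
  exact hb hdisj

lemma exists_pow_linear_of_FFRT [IsNoetherianRing S] (p : ℕ) [Fact p.Prime] [CharP S p]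
    (𝒜 : ℕ → Submodule K S) [GradedAlgebra 𝒜] (hfin : ∀ n, Module.Finite K (𝒜 n))
    (hF : HasGradedFFRT p K S 𝒜) (x : S) :
    ∃ e₀ : ℕ, ∀ (a : ℕ) (r : S), ∃ δ : S →+ S,
      (∀ s y, δ (s ^ p ^ (e₀ + a) * y) = s ^ p ^ (e₀ + a) * δ y) ∧
      δ (x ^ (p ^ (e₀ + a) - 1)) = r * x ^ (p ^ (e₀ + a) - p ^ a) := by
  classical
  obtain ⟨⟨s, M, ℳ, fin, internal, smul_mem, decomp⟩⟩ := hF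
  have htop : ⨆ n, 𝒜 n = ⊤ := (DirectSum.Decomposition.isInternal 𝒜).submodule_iSup_eq_top
  have hp0 : 0 < p := (Fact.out : p.Prime).pos
  choose n α ψ hψ hdeg using decomp
  have hψsurj (e : ℕ) (j) : Function.Surjective fun y => ψ e y j := fun m =>
    ⟨(ψ e).symm (DirectSum.of _ j m), by simp⟩
  obtain ⟨D, hD⟩ := exists_pow_mem_bounded_degree 𝒜 x
  -- components of `x ^ (pᵉ - 1)` have bounded degree
  have hC (i : Fin s) : ∃ C : ℚ, ∀ (e : ℕ) (j : Fin (n e i)),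
      ψ e (x ^ (p ^ e - 1)) ⟨i, j⟩ ∈ ⨆ β ∈ Set.Iic C, ℳ i β := by
    by_cases hb : ∃ b, ℳ i b ≠ ⊥
    · obtain ⟨b, hb⟩ := hb
      refine ⟨b + D, fun e j => ?_⟩
      have hq : (0 : ℚ) < (p : ℚ) ^ e := by positivity
      have hα : α e i j ≤ b :=
        shift_le_of_surjective htop (internal i).submodule_iSupIndep
          ((DirectSum.component S _ _ ⟨i, j⟩).toAddMonoidHom.comp (ψ e).toAddMonoidHom)
          (hψsurj e ⟨i, j⟩) hq.le (fun d y hy => hdeg e d y hy ⟨i, j⟩) hb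
      have hle (d : ℕ) (y : S) (hd : d ≤ (p ^ e - 1) * D) (hy : y ∈ 𝒜 d) :
          ψ e y ⟨i, j⟩ ∈ ⨆ β ∈ Set.Iic (b + D), ℳ i β := by
        refine Submodule.mem_iSup_of_mem _ (Submodule.mem_iSup_of_mem ?_ (hdeg e d y hy ⟨i, j⟩))
        refine add_le_add hα ((div_le_iff₀ hq).2 ?_)
        calc (d : ℚ) ≤ ((p ^ e * D : ℕ) : ℚ) :=
              Nat.cast_le.2 (hd.trans (Nat.mul_le_mul_right _ (Nat.sub_le _ _)))
          _ = D * (p : ℚ) ^ e := by push_cast; ring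
      have := hD (p ^ e - 1)
      generalize x ^ (p ^ e - 1) = z at this
      rw [iSup_subtype'] at this
      induction this using Submodule.iSup_induction' with
      | mem d y hy => exact hle d y d.2 hy
      | zero => simp
      | add y z _ _ hy hz =>
        rw [map_add, DirectSum.add_apply]
        exact add_mem hy hz
    · push Not at hb
      refine ⟨0, fun e j => ?_⟩
      have h0 : (⊤ : Submodule K (M i)) = ⊥ := by
        rw [← (internal i).submodule_iSup_eq_top]
        simp [hb]
      have := h0 ▸ Submodule.mem_top (R := K) (x := ψ e (x ^ (p ^ e - 1)) ⟨i, j⟩)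
      rw [(Submodule.mem_bot K).1 this]
      exact zero_mem _
  choose C hC using hC
  have hV (i : Fin s) : Module.Finite K (⨆ β ∈ Set.Iic (C i), ℳ i β : Submodule K (M i)) :=
    finite_bounded_degree_part 𝒜 htop hfin (ℳ i) (internal i) (smul_mem i) (C i)
  have hH (i j : Fin s) : ∃ H : Finset (M j →ₗ[S] M i),
      Submodule.span S (H : Set (M j →ₗ[S] M i)) = ⊤ :=
    IsNoetherian.noetherian (⊤ : Submodule S (M j →ₗ[S] M i))
  choose H hH using hH
  have hstab (i : Fin s) : ∃ e₀, ∀ e, e₀ ≤ e → powEval p e₀ x (M i) ≤ powEval p e x (M i) := by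
    let W : Submodule K (M i) := ⨆ l : Σ j : Fin s, H i j,
      (⨆ β ∈ Set.Iic (C l.1), ℳ l.1 β).map (l.2.1.restrictScalars K)
    have (l : Σ j : Fin s, H i j) : Module.Finite K
        ((⨆ β ∈ Set.Iic (C l.1), ℳ l.1 β).map (l.2.1.restrictScalars K)) :=
      Module.Finite.map _ _
    have : Module.Finite K W := Submodule.finite_iSup _
    refine exists_stable_of_le_span (powEval_antitone p x (M i)) W fun e => ?_
    refine powEval_le_span (ψ e) (hψ e) (fun j => (H i j.1 : Set (M j.1 →ₗ[S] M i))) (fun j => hH i j.1) W ?_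
    intro j h hh
    exact Submodule.mem_iSup_of_mem ⟨j.1, h, hh⟩ ⟨_, hC j.1 e j.2, rfl⟩
  choose E hE using hstab
  refine ⟨Finset.univ.sup E, fun a r => ?_⟩
  set e₀ := Finset.univ.sup E
  have hval (j : Σ i : Fin s, Fin (n (e₀ + a) i)) :
      ψ (e₀ + a) (r * x ^ (p ^ (e₀ + a) - p ^ a)) j ∈ powEval p (e₀ + a) x (M j.1) := by
    have hEj : E j.1 ≤ e₀ := Finset.le_sup (Finset.mem_univ _)
    refine hE j.1 _ (hEj.trans (Nat.le_add_right _ _)) (powEval_antitone p x _ hEj ?_)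
    refine ⟨((DirectSum.component S _ _ j).toAddMonoidHom.comp (ψ (e₀ + a)).toAddMonoidHom).comp
      ((AddMonoidHom.mulLeft r).comp (iterateFrobenius S p a).toAddMonoidHom), fun c y => ?_, ?_⟩
    · have : r * (c ^ p ^ e₀ * y) ^ p ^ a = c ^ p ^ (e₀ + a) * (r * y ^ p ^ a) := by
        rw [mul_pow, ← pow_mul, ← pow_add]
        ring
      simp [iterateFrobenius_def, this, hψ]
    · have : (p ^ e₀ - 1) * p ^ a = p ^ (e₀ + a) - p ^ a := by
        rw [Nat.sub_mul, one_mul, pow_add]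
      simp [iterateFrobenius_def, ← pow_mul, this]
      rfl
  choose φ hφ hφx using hval
  have hsymm (c : S) (v) : (ψ (e₀ + a)).symm (c • v) =
      c ^ p ^ (e₀ + a) * (ψ (e₀ + a)).symm v := by
    rw [AddEquiv.symm_apply_eq, hψ, AddEquiv.apply_symm_apply]
  refine ⟨(ψ (e₀ + a)).symm.toAddMonoidHom.comp
    (∑ j, (DirectSum.lof S _ (fun j : Σ i : Fin s, Fin (n (e₀ + a) i) => M j.1)
      j).toAddMonoidHom.comp (φ j)), fun c y => ?_, ?_⟩
  · simp only [AddMonoidHom.comp_apply, AddMonoidHom.finsetSum_apply]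
    simp only [LinearMap.toAddMonoidHom_coe, AddEquiv.coe_toAddMonoidHom, hφ, map_smul,
      ← Finset.smul_sum, hsymm]
  · simp only [AddMonoidHom.comp_apply, AddMonoidHom.finsetSum_apply]
    simp only [LinearMap.toAddMonoidHom_coe, AddEquiv.coe_toAddMonoidHom, hφx,
      DirectSum.lof_eq_of, DirectSum.sum_univ_of, AddEquiv.symm_apply_apply]

end FFRT

section Descent

/-- A `k`-linear retraction of `K` onto `k` induces an `R`-linear retraction of `R → K ⊗ R`. -/
lemma exists_retraction_baseChange (k K R : Type*) [Field k] [Field K] [Algebra k K] [CommRing R]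
    [Algebra k R] : ∃ ρ : K ⊗[k] R →ₗ[k] R,
      (∀ r, ρ (1 ⊗ₜ r) = r) ∧ ∀ r t, ρ (1 ⊗ₜ r * t) = r * ρ t := by
  obtain ⟨l, hl⟩ := LinearMap.exists_leftInverse_of_injective (Algebra.linearMap k K)
    (LinearMap.ker_eq_bot.2 (algebraMap k K).injective)
  have hl1 : l 1 = 1 := by simpa using LinearMap.congr_fun hl 1
  refine ⟨(TensorProduct.lid k R).toLinearMap.comp (l.rTensor R), fun r => by simp [hl1],
    fun r t => ?_⟩
  induction t with
  | zero => simp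
  | tmul c s => simp
  | add a b ha hb => rw [mul_add, map_add, map_add, ha, hb, mul_add]

lemma exists_descent_of_pow_linear {k K R : Type*} [Field k] [Field K] [Algebra k K] [CommRing R]
    [Algebra k R] {p : ℕ} [ExpChar K p] [PerfectRing K p] {e : ℕ}
    (ρ : K ⊗[k] R →ₗ[k] R) (hρ : ∀ r t, ρ (1 ⊗ₜ r * t) = r * ρ t) (δ : K ⊗[k] R →+ K ⊗[k] R)
    (hδ : ∀ s y, δ (s ^ p ^ e * y) = s ^ p ^ e * δ y) :
    ∃ δ' : R →ₗ[k] R, (∀ r z : R, δ' (r ^ p ^ e * z) = r ^ p ^ e * δ' z) ∧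
      ∀ z, δ' z = ρ (δ (1 ⊗ₜ z)) := by
  have hsmul (c : k) (t : K ⊗[k] R) : δ (c • t) = c • δ t := by
    obtain ⟨d, hd⟩ := (bijective_iterateFrobenius K p e).surjective (algebraMap k K c)
    have h (t : K ⊗[k] R) : c • t = (algebraMap K (K ⊗[k] R) d) ^ p ^ e * t := by
      rw [← map_pow, ← Algebra.smul_def, ← iterateFrobenius_def, hd, algebraMap_smul]
    rw [h, h, hδ]
  refine ⟨{ toFun := fun z => ρ (δ (1 ⊗ₜ z))
            map_add' := fun y z => by rw [TensorProduct.tmul_add, map_add, map_add]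
            map_smul' := fun c z => by
              rw [TensorProduct.tmul_smul, hsmul, map_smul, RingHom.id_apply] },
    fun r z => ?_, fun z => rfl⟩
  have h : (1 : K) ⊗ₜ[k] (r ^ p ^ e * z) = (1 ⊗ₜ r) ^ p ^ e * (1 ⊗ₜ z) := by simp
  change ρ (δ (1 ⊗ₜ (r ^ p ^ e * z))) = r ^ p ^ e * ρ (δ (1 ⊗ₜ z))
  rw [h, hδ, Algebra.TensorProduct.tmul_pow, one_pow, hρ]

end Descent

/-- Let `R = ⨁_{n ≥ 0} R_n` be a Noetherian graded ring with
`k := R_0` a field of characteristic `p > 0` and `K` the perfect closure of `k`.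
If `R_K := R ⊗_k K` (with its induced grading) has finite graded F-representation type,
then for every non-zerodivisor `x ∈ R` the localization `R_x` is generated by `1/x` as
a `D_{R/k}`-module: every `y ∈ R_x` is of the form `δ(1/x)` for some `δ ∈ D_{R/k}`.
(In characteristic `p`, every `δ ∈ D_{R/k}` is `R^{pᵉ}`-linear for some `e` and acts on
`R_x` by `δ(z/s) = δ(s^{pᵉ-1}z)/s^{pᵉ}`; the equation `δ(1/x) = y` reads
`δ(x^{pᵉ-1}) = y·x^{pᵉ}` in `R_x`.) -/
theorem stmt1 {k : Type u} [Field k] (p : ℕ) (hp : p.Prime) [CharP k p]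
    {R : Type u} [CommRing R] [Algebra k R] [IsNoetherianRing R] [CharP R p]
    -- the grading of `R`, with `R_0 = k`:
    (𝒜 : ℕ → Submodule k R) [GradedAlgebra 𝒜]
    (h0 : 𝒜 0 = Submodule.span k {1})
    -- `K` is the perfect closure of `k`:
    (K : Type u) [Field K] [Algebra k K] [ExpChar K p] [PerfectRing K p]
    [IsPRadical (algebraMap k K) p]
    -- `R_K = R ⊗_k K`, with grading `[R_K]_n = R_n ⊗_k K`, has finite graded
    -- F-representation type:
    (hFFRT : HasGradedFFRT p K (K ⊗[k] R) (fun n => (𝒜 n).baseChange K))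
    (x : R) (hx : x ∈ nonZeroDivisors R) :
    ∀ y : Localization.Away x,
      ∃ δ : R →ₗ[k] R, δ ∈ DiffOps k R ∧ ∃ e : ℕ,
        (∀ r z : R, δ (r ^ p ^ e * z) = r ^ p ^ e * δ z) ∧
        algebraMap R (Localization.Away x) (δ (x ^ (p ^ e - 1))) =
          y * algebraMap R (Localization.Away x) x ^ p ^ e := by
  have : Fact p.Prime := ⟨hp⟩
  have hft : Algebra.FiniteType k R := finiteType_of_graded 𝒜 h0
  have : IsNoetherianRing (K ⊗[k] R) := Algebra.FiniteType.isNoetherianRing K _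
  have hfin (n : ℕ) : Module.Finite K ((𝒜 n).baseChange K) := by
    have : Module.Finite k (𝒜 n) := finite_graded_piece 𝒜 h0 n
    exact Module.Finite.range ((𝒜 n).subtype.baseChange K)
  obtain ⟨ρ, hρone, hρmul⟩ := exists_retraction_baseChange k K R
  have : CharP (K ⊗[k] R) p :=
    charP_of_injective_ringHom
      (f := (Algebra.TensorProduct.includeRight : R →ₐ[k] K ⊗[k] R).toRingHom)
      (Function.LeftInverse.injective (g := ρ) hρone) p
  obtain ⟨e₀, hδ⟩ := exists_pow_linear_of_FFRT p (fun n => (𝒜 n).baseChange K) hfin hFFRT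
    ((1 : K) ⊗ₜ[k] x)
  intro y
  obtain ⟨⟨r, _, m, rfl⟩, hr⟩ := IsLocalization.surj (Submonoid.powers x) y
  obtain ⟨δ, hlin, hval⟩ := hδ m (1 ⊗ₜ (r * x ^ (p ^ m - m)))
  obtain ⟨δ', hlin', hval'⟩ := exists_descent_of_pow_linear ρ hρmul δ hlin
  refine ⟨δ', mem_DiffOps_of_pow_linear p hp (e₀ + m) δ' hlin', e₀ + m, hlin', ?_⟩
  have hm : m ≤ p ^ m := (Nat.lt_pow_self hp.one_lt).le
  have hq : p ^ m ≤ p ^ (e₀ + m) := Nat.pow_le_pow_right hp.pos (Nat.le_add_left _ _)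
  have hx' : δ' (x ^ (p ^ (e₀ + m) - 1)) = r * x ^ (p ^ (e₀ + m) - m) := by
    rw [Algebra.TensorProduct.tmul_pow, Algebra.TensorProduct.tmul_pow, one_pow, one_pow,
      Algebra.TensorProduct.tmul_mul_tmul, one_mul] at hval
    rw [hval', hval, hρone, mul_assoc, ← pow_add]
    congr 2
    omega
  rw [hx', map_mul, ← hr, mul_assoc, ← map_mul, ← pow_add, Nat.add_sub_cancel' (hm.trans hq),
    map_pow]
end

section
/- Let R be a Cohen-Macaulay ring of prime characteristic p with finite F-representation type by finitely generated R-modules M_1, …, M_t, admitting a canonical module ω_R. Let I be an ideal of R and n an integer. Then Ass_R H_I^n(ω_R) ⊆ ⋃_{i=1}^t Ass_R Ext_R^n(M_i/IM_i, ω_R). In particular, the local cohomology module H_I^n(ω_R) has only a finite number of associated primes. -/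
/-!
Statement 3: If `R` is a Cohen-Macaulay ring of prime characteristic `p` with finite
F-representation type by finitely generated modules `M_1, …, M_t`, admitting a canonical
module `ω_R`, `I` an ideal and `n` an integer, then
`Ass_R H_I^n(ω_R) ⊆ ⋃_i Ass_R Ext_R^n(M_i/IM_i, ω_R)`; in particular `H_I^n(ω_R)` has
only finitely many associated primes.
-/

open CategoryTheory

open scoped DirectSum

universe u

section Defs

variable (R : Type u) [CommRing R]

/-- `Ext_R^i(M, N)` via Mathlib's `Ext` functor on `ModuleCat R`. -/
noncomputable def extCat (i : ℕ) (M N : ModuleCat.{u} R) : ModuleCat.{u} R :=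
  ((Ext R (ModuleCat.{u} R) i).obj (Opposite.op M)).obj N

/-- `ω` is a canonical (dualizing) module for `R`: finitely generated, of finite
injective dimension, the homothety map `R → End_R(ω)` is bijective and
`Ext_R^i(ω, ω) = 0` for `i > 0`. -/
def IsCanonicalModule (ω : Type u) [AddCommGroup ω] [Module R ω] : Prop :=
  Module.Finite R ω ∧
  (∃ n : ℕ, ∀ (M : ModuleCat.{u} R) (i : ℕ), n < i →
    Subsingleton (extCat R i M (ModuleCat.of R ω))) ∧
  Function.Bijective (algebraMap R (Module.End R ω)) ∧
  (∀ i : ℕ, 0 < i → Subsingleton (extCat R i (ModuleCat.of R ω) (ModuleCat.of R ω)))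

/-- A (weakly) regular sequence generating a proper ideal. -/
def IsRegularSeq (rs : List R) : Prop :=
  (∀ (i : ℕ) (hi : i < rs.length) (a : R),
      rs.get ⟨i, hi⟩ * a ∈ Ideal.span {x | x ∈ rs.take i} →
        a ∈ Ideal.span {x | x ∈ rs.take i}) ∧
  Ideal.span {x | x ∈ rs} ≠ ⊤

/-- `R` is a Cohen-Macaulay *local* ring: Noetherian local, admitting a regular sequence
of nonunits whose length is the Krull dimension of `R`. -/
def IsCMLocalRing : Prop :=
  IsLocalRing R ∧ IsNoetherianRing R ∧
  ∃ rs : List R, IsRegularSeq R rs ∧ (∀ x ∈ rs, ¬IsUnit x) ∧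
    (rs.length : WithBot (WithTop ℕ)) = ringKrullDim R

/-- `R` is a Cohen-Macaulay ring: Noetherian, and all its localizations at primes are
Cohen-Macaulay local rings. -/
def IsCMRing : Prop :=
  IsNoetherianRing R ∧
    ∀ (P : Ideal R) (_ : P.IsPrime), IsCMLocalRing (Localization.AtPrime P)

end Defs

/-! ### Unbundled `Ext` modules -/

section ExtModules

open CategoryTheory.Abelian

variable (R : Type u) [CommRing R]

/-- `Ext_R^n(N, X)` for unbundled modules. -/
abbrev ExtMod (n : ℕ) (N X : Type u) [AddCommGroup N] [Module R N] [AddCommGroup X]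
    [Module R X] : Type u :=
  Abelian.Ext (ModuleCat.of R N) (ModuleCat.of R X) n

variable {R}
variable {N N' N'' X X' X'' : Type u} [AddCommGroup N] [Module R N] [AddCommGroup N']
  [Module R N'] [AddCommGroup N''] [Module R N''] [AddCommGroup X] [Module R X]
  [AddCommGroup X'] [Module R X'] [AddCommGroup X''] [Module R X'']

/-- Contravariant functoriality of `Ext`. -/
noncomputable def extPull (n : ℕ) (X : Type u) [AddCommGroup X] [Module R X] (f : N →ₗ[R] N') :
    ExtMod R n N' X →ₗ[R] ExtMod R n N X :=
  (Ext.mk₀ (ModuleCat.ofHom f)).precompOfLinear R (ModuleCat.of R X) (zero_add n)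

/-- Covariant functoriality of `Ext`. -/
noncomputable def extPush (n : ℕ) (N : Type u) [AddCommGroup N] [Module R N] (g : X →ₗ[R] X') :
    ExtMod R n N X →ₗ[R] ExtMod R n N X' :=
  (Ext.mk₀ (ModuleCat.ofHom g)).postcompOfLinear R (ModuleCat.of R N) (add_zero n)

theorem extPull_apply (n : ℕ) (f : N →ₗ[R] N') (z : ExtMod R n N' X) :
    extPull n X f z = (Ext.mk₀ (ModuleCat.ofHom f)).comp z (zero_add n) := rfl

theorem extPush_apply (n : ℕ) (g : X →ₗ[R] X') (z : ExtMod R n N X) :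
    extPush n N g z = z.comp (Ext.mk₀ (ModuleCat.ofHom g)) (add_zero n) := rfl

theorem extPull_comp (n : ℕ) (f : N →ₗ[R] N') (f' : N' →ₗ[R] N'') (z : ExtMod R n N'' X) :
    extPull n X (f' ∘ₗ f) z = extPull n X f (extPull n X f' z) := by
  simp [extPull_apply, ModuleCat.ofHom_comp]

theorem extPush_comp (n : ℕ) (g : X →ₗ[R] X') (g' : X' →ₗ[R] X'') (z : ExtMod R n N X) :
    extPush n N (g' ∘ₗ g) z = extPush n N g' (extPush n N g z) := by
  simp [extPush_apply, ModuleCat.ofHom_comp]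

theorem extPull_id (n : ℕ) (z : ExtMod R n N X) : extPull n X LinearMap.id z = z := by
  simp [extPull_apply]

theorem extPush_id (n : ℕ) (z : ExtMod R n N X) : extPush n N LinearMap.id z = z := by
  simp [extPush_apply]

theorem extPull_add (n : ℕ) (f g : N →ₗ[R] N') :
    extPull n X (f + g) = extPull n X f + extPull n X g := by
  ext z; simp [extPull_apply, ModuleCat.ofHom_add, Ext.mk₀_add, Ext.add_comp]

theorem extPush_add (n : ℕ) (f g : X →ₗ[R] X') :
    extPush n N (f + g) = extPush n N f + extPush n N g := by
  ext z; simp [extPush_apply, ModuleCat.ofHom_add, Ext.mk₀_add, Ext.comp_add]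

theorem extPull_smul (n : ℕ) (r : R) (f : N →ₗ[R] N') :
    extPull n X (r • f) = r • extPull n X f := by
  ext z
  have : ModuleCat.ofHom (r • f) = r • ModuleCat.ofHom f := rfl
  simp [extPull_apply, this, Ext.mk₀_smul]

theorem extPush_smul (n : ℕ) (r : R) (f : X →ₗ[R] X') :
    extPush n N (r • f) = r • extPush n N f := by
  ext z
  have : ModuleCat.ofHom (r • f) = r • ModuleCat.ofHom f := rfl
  simp [extPush_apply, this, Ext.mk₀_smul]

/-- The additive map `f ↦ f^*` on `Ext`. -/
noncomputable def extPullHom (n : ℕ) (N N' X : Type u) [AddCommGroup N] [Module R N]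
    [AddCommGroup N'] [Module R N'] [AddCommGroup X] [Module R X] :
    (N →ₗ[R] N') →ₗ[R] (ExtMod R n N' X →ₗ[R] ExtMod R n N X) where
  toFun := extPull n X
  map_add' := extPull_add n
  map_smul' := extPull_smul n

/-- The additive map `g ↦ g_*` on `Ext`. -/
noncomputable def extPushHom (n : ℕ) (N X X' : Type u) [AddCommGroup N] [Module R N]
    [AddCommGroup X'] [Module R X'] [AddCommGroup X] [Module R X] :
    (X →ₗ[R] X') →ₗ[R] (ExtMod R n N X →ₗ[R] ExtMod R n N X') where
  toFun := extPush n N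
  map_add' := extPush_add n
  map_smul' := extPush_smul n

theorem extPull_zero (n : ℕ) : extPull n X (0 : N →ₗ[R] N') = 0 :=
  map_zero (extPullHom n N N' X)

theorem extPush_zero (n : ℕ) : extPush n N (0 : X →ₗ[R] X') = 0 :=
  map_zero (extPushHom n N X X')

theorem extPull_sum (n : ℕ) {ι : Type*} (s : Finset ι) (f : ι → (N →ₗ[R] N')) :
    extPull n X (∑ i ∈ s, f i) = ∑ i ∈ s, extPull n X (f i) :=
  map_sum (extPullHom n N N' X) f s

theorem extPush_sum (n : ℕ) {ι : Type*} (s : Finset ι) (f : ι → (X →ₗ[R] X')) :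
    extPush n N (∑ i ∈ s, f i) = ∑ i ∈ s, extPush n N (f i) :=
  map_sum (extPushHom n N X X') f s

/-- An isomorphism in the first variable induces an isomorphism on `Ext`. -/
noncomputable def extPullEquiv (n : ℕ) (X : Type u) [AddCommGroup X] [Module R X]
    (f : N ≃ₗ[R] N') : ExtMod R n N' X ≃ₗ[R] ExtMod R n N X :=
  LinearEquiv.ofLinearMap (extPull n X f.toLinearMap) (extPull n X f.symm.toLinearMap)
    (by ext z; simp [← extPull_comp, extPull_id]) (by ext z; simp [← extPull_comp, extPull_id])

/-- An isomorphism in the second variable induces an isomorphism on `Ext`. -/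
noncomputable def extPushEquiv (n : ℕ) (N : Type u) [AddCommGroup N] [Module R N]
    (g : X ≃ₗ[R] X') : ExtMod R n N X ≃ₗ[R] ExtMod R n N X' :=
  LinearEquiv.ofLinearMap (extPush n N g.toLinearMap) (extPush n N g.symm.toLinearMap)
    (by ext z; simp [← extPush_comp, extPush_id]) (by ext z; simp [← extPush_comp, extPush_id])

/-- `Ext^0` is `Hom`. -/
noncomputable def extZeroEquiv (N X : Type u) [AddCommGroup N] [Module R N] [AddCommGroup X]
    [Module R X] : ExtMod R 0 N X ≃ₗ[R] (N →ₗ[R] X) :=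
  (Ext.linearEquiv₀ (R := R)).trans ModuleCat.homLinearEquiv

theorem extZeroEquiv_symm_apply (f : N →ₗ[R] X) :
    (extZeroEquiv N X).symm f = Ext.mk₀ (ModuleCat.ofHom f) := rfl

theorem extZeroEquiv_mk₀ (f : N →ₗ[R] X) :
    extZeroEquiv N X (Ext.mk₀ (ModuleCat.ofHom f)) = f :=
  (extZeroEquiv N X).apply_symm_apply f

theorem extZeroEquiv_pull (f : N →ₗ[R] N') (z : ExtMod R 0 N' X) :
    extZeroEquiv N X (extPull 0 X f z) = extZeroEquiv N' X z ∘ₗ f := by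
  obtain ⟨z, rfl⟩ := (extZeroEquiv N' X).symm.surjective z
  apply (extZeroEquiv N X).symm.injective
  simp [extZeroEquiv_symm_apply, extZeroEquiv_mk₀, extPull_apply, ModuleCat.ofHom_comp]

theorem extZeroEquiv_push (g : X →ₗ[R] X') (z : ExtMod R 0 N X) :
    extZeroEquiv N X' (extPush 0 N g z) = g ∘ₗ extZeroEquiv N X z := by
  obtain ⟨z, rfl⟩ := (extZeroEquiv N X).symm.surjective z
  apply (extZeroEquiv N X').symm.injective
  simp [extZeroEquiv_symm_apply, extZeroEquiv_mk₀, extPush_apply, ModuleCat.ofHom_comp]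

theorem ext_subsingleton_of_projective (n : ℕ) [Module.Projective R N] :
    Subsingleton (ExtMod R (n + 1) N X) := by
  have : Projective (ModuleCat.of R N) := (IsProjective.iff_projective _).mp inferInstance
  exact Ext.subsingleton_of_projective _ _ n

section LongExactSequence

theorem comp_comp_extClass {S : ShortComplex (ModuleCat.{u} R)} (hS : S.ShortExact)
    {Y : ModuleCat.{u} R} {n : ℕ} (z : Ext Y S.X₂ n) :
    (z.comp (Ext.mk₀ S.g) (add_zero n)).comp hS.extClass rfl = 0 := by
  rw [Ext.comp_assoc_of_second_deg_zero, hS.comp_extClass, Ext.comp_zero]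

theorem comp_extClass_comp {S : ShortComplex (ModuleCat.{u} R)} (hS : S.ShortExact)
    {Y : ModuleCat.{u} R} {n : ℕ} (z : Ext Y S.X₃ n) :
    (z.comp hS.extClass rfl).comp (Ext.mk₀ S.f) (add_zero (n + 1)) = 0 := by
  rw [Ext.comp_assoc_of_third_deg_zero, hS.extClass_comp, Ext.comp_zero]

variable {A B C : Type u} [AddCommGroup A] [Module R A] [AddCommGroup B] [Module R B]
  [AddCommGroup C] [Module R C] {f : A →ₗ[R] B} {g : B →ₗ[R] C}

theorem extPull_exact (n : ℕ) (X : Type u) [AddCommGroup X] [Module R X]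
    (hf : Function.Injective f) (hfg : Function.Exact f g) (hg : Function.Surjective g) :
    Function.Exact (extPull n X g) (extPull n X f) := by
  have hS := ModuleCat.shortComplex_shortExact
    (ShortComplex.moduleCatMk f g hfg.linearMap_comp_eq_zero) hfg hf hg
  intro z
  constructor
  · exact fun h ↦ Ext.contravariant_sequence_exact₂ hS _ z h
  · rintro ⟨z, rfl⟩
    rw [← extPull_comp, hfg.linearMap_comp_eq_zero, extPull_zero]; rfl

theorem exists_extPull_connecting (n : ℕ) (X : Type u) [AddCommGroup X] [Module R X]
    (hf : Function.Injective f) (hfg : Function.Exact f g) (hg : Function.Surjective g) :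
    ∃ δ : ExtMod R n A X →ₗ[R] ExtMod R (n + 1) C X,
      Function.Exact (extPull n X f) δ ∧ Function.Exact δ (extPull (n + 1) X g) := by
  have hS := ModuleCat.shortComplex_shortExact
    (ShortComplex.moduleCatMk f g hfg.linearMap_comp_eq_zero) hfg hf hg
  refine ⟨hS.extClass.precompOfLinear R (ModuleCat.of R X) (add_comm 1 n), ?_, ?_⟩
  · intro z
    constructor
    · exact fun h ↦ Ext.contravariant_sequence_exact₁ hS _ z (add_comm 1 n) h
    · rintro ⟨z, rfl⟩
      exact hS.extClass_comp_assoc z (h := add_comm 1 n)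
  · intro z
    constructor
    · exact fun h ↦ Ext.contravariant_sequence_exact₃ hS _ z h (add_comm 1 n)
    · rintro ⟨z, rfl⟩
      exact hS.comp_extClass_assoc z (add_comm 1 n)

theorem exists_extPush_connecting (n : ℕ) (N : Type u) [AddCommGroup N] [Module R N]
    (hf : Function.Injective f) (hfg : Function.Exact f g) (hg : Function.Surjective g) :
    ∃ δ : ExtMod R n N C →ₗ[R] ExtMod R (n + 1) N A,
      Function.Exact (extPush n N g) δ ∧ Function.Exact δ (extPush (n + 1) N f) := by
  have hS := ModuleCat.shortComplex_shortExact
    (ShortComplex.moduleCatMk f g hfg.linearMap_comp_eq_zero) hfg hf hg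
  refine ⟨hS.extClass.postcompOfLinear R (ModuleCat.of R N) rfl, ?_, ?_⟩
  · intro z
    constructor
    · exact fun h ↦ Ext.covariant_sequence_exact₃ _ hS z rfl h
    · rintro ⟨z, rfl⟩
      exact comp_comp_extClass hS z
  · intro z
    constructor
    · exact fun h ↦ Ext.covariant_sequence_exact₁ _ hS z h rfl
    · rintro ⟨z, rfl⟩
      exact comp_extClass_comp hS z

end LongExactSequence

end ExtModules

/-! ### Comparison of the two `Ext` constructions -/

section Comparison

open CategoryTheory.Abelian

variable {R : Type u} [CommRing R] {X Y : ModuleCat.{u} R} (P : ProjectiveResolution X)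

theorem extMk_eq_zero_iff_prev {n : ℕ} (f : P.complex.X n ⟶ Y)
    (hf : P.complex.d (n + 1) n ≫ f = 0) :
    P.extMk f (n + 1) rfl hf = 0 ↔
      ∃ g : P.complex.X ((ComplexShape.up ℕ).prev n) ⟶ Y,
        P.complex.d n ((ComplexShape.up ℕ).prev n) ≫ g = f := by
  cases n with
  | succ n =>
    rw [show (ComplexShape.up ℕ).prev (n + 1) = n from CochainComplex.prev_nat_succ n]
    exact P.extMk_eq_zero_iff f _ rfl hf n rfl
  | zero =>
    rw [show (ComplexShape.up ℕ).prev 0 = 0 from CochainComplex.prev_nat_zero,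
      P.complex.shape 0 0 (by simp)]
    constructor
    · intro h
      rw [← P.extEquivCohomologyClass.apply_eq_iff_eq,
        ProjectiveResolution.extEquivCohomologyClass_extMk,
        ProjectiveResolution.extEquivCohomologyClass_zero,
        CochainComplex.HomComplex.CohomologyClass.mk_eq_zero_iff,
        CochainComplex.HomComplex.Cocycle.toSingleMk_mem_coboundaries_iff _ _ _ _ _ 1
          (by simp)] at h
      obtain ⟨g, hg⟩ := h
      have hz : Limits.IsZero (P.cochainComplex.X 1) :=
        P.cochainComplex.isZero_of_isStrictlyLE 0 1 (by simp)
      rw [hz.eq_of_src g 0, Limits.comp_zero] at hg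
      refine ⟨0, ?_⟩
      rw [Limits.comp_zero, ← cancel_epi (P.cochainComplexXIso _ 0 rfl).hom, ← hg, Limits.comp_zero]
    · rintro ⟨g, rfl⟩
      simp

theorem smul_extMk {n : ℕ} (r : R) (f : P.complex.X n ⟶ Y)
    (hf : P.complex.d (n + 1) n ≫ f = 0) :
    r • P.extMk f (n + 1) rfl hf = P.extMk (r • f) (n + 1) rfl (by simp [hf]) := by
  simp [Ext.smul_eq_comp_mk₀, P.extMk_comp_mk₀]

theorem comp_eq_zero_of_mem_ker_linearYonedaObj {n : ℕ}
    (f : LinearMap.ker (((P.complex.linearYonedaObj R Y).sc n).g.hom)) :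
    P.complex.d (n + 1) n ≫ (show P.complex.X n ⟶ Y from f.1) = 0 := by
  have h : P.complex.d ((ComplexShape.up ℕ).next n) n ≫
      (show P.complex.X n ⟶ Y from f.1) = 0 := LinearMap.mem_ker.mp f.2
  rwa [show (ComplexShape.up ℕ).next n = n + 1 from CochainComplex.next ℕ n] at h

/-- Cocycles in `Hom(P, Y)` map linearly to `Ext`. -/
noncomputable def extMkLinear (n : ℕ) :
    LinearMap.ker (((P.complex.linearYonedaObj R Y).sc n).g.hom) →ₗ[R] Ext X Y n where
  toFun f := P.extMk (Y := Y) f.1 (n + 1) rfl (comp_eq_zero_of_mem_ker_linearYonedaObj P f)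
  map_add' f g := (P.add_extMk (Y := Y) f.1 g.1 (n + 1) rfl _ _).symm
  map_smul' r f := (smul_extMk P (Y := Y) r f.1 _).symm

theorem extMkLinear_surjective (n : ℕ) :
    Function.Surjective (extMkLinear (Y := Y) P n) := by
  intro z
  obtain ⟨f, hf, rfl⟩ := P.extMk_surjective z (n + 1) rfl
  have hf' : P.complex.d ((ComplexShape.up ℕ).next n) n ≫ f = 0 := by
    rwa [show (ComplexShape.up ℕ).next n = n + 1 from CochainComplex.next ℕ n]
  exact ⟨⟨f, LinearMap.mem_ker.mpr hf'⟩, rfl⟩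

theorem ker_extMkLinear (n : ℕ) :
    LinearMap.ker (extMkLinear (Y := Y) P n) =
      LinearMap.range ((P.complex.linearYonedaObj R Y).sc n).moduleCatToCycles := by
  ext f
  rw [LinearMap.mem_ker]
  refine (extMk_eq_zero_iff_prev P (Y := Y) f.1
    (comp_eq_zero_of_mem_ker_linearYonedaObj P f)).trans ?_
  constructor
  · rintro ⟨g, hg⟩
    exact ⟨g, Subtype.ext hg⟩
  · rintro ⟨g, hg⟩
    exact ⟨g, congrArg Subtype.val hg⟩

theorem nonempty_extFunctor_linearEquiv (n : ℕ) (X Y : ModuleCat.{u} R) :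
    Nonempty (((_root_.Ext R (ModuleCat.{u} R) n).obj (Opposite.op X)).obj Y ≃ₗ[R]
      Ext X Y n) := by
  let P := projectiveResolution X
  let e : (LinearMap.ker (((P.complex.linearYonedaObj R Y).sc n).g.hom) ⧸
      LinearMap.range ((P.complex.linearYonedaObj R Y).sc n).moduleCatToCycles) ≃ₗ[R] Ext X Y n :=
    (Submodule.quotEquivOfEq _ _ (ker_extMkLinear P n).symm).trans
      ((extMkLinear P n).quotKerEquivOfSurjective (extMkLinear_surjective P n))
  exact ⟨((P.isoExt n Y).toLinearEquiv.trans
    (((P.complex.linearYonedaObj R Y).sc n).moduleCatHomologyIso.toLinearEquiv)).trans e⟩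

end Comparison

/-! ### Restriction and coextension of scalars along a ring endomorphism -/

section ChangeOfRings

variable {R : Type u} [CommRing R]

/-- The module `X` with scalars restricted along `F`. -/
def Res (_F : R →+* R) (X : Type u) : Type u := X

namespace Res

variable (F : R →+* R) {X Y Z : Type u} [AddCommGroup X] [Module R X] [AddCommGroup Y] [Module R Y]
  [AddCommGroup Z] [Module R Z]

instance : AddCommGroup (Res F X) := inferInstanceAs (AddCommGroup X)

instance : Module R (Res F X) := Module.compHom X F

/-- The identity map `X → Res F X`. -/
def of : X ≃+ Res F X := AddEquiv.refl X

theorem smul_of (r : R) (x : X) : r • of F x = of F (F r • x) := rfl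

theorem of_symm_smul (r : R) (x : Res F X) : (of F).symm (r • x) = F r • (of F).symm x := rfl

variable {F} in
@[ext]
theorem hom_ext {f g : Res F X →ₗ[R] Y} (h : ∀ x, f (of F x) = g (of F x)) : f = g :=
  LinearMap.ext fun x ↦ h ((of F).symm x)

/-- Restriction of scalars of a linear map. -/
def map (f : X →ₗ[R] Y) : Res F X →ₗ[R] Res F Y where
  toFun x := of F (f ((of F).symm x))
  map_add' x y := by simp
  map_smul' r x := by simp [of_symm_smul, smul_of]

@[simp] theorem map_of (f : X →ₗ[R] Y) (x : X) : map F f (of F x) = of F (f x) := rfl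

/-- Restriction of scalars commutes with finite powers. -/
def piEquiv (ι : Type) : Res F (ι → X) ≃ₗ[R] (ι → Res F X) where
  toFun x i := of F ((of F).symm x i)
  map_add' _ _ := rfl
  map_smul' _ _ := rfl
  invFun y := of F fun i ↦ (of F).symm (y i)
  left_inv _ := rfl
  right_inv _ := rfl

theorem finite (hF : Module.Finite R (Res F R)) [Module.Finite R X] :
    Module.Finite R (Res F X) := by
  obtain ⟨n, f, hf⟩ := Module.Finite.exists_fin' R X
  have : Module.Finite R (Res F (Fin n → R)) := Module.Finite.equiv (piEquiv F (Fin n)).symm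
  refine Module.Finite.of_surjective (map F f) fun x ↦ ?_
  obtain ⟨y, hy⟩ := hf ((of F).symm x)
  exact ⟨of F y, by rw [map_of, hy]; rfl⟩

end Res

/-- The coextension of scalars `Hom_R(Res R, X)` along `F`. -/
def Coext (F : R →+* R) (X : Type u) [AddCommGroup X] [Module R X] : Type u :=
  Res F R →ₗ[R] X

namespace Coext

variable (F : R →+* R) {X Y : Type u} [AddCommGroup X] [Module R X] [AddCommGroup Y] [Module R Y]
  {N N' : Type u} [AddCommGroup N] [Module R N] [AddCommGroup N'] [Module R N']

instance : AddCommGroup (Coext F X) := inferInstanceAs (AddCommGroup (Res F R →ₗ[R] X))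

/-- Evaluation of an element of the coextension. -/
def eval : Coext F X ≃+ (Res F R →ₗ[R] X) := AddEquiv.refl _

variable {F}

@[ext]
theorem ext {φ ψ : Coext F X} (h : ∀ y : R, eval F φ (Res.of F y) = eval F ψ (Res.of F y)) :
    φ = ψ :=
  (eval F).injective (Res.hom_ext h)

/-- Multiplication by `r` as an endomorphism of `Res F R`. -/
def mulRes (F : R →+* R) (r : R) : Res F R →ₗ[R] Res F R := Res.map F (LinearMap.mulLeft R r)

instance : SMul R (Coext F X) := ⟨fun r φ ↦ (eval F).symm (eval F φ ∘ₗ mulRes F r)⟩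

@[simp] theorem eval_smul (r : R) (φ : Coext F X) (y : R) :
    eval F (r • φ) (Res.of F y) = eval F φ (Res.of F (r * y)) := rfl

instance : Module R (Coext F X) where
  one_smul φ := by ext; simp
  mul_smul r s φ := by ext y; simp only [eval_smul]; congr 2; ring
  smul_zero r := by ext; simp
  smul_add r φ ψ := by ext; simp
  add_smul r s φ := by ext; simp [add_mul]
  zero_smul φ := by ext; simp

theorem eval_map_smul (r : R) (φ : Coext F X) : eval F (F r • φ) = r • eval F φ := by
  ext y
  simp only [eval_smul, LinearMap.smul_apply, ← map_smul, Res.smul_of, smul_eq_mul]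

/-- The adjunction between restriction and coextension. -/
def homEquiv (F : R →+* R) (N X : Type u) [AddCommGroup N] [Module R N] [AddCommGroup X]
    [Module R X] : (N →ₗ[R] Coext F X) ≃+ (Res F N →ₗ[R] X) where
  toFun φ :=
    { toFun x := eval F (φ ((Res.of F).symm x)) (Res.of F 1)
      map_add' x y := by simp
      map_smul' r x := by
        rw [Res.of_symm_smul, map_smul, eval_map_smul]; rfl }
  invFun θ :=
    { toFun n := (eval F).symm
        { toFun y := θ (Res.of F ((Res.of F).symm y • n))
          map_add' y z := by simp [add_smul]
          map_smul' r y := by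
            rw [Res.of_symm_smul, RingHom.id_apply, ← map_smul θ, Res.smul_of, smul_smul,
              smul_eq_mul] }
      map_add' m n := by
        ext y
        change θ (Res.of F (y • (m + n))) = θ (Res.of F (y • m)) + θ (Res.of F (y • n))
        simp
      map_smul' r n := by
        ext y
        change θ (Res.of F (y • r • n)) = θ (Res.of F ((r * y) • n))
        rw [smul_smul, mul_comm] }
  left_inv φ := by
    ext n y
    change eval F (φ (y • n)) (Res.of F 1) = _
    rw [map_smul, eval_smul, mul_one]
  right_inv θ := by
    ext n
    change θ (Res.of F ((1 : R) • n)) = _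
    rw [one_smul]
  map_add' φ ψ := by
    ext n
    simp

theorem homEquiv_of (φ : N →ₗ[R] Coext F X) (n : N) :
    homEquiv F N X φ (Res.of F n) = eval F (φ n) (Res.of F 1) := rfl

theorem homEquiv_map_smul (r : R) (φ : N →ₗ[R] Coext F X) :
    homEquiv F N X (F r • φ) = r • homEquiv F N X φ := by
  ext n
  rw [homEquiv_of, LinearMap.smul_apply, eval_map_smul]; rfl

theorem homEquiv_comp (φ : N' →ₗ[R] Coext F X) (f : N →ₗ[R] N') :
    homEquiv F N X (φ ∘ₗ f) = homEquiv F N' X φ ∘ₗ Res.map F f := rfl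

/-- Restricting the coextension gives back `Hom_R(Res R, X)` with its usual structure. -/
def resEquiv (F : R →+* R) (X : Type u) [AddCommGroup X] [Module R X] :
    Res F (Coext F X) ≃ₗ[R] (Res F R →ₗ[R] X) where
  __ := (Res.of F).symm.trans (eval F)
  map_smul' r φ := eval_map_smul r ((Res.of F).symm φ)

theorem finite [IsNoetherianRing R] (hF : Module.Finite R (Res F R)) [Module.Finite R X] :
    Module.Finite R (Coext F X) := by
  have h : Module.Finite R (Res F (Coext F X)) := Module.Finite.equiv (resEquiv F X).symm
  obtain ⟨s, hs⟩ := h.fg_top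
  classical
  refine ⟨⟨s.image (Res.of F).symm, ?_⟩⟩
  rw [eq_top_iff]
  intro x _
  have hx : Res.of F x ∈ Submodule.span R (s : Set (Res F (Coext F X))) := hs ▸ Submodule.mem_top
  suffices H : ∀ y ∈ Submodule.span R (s : Set (Res F (Coext F X))),
      (Res.of F).symm y ∈ Submodule.span R (↑(s.image (Res.of F).symm) : Set (Coext F X)) from
    H _ hx
  intro y hy
  induction hy using Submodule.span_induction with
  | mem y hy => exact Submodule.subset_span (Finset.mem_coe.mpr (Finset.mem_image_of_mem _ hy))
  | zero => simp
  | add y z _ _ hy hz => rw [map_add]; exact add_mem hy hz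
  | smul r y _ hy => rw [Res.of_symm_smul]; exact Submodule.smul_mem _ _ hy

end Coext

theorem ext_pi_subsingleton {N X : Type u} [AddCommGroup N] [Module R N] [AddCommGroup X]
    [Module R X] (n k : ℕ) [Subsingleton (ExtMod R n N X)] :
    Subsingleton (ExtMod R n (Fin k → N) X) := by
  refine subsingleton_of_forall_eq 0 fun z ↦ ?_
  have hid : (LinearMap.id : (Fin k → N) →ₗ[R] (Fin k → N)) =
      ∑ j, (LinearMap.single R (fun _ ↦ N) j) ∘ₗ (LinearMap.proj j) := by
    ext i x j; simp [Finset.sum_apply, Pi.single_apply]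
  rw [← extPull_id n z, hid, extPull_sum, LinearMap.sum_apply]
  refine Finset.sum_eq_zero fun j _ ↦ ?_
  rw [extPull_comp, Subsingleton.elim (extPull n X (LinearMap.single R (fun _ ↦ N) j) z) 0,
    map_zero]

theorem exists_semilinear_addEquiv_of_surjective (F : R →+* R) {A A' B B' : Type*}
    [AddCommGroup A] [Module R A] [AddCommGroup A'] [Module R A'] [AddCommGroup B] [Module R B]
    [AddCommGroup B'] [Module R B'] (δ : A →ₗ[R] B) (δ' : A' →ₗ[R] B')
    (hδ : Function.Surjective δ) (hδ' : Function.Surjective δ') (e : A ≃+ A')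
    (h : ∀ a, δ a = 0 ↔ δ' (e a) = 0) (he : ∀ (r : R) a, e (F r • a) = r • e a) :
    ∃ e' : B ≃+ B', ∀ (r : R) b, e' (F r • b) = r • e' b := by
  choose σ hσ using hδ
  have key (a : A) : δ' (e (σ (δ a))) = δ' (e a) := by
    rw [← sub_eq_zero, ← map_sub, ← map_sub, ← h, map_sub, hσ, sub_self]
  let E : B →+ B' := AddMonoidHom.mk' (fun b ↦ δ' (e (σ b))) fun b c ↦ by
    obtain ⟨b, rfl⟩ : ∃ a, δ a = b := ⟨_, hσ b⟩
    obtain ⟨c, rfl⟩ : ∃ a, δ a = c := ⟨_, hσ c⟩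
    rw [← map_add, key, key, key, map_add, map_add]
  refine ⟨AddEquiv.ofBijective E ⟨?_, ?_⟩, ?_⟩
  · rw [injective_iff_map_eq_zero]
    intro b hb
    have hb' : δ' (e (σ b)) = 0 := hb
    rwa [← h, hσ] at hb'
  · intro b
    obtain ⟨a, rfl⟩ := hδ' b
    exact ⟨δ (e.symm a), by change δ' (e (σ _)) = _; rw [key, e.apply_symm_apply]⟩
  · intro r b
    change δ' (e (σ _)) = r • δ' (e (σ b))
    obtain ⟨b, rfl⟩ : ∃ a, δ a = b := ⟨_, hσ b⟩
    rw [← map_smul, key, he, map_smul, key]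

/-- A finite presentation step `0 → K → R^k → N → 0`. -/
theorem exists_syzygy (R : Type u) [CommRing R] [IsNoetherianRing R] (N : Type u)
    [AddCommGroup N] [Module R N] [Module.Finite R N] :
    ∃ (k : ℕ) (K : Submodule R (Fin k → R)) (g : (Fin k → R) →ₗ[R] N),
      Function.Exact K.subtype g ∧ Function.Surjective g := by
  obtain ⟨k, g, hg⟩ := Module.Finite.exists_fin' R N
  refine ⟨k, LinearMap.ker g, g, ?_, hg⟩
  rw [LinearMap.exact_iff, Submodule.range_subtype]

theorem exists_ext_coext_addEquiv [IsNoetherianRing R] (F : R →+* R) (X : Type u)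
    [AddCommGroup X] [Module R X] (hX : ∀ i, Subsingleton (ExtMod R (i + 1) (Res F R) X)) (n : ℕ)
    (N : Type u) [AddCommGroup N] [Module R N] [Module.Finite R N] :
    ∃ e : ExtMod R n N (Coext F X) ≃+ ExtMod R n (Res F N) X,
      ∀ (r : R) z, e (F r • z) = r • e z := by
  have base (N : Type u) [AddCommGroup N] [Module R N] :
      ∃ e : ExtMod R 0 N (Coext F X) ≃+ ExtMod R 0 (Res F N) X, (∀ z,
        e z = (extZeroEquiv _ _).symm (Coext.homEquiv F N X (extZeroEquiv _ _ z))) ∧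
      ∀ (r : R) z, e (F r • z) = r • e z :=
    ⟨((extZeroEquiv _ _).toAddEquiv.trans (Coext.homEquiv F N X)).trans
      (extZeroEquiv _ _).symm.toAddEquiv, fun z ↦ rfl, fun r z ↦ by
      simp [Coext.homEquiv_map_smul]⟩
  induction n generalizing N with
  | zero => obtain ⟨e, -, he⟩ := base N; exact ⟨e, he⟩
  | succ n ih =>
    obtain ⟨k, K, g, hex, hg⟩ := exists_syzygy R N
    have hres (i) : Subsingleton (ExtMod R (i + 1) (Res F (Fin k → R)) X) := by
      have := ext_pi_subsingleton (R := R) (N := Res F R) (X := X) (i + 1) k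
      exact (extPullEquiv (i + 1) X (Res.piEquiv F (Fin k))).symm.injective.subsingleton
    have hproj (i) : Subsingleton (ExtMod R (i + 1) (Fin k → R) (Coext F X)) :=
      ext_subsingleton_of_projective i
    have hex' : Function.Exact (Res.map F K.subtype) (Res.map F g) := hex
    have hg' : Function.Surjective (Res.map F g) := hg
    obtain ⟨δ, h₁, h₂⟩ := exists_extPull_connecting n (Coext F X) K.injective_subtype hex hg
    obtain ⟨δ', h₁', h₂'⟩ := exists_extPull_connecting n X
      (f := Res.map F K.subtype) K.injective_subtype hex' hg'
    have hδ : Function.Surjective δ := fun z ↦ (h₂ z).mp (Subsingleton.elim _ _)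
    have hδ' : Function.Surjective δ' := fun z ↦ (h₂' z).mp (Subsingleton.elim _ _)
    cases n with
    | succ n =>
      obtain ⟨e, he⟩ := ih K
      refine exists_semilinear_addEquiv_of_surjective F δ δ' hδ hδ' e (fun a ↦ ?_) he
      rw [h₁ a, h₁' (e a)]
      have h0 (y) : extPull (n + 1) (Coext F X) K.subtype y = 0 := by
        rw [Subsingleton.elim y 0, map_zero]
      have h0' (y) : extPull (n + 1) X (Res.map F K.subtype) y = 0 := by
        rw [Subsingleton.elim y 0, map_zero]
      constructor
      · rintro ⟨y, rfl⟩; exact ⟨0, by rw [h0, map_zero, map_zero]⟩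
      · rintro ⟨y, hy⟩
        exact ⟨0, by rw [h0]; apply e.injective; rw [← hy, h0', map_zero]⟩
    | zero =>
      obtain ⟨e, he, he'⟩ := base K
      obtain ⟨eP, heP, -⟩ := base (Fin k → R)
      refine exists_semilinear_addEquiv_of_surjective F δ δ' hδ hδ' e (fun a ↦ ?_) he'
      rw [h₁ a, h₁' (e a)]
      have nat (y) : e (extPull 0 (Coext F X) K.subtype y) =
          extPull 0 X (Res.map F K.subtype) (eP y) := by
        rw [he, heP]
        apply (extZeroEquiv _ _).injective
        rw [extZeroEquiv_pull, extZeroEquiv_pull, LinearEquiv.apply_symm_apply,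
          LinearEquiv.apply_symm_apply, Coext.homEquiv_comp]
      constructor
      · rintro ⟨y, rfl⟩; exact ⟨eP y, (nat y).symm⟩
      · rintro ⟨y, hy⟩
        exact ⟨eP.symm y, e.injective (by rw [nat, eP.apply_symm_apply, hy])⟩

end ChangeOfRings

/-! ### Duality with respect to a semidualizing module of finite injective dimension -/

section Duality

variable (R : Type u) [CommRing R]

/-- `Ext^i(X, D) = 0` for all `i > 0`. -/
def ExtAcyclic (X D : Type u) [AddCommGroup X] [Module R X] [AddCommGroup D] [Module R D] :
    Prop := ∀ i, Subsingleton (ExtMod R (i + 1) X D)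

/-- `Ext^i(-, D)` vanishes on finitely generated modules for `i ≫ 0`. -/
def ExtBounded (D : Type u) [AddCommGroup D] [Module R D] : Prop :=
  ∃ n, ∀ (M : Type u) [AddCommGroup M] [Module R M] [Module.Finite R M] (i : ℕ), n < i →
    Subsingleton (ExtMod R i M D)

/-- A semidualizing module of finite injective dimension. -/
structure IsDual (D : Type u) [AddCommGroup D] [Module R D] : Prop where
  finite : Module.Finite R D
  bounded : ExtBounded R D
  bijective : Function.Bijective (algebraMap R (Module.End R D))
  acyclic : ExtAcyclic R D D

variable {R}
variable {D X : Type u} [AddCommGroup D] [Module R D] [AddCommGroup X] [Module R X]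

theorem ExtAcyclic.of_equiv {X' : Type u} [AddCommGroup X'] [Module R X'] (h : ExtAcyclic R X D)
    (e : X ≃ₗ[R] X') : ExtAcyclic R X' D := fun i ↦
  have := h i
  (extPullEquiv (i + 1) D e).injective.subsingleton

section LongExactSequence

variable {A B C : Type u} [AddCommGroup A] [Module R A] [AddCommGroup B] [Module R B]
  [AddCommGroup C] [Module R C] {f : A →ₗ[R] B} {g : B →ₗ[R] C}

theorem ext_subsingleton_left (hf : Function.Injective f)
    (hfg : Function.Exact f g) (hg : Function.Surjective g)
    (n : ℕ) [Subsingleton (ExtMod R n B D)]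
    [Subsingleton (ExtMod R (n + 1) C D)] : Subsingleton (ExtMod R n A D) := by
  obtain ⟨δ, h₁, -⟩ := exists_extPull_connecting n D hf hfg hg
  refine subsingleton_of_forall_eq 0 fun z ↦ ?_
  obtain ⟨y, rfl⟩ := (h₁ z).mp (Subsingleton.elim _ _)
  rw [Subsingleton.elim y 0, map_zero]

theorem ext_subsingleton_right (hf : Function.Injective f)
    (hfg : Function.Exact f g) (hg : Function.Surjective g)
    (n : ℕ) [Subsingleton (ExtMod R n A D)]
    [Subsingleton (ExtMod R (n + 1) B D)] : Subsingleton (ExtMod R (n + 1) C D) := by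
  obtain ⟨δ, -, h₂⟩ := exists_extPull_connecting n D hf hfg hg
  refine subsingleton_of_forall_eq 0 fun z ↦ ?_
  obtain ⟨y, rfl⟩ := (h₂ z).mp (Subsingleton.elim _ _)
  rw [Subsingleton.elim y 0, map_zero]

theorem exists_extension_of_ext_one (hf : Function.Injective f)
    (hfg : Function.Exact f g) (hg : Function.Surjective g)
    [Subsingleton (ExtMod R 1 C D)] (φ : A →ₗ[R] D) :
    ∃ ψ : B →ₗ[R] D, ψ ∘ₗ f = φ := by
  obtain ⟨δ, h₁, -⟩ := exists_extPull_connecting 0 D hf hfg hg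
  obtain ⟨y, hy⟩ := (h₁ ((extZeroEquiv A D).symm φ)).mp (Subsingleton.elim (α := ExtMod R 1 C D) _ _)
  exact ⟨extZeroEquiv B D y, by rw [← extZeroEquiv_pull, hy, LinearEquiv.apply_symm_apply]⟩

theorem ext_one_subsingleton_of_extension (hf : Function.Injective f)
    (hfg : Function.Exact f g) (hg : Function.Surjective g)
    [Subsingleton (ExtMod R 1 B D)]
    (h : ∀ φ : A →ₗ[R] D, ∃ ψ : B →ₗ[R] D, ψ ∘ₗ f = φ) : Subsingleton (ExtMod R 1 C D) := by
  obtain ⟨δ, h₁, h₂⟩ := exists_extPull_connecting 0 D hf hfg hg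
  refine subsingleton_of_forall_eq 0 fun z ↦ ?_
  obtain ⟨y, rfl⟩ := (h₂ z).mp (Subsingleton.elim (α := ExtMod R 1 B D) _ _)
  obtain ⟨ψ, hψ⟩ := h (extZeroEquiv A D y)
  refine (h₁ y).mpr ⟨(extZeroEquiv B D).symm ψ, ?_⟩
  apply (extZeroEquiv A D).injective
  rw [extZeroEquiv_pull, LinearEquiv.apply_symm_apply, hψ]

end LongExactSequence

/-- Evaluation `X → Hom(Hom(X, D), D)`. -/
def evalDual (D X : Type u) [AddCommGroup D] [Module R D] [AddCommGroup X] [Module R X] :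
    X →ₗ[R] ((X →ₗ[R] D) →ₗ[R] D) := LinearMap.id.flip

@[simp] theorem evalDual_apply (x : X) (φ : X →ₗ[R] D) : evalDual D X x φ = φ x := rfl

theorem evalDual_free_bijective (hD : Function.Bijective (algebraMap R (Module.End R D))) (k : ℕ) :
    Function.Bijective (evalDual (R := R) D (Fin k → R)) := by
  constructor
  · rw [injective_iff_map_eq_zero]
    intro v hv
    ext j
    apply hD.1
    ext d
    have := congr($hv ((LinearMap.proj j).smulRight d))
    simpa using this
  · intro τ
    let T (j : Fin k) : D →ₗ[R] ((Fin k → R) →ₗ[R] D) :=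
      LinearMap.smulRightₗ (LinearMap.proj j)
    choose a ha using fun j ↦ hD.2 (τ ∘ₗ T j)
    refine ⟨a, ?_⟩
    ext φ
    have hφ : φ = ∑ j, T j (φ (Pi.single j 1)) := by
      ext j
      simp [T, Pi.single_apply]
    have h1 (j) (d) : τ (T j d) = a j • d := by
      have := congr($(ha j) d)
      simpa using this.symm
    conv_rhs => rw [hφ]
    rw [map_sum, evalDual_apply]
    simp_rw [h1, ← map_smul]
    rw [← map_sum]
    congr 1
    ext j
    simp [Pi.single_apply]

theorem acyclic_dual_free (hD : ExtAcyclic R D D) (k : ℕ) :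
    ExtAcyclic R ((Fin k → R) →ₗ[R] D) D := by
  have h : ExtAcyclic R (Fin k → D) D := fun i ↦
    have := hD i
    ext_pi_subsingleton (i + 1) k
  exact h.of_equiv ((LinearMap.lsum R (fun _ : Fin k ↦ R) R).symm.trans
    (LinearEquiv.piCongrRight fun _ ↦ LinearMap.ringLmapEquivSelf R R D)).symm

theorem ExtAcyclic.syzygy {k : ℕ} {K : Submodule R (Fin k → R)} {g : (Fin k → R) →ₗ[R] X}
    (h : ExtAcyclic R X D) (hex : Function.Exact K.subtype g) (hg : Function.Surjective g) :
    ExtAcyclic R K D := fun i ↦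
  have := h (i + 1)
  have : Subsingleton (ExtMod R (i + 1) (Fin k → R) D) := ext_subsingleton_of_projective i
  ext_subsingleton_left K.injective_subtype hex hg (i + 1)

theorem lcomp_subtype_surjective {k : ℕ} {K : Submodule R (Fin k → R)} {g : (Fin k → R) →ₗ[R] X}
    (h : ExtAcyclic R X D) (hex : Function.Exact K.subtype g) (hg : Function.Surjective g) :
    Function.Surjective (LinearMap.lcomp R D K.subtype) := fun φ ↦
  have := h 0
  exists_extension_of_ext_one K.injective_subtype hex hg φ

theorem IsDual.acyclic_dual [IsNoetherianRing R] (hD : IsDual R D) [Module.Finite R X]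
    (hX : ExtAcyclic R X D) : ExtAcyclic R (X →ₗ[R] D) D := by
  obtain ⟨b, hb⟩ := hD.bounded
  have := hD.finite
  suffices H : ∀ (j : ℕ) (X : Type u) [AddCommGroup X] [Module R X] [Module.Finite R X],
      ExtAcyclic R X D → ∀ i, b < i + 1 + j → Subsingleton (ExtMod R (i + 1) (X →ₗ[R] D) D) from
    fun i ↦ H b X hX i (by omega)
  intro j
  induction j with
  | zero => intro X _ _ _ _ i hi; exact hb _ _ hi
  | succ j ih =>
    intro X _ _ _ hX i hi
    obtain ⟨k, K, g, hex, hg⟩ := exists_syzygy R X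
    have := ih K (hX.syzygy hex hg) (i + 1) (by omega)
    have := acyclic_dual_free hD.acyclic k i
    exact ext_subsingleton_left (LinearMap.lcomp_injective_of_surjective g hg)
      (LinearMap.exact_lcomp_of_exact_of_surjective D hex hg) (lcomp_subtype_surjective hX hex hg)
      (i + 1)

theorem IsDual.evalDual_surjective [IsNoetherianRing R] (hD : IsDual R D) [Module.Finite R X]
    (hX : ExtAcyclic R X D) : Function.Surjective (evalDual (R := R) D X) := by
  intro σ
  obtain ⟨k, K, g, hex, hg⟩ := exists_syzygy R X
  have := hD.acyclic_dual (hX.syzygy hex hg) 0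
  obtain ⟨τ, hτ⟩ := exists_extension_of_ext_one (LinearMap.lcomp_injective_of_surjective g hg)
    (LinearMap.exact_lcomp_of_exact_of_surjective D hex hg) (lcomp_subtype_surjective hX hex hg) σ
  obtain ⟨v, rfl⟩ := (evalDual_free_bijective hD.bijective k).2 τ
  exact ⟨g v, hτ⟩

theorem IsDual.evalDual_bijective [IsNoetherianRing R] (hD : IsDual R D) [Module.Finite R X]
    (hX : ExtAcyclic R X D) : Function.Bijective (evalDual (R := R) D X) := by
  refine ⟨?_, hD.evalDual_surjective hX⟩
  rw [injective_iff_map_eq_zero]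
  intro x hx
  obtain ⟨k, K, g, hex, hg⟩ := exists_syzygy R X
  obtain ⟨v, rfl⟩ := hg x
  have hsurj := lcomp_subtype_surjective hX hex hg
  have hexact := LinearMap.exact_lcomp_of_exact_of_surjective D hex hg
  have h0 : LinearMap.lcomp R D (LinearMap.lcomp R D g) (evalDual D (Fin k → R) v) = 0 := by
    ext φ
    exact congr($hx φ)
  obtain ⟨ρ, hρ⟩ := (LinearMap.exact_lcomp_of_exact_of_surjective D hexact hsurj _).mp h0
  obtain ⟨w, rfl⟩ := hD.evalDual_surjective (hX.syzygy hex hg) ρ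
  have : v = K.subtype w := by
    apply (evalDual_free_bijective hD.bijective k).1
    rw [← hρ]
    rfl
  rw [this, hex.apply_apply_eq_zero]

theorem IsDual.exists_embedding [IsNoetherianRing R] (hD : IsDual R D) [Module.Finite R X]
    (hX : ExtAcyclic R X D) : ∃ (k : ℕ) (f : X →ₗ[R] (Fin k → D)), Function.Injective f ∧
      ExtAcyclic R ((Fin k → D) ⧸ LinearMap.range f) D := by
  have := hD.finite
  obtain ⟨k, s, hs⟩ := Module.Finite.exists_fin (R := R) (M := X →ₗ[R] D)
  let f : X →ₗ[R] (Fin k → D) := LinearMap.pi s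
  have hgen (φ : X →ₗ[R] D) : ∃ ψ : (Fin k → D) →ₗ[R] D, ψ ∘ₗ f = φ := by
    have hφ : φ ∈ Submodule.span R (Set.range s) := hs ▸ Submodule.mem_top
    obtain ⟨c, rfl⟩ := (Submodule.mem_span_range_iff_exists_fun R).mp hφ
    exact ⟨∑ j, c j • LinearMap.proj j, by ext x; simp [f]⟩
  have hinj : Function.Injective f := by
    rw [injective_iff_map_eq_zero]
    intro x hx
    apply (hD.evalDual_bijective hX).1
    ext φ
    obtain ⟨ψ, rfl⟩ := hgen φ
    simp [hx]
  have hexact : Function.Exact f (LinearMap.range f).mkQ := by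
    rw [LinearMap.exact_iff, Submodule.ker_mkQ]
  have hsurj := (LinearMap.range f).mkQ_surjective
  refine ⟨k, f, hinj, fun i ↦ ?_⟩
  have hpi (i) : Subsingleton (ExtMod R (i + 1) (Fin k → D) D) :=
    have := hD.acyclic i
    ext_pi_subsingleton (i + 1) k
  cases i with
  | zero =>
    have := hpi 0
    exact ext_one_subsingleton_of_extension hinj hexact hsurj hgen
  | succ i =>
    have := hX i
    exact ext_subsingleton_right hinj hexact hsurj (i + 1)

/-- A bounded module `D` such that `D` and a dualizing module `D'` are mutually acyclic is a
summand of a power of `D'`. -/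
theorem IsDual.exists_retract [IsNoetherianRing R] {D' : Type u} [AddCommGroup D'] [Module R D']
    (hD' : IsDual R D') [Module.Finite R D] (hb : ExtBounded R D) (h₁ : ExtAcyclic R D D')
    (h₂ : ExtAcyclic R D' D) : ∃ (k : ℕ) (f : D →ₗ[R] (Fin k → D')) (g : (Fin k → D') →ₗ[R] D),
      g ∘ₗ f = LinearMap.id := by
  have := hD'.finite
  obtain ⟨b, hb⟩ := hb
  have key : ∀ (j : ℕ) (X : Type u) [AddCommGroup X] [Module R X] [Module.Finite R X],
      ExtAcyclic R X D' → ∀ i, b < i + 1 + j → Subsingleton (ExtMod R (i + 1) X D) := by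
    intro j
    induction j with
    | zero => intro X _ _ _ _ i hi; exact hb _ _ hi
    | succ j ih =>
      intro X _ _ _ hX i hi
      obtain ⟨k, f, hf, hc⟩ := hD'.exists_embedding hX
      have := ih _ hc (i + 1) (by omega)
      have := h₂ i
      have := ext_pi_subsingleton (R := R) (N := D') (X := D) (i + 1) k
      exact ext_subsingleton_left hf (LinearMap.exact_iff.mpr (Submodule.ker_mkQ _))
        (LinearMap.range f).mkQ_surjective (i + 1)
  obtain ⟨k, f, hf, hc⟩ := hD'.exists_embedding h₁
  have := key b _ hc 0 (by omega)
  obtain ⟨g, hg⟩ := exists_extension_of_ext_one hf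
    (LinearMap.exact_iff.mpr (Submodule.ker_mkQ _)) (LinearMap.range f).mkQ_surjective
    (LinearMap.id : D →ₗ[R] D)
  exact ⟨k, f, g, hg⟩

theorem IsDual.coext [IsNoetherianRing R] (hD : IsDual R D) (F : R →+* R)
    (hF : Module.Finite R (Res F R)) (hR : ExtAcyclic R (Res F R) D) : IsDual R (Coext F D) := by
  have := hD.finite
  have hfin := Coext.finite (X := D) hF
  refine ⟨hfin, ?_, ?_, ?_⟩
  · obtain ⟨b, hb⟩ := hD.bounded
    refine ⟨b, fun M _ _ _ i hi ↦ ?_⟩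
    obtain ⟨e, -⟩ := exists_ext_coext_addEquiv F D hR i M
    have := Res.finite F hF (X := M)
    have := hb (Res F M) i hi
    exact e.injective.subsingleton
  · have h := hD.evalDual_bijective hR
    let e : (Coext F D →ₗ[R] Coext F D) ≃ ((Res F R →ₗ[R] D) →ₗ[R] D) :=
      (Coext.homEquiv F (Coext F D) D).toEquiv.trans
        (LinearEquiv.congrLeft D R (Coext.resEquiv F D)).toEquiv
    refine (e.bijective.of_comp_iff' _).mp ?_
    have : e ∘ algebraMap R (Module.End R (Coext F D)) = evalDual D (Res F R) ∘ Res.of F := by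
      funext r
      refine LinearMap.ext fun φ ↦ ?_
      change φ (Res.of F (r * 1)) = φ (Res.of F r)
      rw [mul_one]
    rw [this]
    exact h.comp (Res.of F).bijective
  · intro i
    obtain ⟨e, -⟩ := exists_ext_coext_addEquiv F D hR (i + 1) (Coext F D)
    have := ((hD.acyclic_dual hR).of_equiv (Coext.resEquiv F D).symm) i
    exact e.injective.subsingleton

end Duality

/-! ### Torsion with respect to a multiplicative set and regularity up to torsion -/

section Torsion

variable {R : Type*} [CommRing R] (T : Submonoid R)

/-- Every element of `X` is killed by an element of `T`. -/
def TTorsion (X : Type*) [AddCommGroup X] [Module R X] : Prop :=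
  ∀ z : X, ∃ s ∈ T, s • z = 0

variable {T}
variable {X Y Z : Type*} [AddCommGroup X] [Module R X] [AddCommGroup Y] [Module R Y]
  [AddCommGroup Z] [Module R Z]

theorem TTorsion.of_subsingleton [Subsingleton X] : TTorsion T X := fun _ ↦
  ⟨1, T.one_mem, Subsingleton.elim _ _⟩

theorem TTorsion.of_smul_eq_zero {s : R} (hs : s ∈ T) (h : ∀ x : X, s • x = 0) : TTorsion T X :=
  fun x ↦ ⟨s, hs, h x⟩

theorem TTorsion.of_injective (h : TTorsion T Y) (f : X →ₗ[R] Y) (hf : Function.Injective f) :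
    TTorsion T X := fun x ↦ by
  obtain ⟨s, hs, h⟩ := h (f x)
  exact ⟨s, hs, hf (by rw [map_smul, h, map_zero])⟩

theorem TTorsion.of_exact {f : X →ₗ[R] Y} {g : Y →ₗ[R] Z} (hfg : Function.Exact f g)
    (hX : TTorsion T X) (hZ : TTorsion T Z) : TTorsion T Y := by
  intro y
  obtain ⟨s, hs, h⟩ := hZ (g y)
  rw [← map_smul] at h
  obtain ⟨x, hx⟩ := (hfg _).mp h
  obtain ⟨t, ht, h'⟩ := hX x
  exact ⟨t * s, T.mul_mem ht hs, by rw [mul_smul, ← hx, ← map_smul, h', map_zero]⟩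

theorem exists_smul_mem_of_fg (U V : Submodule R X) (hV : V.FG)
    (h : ∀ x ∈ V, ∃ s ∈ T, s • x ∈ U) : ∃ s ∈ T, ∀ x ∈ V, s • x ∈ U := by
  induction V, hV using Submodule.fg_induction with
  | singleton v =>
    obtain ⟨s, hs, hsv⟩ := h v (Submodule.mem_span_singleton_self v)
    refine ⟨s, hs, fun x hx ↦ ?_⟩
    obtain ⟨a, rfl⟩ := Submodule.mem_span_singleton.mp hx
    rw [smul_comm]
    exact U.smul_mem a hsv
  | sup V W _ _ hV hW =>
    obtain ⟨s, hs, hsV⟩ := hV fun x hx ↦ h x (Submodule.mem_sup_left hx)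
    obtain ⟨t, ht, htW⟩ := hW fun x hx ↦ h x (Submodule.mem_sup_right hx)
    refine ⟨s * t, T.mul_mem hs ht, fun x hx ↦ ?_⟩
    obtain ⟨v, hv, w, hw, rfl⟩ := Submodule.mem_sup.mp hx
    rw [smul_add]
    refine U.add_mem ?_ ?_
    · rw [mul_comm, mul_smul]; exact U.smul_mem t (hsV v hv)
    · rw [mul_smul]; exact U.smul_mem s (htW w hw)

theorem TTorsion.exists_smul_eq_zero [Module.Finite R X] (h : TTorsion T X) :
    ∃ s ∈ T, ∀ x : X, s • x = 0 := by
  obtain ⟨s, hs, h'⟩ := exists_smul_mem_of_fg (T := T) (⊥ : Submodule R X) ⊤ Module.Finite.fg_top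
    fun x _ ↦ by simpa using h x
  exact ⟨s, hs, fun x ↦ by simpa using h' x trivial⟩

/-- Nakayama's lemma up to torsion. -/
theorem TTorsion.of_smul_mem_range {m : Ideal R} [m.IsMaximal] [Module.Finite R X] {x : R}
    (hx : x ∈ m) (h : ∀ z : X, ∃ s ∈ m.primeCompl, ∃ y : X, s • z = x • y) :
    TTorsion m.primeCompl X := by
  obtain ⟨s, hs, h'⟩ := exists_smul_mem_of_fg (T := m.primeCompl)
    (LinearMap.range (LinearMap.lsmul R X x)) ⊤ Module.Finite.fg_top fun z _ ↦ by
      obtain ⟨s, hs, y, hy⟩ := h z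
      exact ⟨s, hs, y, hy.symm⟩
  obtain ⟨t, ht⟩ := Ideal.IsMaximal.exists_inv ‹m.IsMaximal› hs
  obtain ⟨y, hy, hty⟩ := ht
  obtain ⟨r, hr, hr'⟩ := Submodule.exists_sub_one_mem_and_smul_eq_zero_of_fg_of_le_smul m
    (⊤ : Submodule R X) Module.Finite.fg_top (by
      intro z _
      have hz : z = t • s • z + y • z := by rw [smul_smul, ← add_smul, hty, one_smul]
      rw [hz]
      refine add_mem (Submodule.smul_mem _ t ?_) (Submodule.smul_mem_smul hy trivial)
      obtain ⟨w, hw⟩ := h' z trivial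
      rw [← hw]
      exact Submodule.smul_mem_smul hx trivial)
  refine TTorsion.of_smul_eq_zero (s := r) (fun hrm ↦ ?_) fun z ↦ hr' z trivial
  have : (1 : R) ∈ m := by simpa using m.sub_mem hrm hr
  exact (Ideal.ne_top_iff_one m).mp (Ideal.IsMaximal.ne_top ‹_›) this

theorem subsingleton_of_forall_ttorsion
    (h : ∀ (m : Ideal R) [m.IsMaximal], TTorsion m.primeCompl X) : Subsingleton X := by
  refine subsingleton_of_forall_eq 0 fun z ↦ ?_
  by_contra hz
  obtain ⟨m, hm, hle⟩ := Ideal.exists_le_maximal (Ideal.torsionOf R X z)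
    (by rwa [Ne, Ideal.torsionOf_eq_top_iff])
  obtain ⟨s, hs, hsz⟩ := h m z
  exact hs (hle ((Ideal.mem_torsionOf_iff z s).mpr hsz))

end Torsion

section LocallyRegular

variable {R : Type*} [CommRing R] (T : Submonoid R)
variable {N : Type*} [AddCommGroup N] [Module R N]

/-- The submodule `x N`. -/
def mulRange (N : Type*) [AddCommGroup N] [Module R N] (x : R) : Submodule R N :=
  LinearMap.range (LinearMap.lsmul R N x)

theorem smul_mem_mulRange (x : R) (y : N) : x • y ∈ mulRange N x := ⟨y, rfl⟩

theorem mem_sup_mulRange {U : Submodule R N} {x : R} {z : N} :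
    z ∈ U ⊔ mulRange N x ↔ ∃ u ∈ U, ∃ y, z = u + x • y := by
  rw [Submodule.mem_sup]
  constructor
  · rintro ⟨u, hu, _, ⟨y, rfl⟩, rfl⟩; exact ⟨u, hu, y, rfl⟩
  · rintro ⟨u, hu, y, rfl⟩; exact ⟨u, hu, _, ⟨y, rfl⟩, rfl⟩

/-- The sequence is regular on `N / U` up to `T`-torsion. -/
def LReg : List R → Submodule R N → Prop
  | [], _ => True
  | x :: xs, U => (∀ y : N, x • y ∈ U → ∃ s ∈ T, s • y ∈ U) ∧ LReg xs (U ⊔ mulRange N x)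

/-- The submodule `U + (xs) N`. -/
def supRange : List R → Submodule R N → Submodule R N
  | [], U => U
  | x :: xs, U => supRange xs (U ⊔ mulRange N x)

variable {T}

theorem LReg.of_three_term (ys : List R) (x : R) (U₁ U₂ : Submodule R N)
    (h₁ : ∀ z : N, x • z ∈ U₂ → ∃ s ∈ T, s • z ∈ U₁) (h₂ : ∀ z ∈ U₁, x • z ∈ U₂)
    (h₃ : LReg T ys U₁) (h₄ : LReg T ys (U₂ ⊔ mulRange N x)) : LReg T ys U₂ := by
  induction ys generalizing U₁ U₂ with
  | nil => trivial
  | cons y ys ih =>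
    obtain ⟨h₃, h₃'⟩ := h₃
    obtain ⟨h₄, h₄'⟩ := h₄
    refine ⟨fun z hz ↦ ?_, ih (U₁ ⊔ mulRange N y) (U₂ ⊔ mulRange N y) ?_ ?_ h₃' ?_⟩
    · obtain ⟨s, hs, hsz⟩ := h₄ z (Submodule.mem_sup_left hz)
      obtain ⟨u, hu, w, hw⟩ := mem_sup_mulRange.mp hsz
      have h5 : x • y • w ∈ U₂ := by
        have : x • y • w = s • y • z - y • u := by
          rw [smul_comm s y, hw, smul_add, smul_comm y x]; abel
        rw [this]
        exact U₂.sub_mem (U₂.smul_mem s hz) (U₂.smul_mem y hu)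
      obtain ⟨s', hs', h6⟩ := h₁ _ h5
      rw [smul_comm] at h6
      obtain ⟨s'', hs'', h7⟩ := h₃ _ h6
      refine ⟨s'' * s' * s, T.mul_mem (T.mul_mem hs'' hs') hs, ?_⟩
      rw [mul_smul, hw, smul_add]
      refine U₂.add_mem (U₂.smul_mem _ hu) ?_
      rw [smul_comm, mul_smul]
      exact h₂ _ h7
    · intro z hz
      obtain ⟨u, hu, w, hw⟩ := mem_sup_mulRange.mp hz
      have h5 : y • w ∈ U₂ ⊔ mulRange N x := by
        have : y • w = -u + x • z := by rw [hw]; abel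
        exact mem_sup_mulRange.mpr ⟨-u, U₂.neg_mem hu, z, this⟩
      obtain ⟨s, hs, h6⟩ := h₄ _ h5
      obtain ⟨u', hu', v, hv⟩ := mem_sup_mulRange.mp h6
      have h7 : x • (s • z - y • v) ∈ U₂ := by
        have : x • (s • z - y • v) = s • u + y • u' := by
          rw [smul_sub, smul_comm x s, hw, smul_add, smul_comm s y, hv, smul_add, smul_comm y x]
          abel
        rw [this]
        exact U₂.add_mem (U₂.smul_mem _ hu) (U₂.smul_mem _ hu')
      obtain ⟨s', hs', h8⟩ := h₁ _ h7
      refine ⟨s' * s, T.mul_mem hs' hs, mem_sup_mulRange.mpr ⟨_, h8, s' • v, ?_⟩⟩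
      rw [smul_sub, smul_smul, smul_comm y s']; abel
    · intro z hz
      obtain ⟨u, hu, w, rfl⟩ := mem_sup_mulRange.mp hz
      exact mem_sup_mulRange.mpr ⟨_, h₂ u hu, x • w, by rw [smul_add, smul_comm x y]⟩
    · rwa [sup_right_comm]

theorem LReg.top (xs : List R) : LReg T xs (⊤ : Submodule R N) := by
  induction xs with
  | nil => trivial
  | cons x xs ih => exact ⟨fun y _ ↦ ⟨1, T.one_mem, trivial⟩, by rwa [top_sup_eq]⟩

theorem LReg.head_pow {x : R} {xs : List R} {U : Submodule R N} (h : LReg T (x :: xs) U) (k : ℕ) :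
    LReg T (x ^ k :: xs) U := by
  obtain ⟨h₁, h₂⟩ := h
  induction k with
  | zero =>
    refine ⟨fun y hy ↦ ⟨1, T.one_mem, by simpa using hy⟩, ?_⟩
    have : U ⊔ mulRange N (x ^ 0) = ⊤ :=
      eq_top_iff.mpr fun z _ ↦ Submodule.mem_sup_right ⟨z, by simp⟩
    rw [this]
    exact LReg.top xs
  | succ k ih =>
    obtain ⟨ih₁, ih₂⟩ := ih
    refine ⟨fun y hy ↦ ?_, LReg.of_three_term xs x _ _ ?_ ?_ ih₂ ?_⟩
    · rw [pow_succ', mul_smul] at hy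
      obtain ⟨s, hs, hy'⟩ := h₁ _ hy
      rw [smul_comm] at hy'
      obtain ⟨t, ht, hy''⟩ := ih₁ _ hy'
      exact ⟨t * s, T.mul_mem ht hs, by rwa [mul_smul]⟩
    · intro z hz
      obtain ⟨u, hu, w, hw⟩ := mem_sup_mulRange.mp hz
      have h5 : x • (z - x ^ k • w) ∈ U := by
        have : x • (z - x ^ k • w) = u := by
          rw [smul_sub, hw, pow_succ', mul_smul]; abel
        rwa [this]
      obtain ⟨s, hs, h6⟩ := h₁ _ h5
      refine ⟨s, hs, mem_sup_mulRange.mpr ⟨_, h6, s • w, ?_⟩⟩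
      rw [smul_sub, smul_comm (x ^ k) s]; abel
    · intro z hz
      obtain ⟨u, hu, w, rfl⟩ := mem_sup_mulRange.mp hz
      exact mem_sup_mulRange.mpr ⟨x • u, U.smul_mem _ hu, w, by
        rw [smul_add, pow_succ', mul_smul]⟩
    · have : mulRange N (x ^ (k + 1)) ≤ mulRange N x := by
        rintro _ ⟨y, rfl⟩
        exact ⟨x ^ k • y, by simp only [LinearMap.lsmul_apply, smul_smul, ← pow_succ']⟩
      rwa [sup_assoc, sup_eq_right.mpr this]

theorem LReg.map_pow {xs : List R} {U : Submodule R N} (h : LReg T xs U) (k : ℕ) :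
    LReg T (xs.map (· ^ k)) U := by
  induction xs generalizing U with
  | nil => trivial
  | cons x xs ih => exact LReg.head_pow ⟨h.1, ih h.2⟩ k

end LocallyRegular

section LocallyRegularRes

variable {R : Type u} [CommRing R] {T : Submonoid R} {N : Type u} [AddCommGroup N] [Module R N]

theorem LReg.res {q : ℕ} (hq : q ≠ 0) (F : R →+* R) (hF : ∀ r, F r = r ^ q) {xs : List R}
    {U : Submodule R N} (h : LReg T (xs.map (· ^ q)) U) {V : Submodule R (Res F N)}
    (hV : ∀ y, Res.of F y ∈ V ↔ y ∈ U) : LReg T xs V := by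
  induction xs generalizing U V with
  | nil => trivial
  | cons x xs ih =>
    refine ⟨fun y hy ↦ ?_, ih h.2 fun y ↦ ?_⟩
    · obtain ⟨y, rfl⟩ := (Res.of F).surjective y
      rw [Res.smul_of, hV, hF] at hy
      obtain ⟨s, hs, hy'⟩ := h.1 y hy
      refine ⟨s, hs, ?_⟩
      rw [Res.smul_of, hV, hF, ← Nat.succ_pred_eq_of_ne_zero hq, pow_succ, mul_smul]
      exact U.smul_mem _ hy'
    · rw [mem_sup_mulRange, mem_sup_mulRange]
      constructor
      · rintro ⟨u, hu, w, hw⟩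
        obtain ⟨u, rfl⟩ := (Res.of F).surjective u
        obtain ⟨w, rfl⟩ := (Res.of F).surjective w
        refine ⟨u, (hV u).mp hu, w, ?_⟩
        rw [Res.smul_of, hF, ← map_add] at hw
        exact (Res.of F).injective hw
      · rintro ⟨u, hu, w, rfl⟩
        exact ⟨Res.of F u, (hV u).mpr hu, Res.of F w, by rw [Res.smul_of, hF, map_add]⟩

theorem LReg.frobenius_res {q : ℕ} (hq : q ≠ 0) (F : R →+* R) (hF : ∀ r, F r = r ^ q)
    {xs : List R} (h : LReg T xs (⊥ : Submodule R N)) :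
    LReg T xs (⊥ : Submodule R (Res F N)) :=
  (h.map_pow q).res hq F hF fun y ↦ by simp

end LocallyRegularRes

/-! ### Long exact sequences up to torsion -/

section TorsionSequences

variable {R : Type u} [CommRing R] {T : Submonoid R}
variable {X X' N : Type u} [AddCommGroup X] [Module R X] [AddCommGroup X'] [Module R X']
  [AddCommGroup N] [Module R N] {f : X →ₗ[R] X} {g : X →ₗ[R] X'}

theorem ext_smul_eq_zero_right {s : R} (h : ∀ x : X, s • x = 0) (i : ℕ) (z : ExtMod R i N X) :
    s • z = 0 := by
  have h' : s • (LinearMap.id : X →ₗ[R] X) = 0 := by ext x; exact h x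
  rw [← extPush_id i (s • z), map_smul, ← LinearMap.smul_apply, ← extPush_smul, h', extPush_zero,
    LinearMap.zero_apply]

theorem ext_smul_eq_zero_left {s : R} (h : ∀ x : N, s • x = 0) (i : ℕ) (z : ExtMod R i N X) :
    s • z = 0 := by
  have h' : s • (LinearMap.id : N →ₗ[R] N) = 0 := by ext x; exact h x
  rw [← extPull_id i (s • z), map_smul, ← LinearMap.smul_apply, ← extPull_smul, h', extPull_zero,
    LinearMap.zero_apply]

theorem TTorsion.ext_right [Module.Finite R X] (h : TTorsion T X) (i : ℕ) :
    TTorsion T (ExtMod R i N X) := by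
  obtain ⟨s, hs, h⟩ := h.exists_smul_eq_zero
  exact .of_smul_eq_zero hs (ext_smul_eq_zero_right h i)

theorem TTorsion.ext_left [Module.Finite R N] (h : TTorsion T N) (i : ℕ) :
    TTorsion T (ExtMod R i N X) := by
  obtain ⟨s, hs, h⟩ := h.exists_smul_eq_zero
  exact .of_smul_eq_zero hs (ext_smul_eq_zero_left h i)

theorem exact_ker_subtype_rangeRestrict (f : X →ₗ[R] X') :
    Function.Exact (LinearMap.ker f).subtype f.rangeRestrict := by
  intro y
  rw [← LinearMap.mem_ker, LinearMap.ker_rangeRestrict]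
  simp

theorem exact_range_subtype (h : Function.Exact f g) :
    Function.Exact (LinearMap.range f).subtype g := by
  intro y
  rw [h y]
  simp

theorem ttorsion_ext_right_of_exact [Module.Finite R (LinearMap.ker f)]
    (hfg : Function.Exact f g)
    (hg : Function.Surjective g) (hf : TTorsion T (LinearMap.ker f)) (i : ℕ)
    (h₁ : TTorsion T (ExtMod R i N X)) (h₂ : TTorsion T (ExtMod R (i + 1) N X)) :
    TTorsion T (ExtMod R i N X') := by
  obtain ⟨δ, h, -⟩ := exists_extPush_connecting i N (LinearMap.range f).injective_subtype
    (exact_range_subtype hfg) hg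
  obtain ⟨δ', h', -⟩ := exists_extPush_connecting (i + 1) N (LinearMap.ker f).injective_subtype
    (exact_ker_subtype_rangeRestrict f) f.surjective_rangeRestrict
  exact .of_exact h h₁ (.of_exact h' h₂ (hf.ext_right (i + 2)))

theorem exists_lift_smul [Module.Finite R (LinearMap.ker f)] (hfg : Function.Exact f g)
    (hg : Function.Surjective g) (hf : TTorsion T (LinearMap.ker f))
    (h₂ : TTorsion T (ExtMod R 1 N X)) (φ : N →ₗ[R] X') :
    ∃ s ∈ T, ∃ φ' : N →ₗ[R] X, g ∘ₗ φ' = s • φ := by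
  obtain ⟨δ, h, -⟩ := exists_extPush_connecting 0 N (LinearMap.range f).injective_subtype
    (exact_range_subtype hfg) hg
  obtain ⟨δ', h', -⟩ := exists_extPush_connecting 1 N (LinearMap.ker f).injective_subtype
    (exact_ker_subtype_rangeRestrict f) f.surjective_rangeRestrict
  obtain ⟨s, hs, hs'⟩ := TTorsion.of_exact h' h₂ (hf.ext_right 2) (δ ((extZeroEquiv N X').symm φ))
  rw [← map_smul] at hs'
  obtain ⟨y, hy⟩ := (h _).mp hs'
  refine ⟨s, hs, extZeroEquiv N X y, ?_⟩
  rw [← extZeroEquiv_push, hy, map_smul, LinearEquiv.apply_symm_apply]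

theorem exists_factor_smul [Module.Finite R (LinearMap.ker f)] (hfg : Function.Exact f g)
    (hf : TTorsion T (LinearMap.ker f)) (φ : N →ₗ[R] X) (hφ : g ∘ₗ φ = 0) :
    ∃ s ∈ T, ∃ φ' : N →ₗ[R] X, f ∘ₗ φ' = s • φ := by
  obtain ⟨δ', h', -⟩ := exists_extPush_connecting 0 N (LinearMap.ker f).injective_subtype
    (exact_ker_subtype_rangeRestrict f) f.surjective_rangeRestrict
  let φ₁ : N →ₗ[R] LinearMap.range f :=
    φ.codRestrict _ fun c ↦ (hfg _).mp (LinearMap.congr_fun hφ c)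
  obtain ⟨s, hs, hs'⟩ := hf.ext_right (N := N) 1 (δ' ((extZeroEquiv N _).symm φ₁))
  rw [← map_smul] at hs'
  obtain ⟨y, hy⟩ := (h' _).mp hs'
  refine ⟨s, hs, extZeroEquiv N X y, ?_⟩
  have := congrArg (extZeroEquiv N _) hy
  rw [extZeroEquiv_push, map_smul, LinearEquiv.apply_symm_apply] at this
  ext c
  exact congrArg Subtype.val (LinearMap.congr_fun this c)

variable {D : Type u} [AddCommGroup D] [Module R D]

theorem exists_smul_eq_extPull [Module.Finite R (LinearMap.ker f)] (hfg : Function.Exact f g)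
    (hg : Function.Surjective g) (hf : TTorsion T (LinearMap.ker f)) (i : ℕ)
    (h : TTorsion T (ExtMod R (i + 1) X' D)) (z : ExtMod R i X D) :
    ∃ s ∈ T, ∃ y : ExtMod R i X D, s • z = extPull i D f y := by
  have h₁ := extPull_exact i D (LinearMap.ker f).injective_subtype
    (exact_ker_subtype_rangeRestrict f) f.surjective_rangeRestrict
  obtain ⟨δ, h₂, -⟩ := exists_extPull_connecting i D (LinearMap.range f).injective_subtype
    (exact_range_subtype hfg) hg
  obtain ⟨s, hs, hsz⟩ := hf.ext_left i (extPull i D (LinearMap.ker f).subtype z)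
  rw [← map_smul] at hsz
  obtain ⟨a, ha⟩ := (h₁ _).mp hsz
  obtain ⟨t, ht, hta⟩ := h (δ a)
  rw [← map_smul] at hta
  obtain ⟨y, hy⟩ := (h₂ _).mp hta
  refine ⟨t * s, T.mul_mem ht hs, y, ?_⟩
  rw [mul_smul, ← ha, ← map_smul, ← hy, ← extPull_comp]
  rfl

theorem ttorsion_ext_left_of_exact [Module.Finite R (LinearMap.ker f)]
    (hfg : Function.Exact f g)
    (hg : Function.Surjective g) (hf : TTorsion T (LinearMap.ker f)) (i : ℕ)
    (h₁ : TTorsion T (ExtMod R (i + 1) X D)) (h₂ : TTorsion T (ExtMod R (i + 2) X D)) :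
    TTorsion T (ExtMod R (i + 2) X' D) := by
  obtain ⟨δ, -, h⟩ := exists_extPull_connecting (i + 1) D (LinearMap.range f).injective_subtype
    (exact_range_subtype hfg) hg
  obtain ⟨δ', -, h'⟩ := exists_extPull_connecting i D (LinearMap.ker f).injective_subtype
    (exact_ker_subtype_rangeRestrict f) f.surjective_rangeRestrict
  exact .of_exact h (.of_exact h' (hf.ext_left i) h₁) h₂

end TorsionSequences

section QuotientSequence

variable {R : Type u} [CommRing R] {T : Submonoid R} {N : Type u} [AddCommGroup N] [Module R N]

/-- The projection `N / U → N / (U + x N)`. -/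
def quotMulFactor (U : Submodule R N) (x : R) : (N ⧸ U) →ₗ[R] (N ⧸ (U ⊔ mulRange N x)) :=
  Submodule.factor le_sup_left

theorem quotMulFactor_surjective (U : Submodule R N) (x : R) :
    Function.Surjective (quotMulFactor U x) := Submodule.factor_surjective le_sup_left

theorem exact_lsmul_quotMulFactor (U : Submodule R N) (x : R) :
    Function.Exact (LinearMap.lsmul R (N ⧸ U) x) (quotMulFactor U x) := by
  intro y
  obtain ⟨y, rfl⟩ := U.mkQ_surjective y
  have : quotMulFactor U x (U.mkQ y) = (U ⊔ mulRange N x).mkQ y := rfl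
  rw [this, Submodule.mkQ_apply, Submodule.Quotient.mk_eq_zero, mem_sup_mulRange]
  constructor
  · rintro ⟨u, hu, w, rfl⟩
    refine ⟨U.mkQ w, ?_⟩
    rw [map_add, Submodule.mkQ_apply U u, (Submodule.Quotient.mk_eq_zero U).mpr hu, zero_add]
    rfl
  · rintro ⟨w, hw⟩
    obtain ⟨w, rfl⟩ := U.mkQ_surjective w
    refine ⟨y - x • w, ?_, w, by abel⟩
    rw [← Submodule.Quotient.mk_eq_zero, Submodule.Quotient.mk_sub, sub_eq_zero]
    exact hw.symm

theorem ttorsion_ker_lsmul (U : Submodule R N) (x : R)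
    (h : ∀ y : N, x • y ∈ U → ∃ s ∈ T, s • y ∈ U) :
    TTorsion T (LinearMap.ker (LinearMap.lsmul R (N ⧸ U) x)) := by
  rintro ⟨y, hy⟩
  obtain ⟨y, rfl⟩ := U.mkQ_surjective y
  obtain ⟨s, hs, h'⟩ := h y ((Submodule.Quotient.mk_eq_zero U).mp hy)
  exact ⟨s, hs, Subtype.ext ((Submodule.Quotient.mk_eq_zero U).mpr h')⟩

theorem extPull_lsmul {D : Type u} [AddCommGroup D] [Module R D] (x : R) (i : ℕ)
    (z : ExtMod R i N D) : extPull i D (LinearMap.lsmul R N x) z = x • z := by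
  have : LinearMap.lsmul R N x = x • LinearMap.id := rfl
  rw [this, extPull_smul, LinearMap.smul_apply, extPull_id]

end QuotientSequence

/-! ### Regular sequences on semidualizing modules -/

section Semidualizing

variable {R : Type u} [CommRing R] {T : Submonoid R} {C : Type u} [AddCommGroup C] [Module R C]

theorem ttorsion_of_ttorsion_linearMap [IsNoetherianRing R] [Module.Finite R C]
    (hC : Function.Injective (algebraMap R (Module.End R C))) {K : Type u} [AddCommGroup K]
    [Module R K] [Module.Finite R K] (h : TTorsion T (C →ₗ[R] K)) : TTorsion T K := by
  let K₀ : Submodule R K :=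
    { carrier := {k | ∃ s ∈ T, s • k = 0}
      zero_mem' := ⟨1, T.one_mem, smul_zero _⟩
      add_mem' := by
        rintro a b ⟨s, hs, ha⟩ ⟨t, ht, hb⟩
        refine ⟨s * t, T.mul_mem hs ht, ?_⟩
        rw [smul_add, mul_smul s t b, hb, mul_comm, mul_smul, ha, smul_zero, smul_zero, zero_add]
      smul_mem' := by
        rintro r a ⟨s, hs, ha⟩
        exact ⟨s, hs, by rw [smul_comm, ha, smul_zero]⟩ }
  obtain ⟨e, he, heK⟩ := exists_smul_mem_of_fg (T := T) ⊥ K₀ (IsNoetherian.noetherian K₀)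
    fun x ⟨s, hs, hx⟩ ↦ ⟨s, hs, by simpa using hx⟩
  have hsub : Subsingleton (C →ₗ[R] mulRange K e) := by
    refine subsingleton_of_forall_eq 0 fun φ ↦ ?_
    obtain ⟨s, hs, hφ⟩ := h ((mulRange K e).subtype ∘ₗ φ)
    ext c
    obtain ⟨k, hk⟩ := (φ c).2
    have h1 : (s * e) • k = 0 := by
      rw [mul_smul]
      have := LinearMap.congr_fun hφ c
      simpa [← hk] using this
    have h2 : e • k = 0 := by simpa using heK k ⟨s * e, T.mul_mem hs he, h1⟩
    rw [← hk]
    exact h2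
  obtain ⟨r, hr, hreg⟩ := IsSMulRegular.subsingleton_linearMap_iff.mp hsub
  have hr0 : r = 0 := by
    apply hC
    ext c
    simpa using Module.mem_annihilator.mp hr c
  subst hr0
  refine .of_smul_eq_zero he fun k ↦ ?_
  have : (⟨e • k, smul_mem_mulRange e k⟩ : mulRange K e) = 0 := hreg (by simp)
  exact congrArg Subtype.val this

/-- `C / V` is a semidualizing module over `R / U` up to `T`-torsion. -/
structure LSemidual (T : Submonoid R) (U : Ideal R) (V : Submodule R C) : Prop where
  smul_mem : ∀ r ∈ U, ∀ c, r • c ∈ V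
  faithful : ∀ r, (∀ c, r • c ∈ V) → ∃ s ∈ T, s * r ∈ U
  homothety : ∀ φ : C →ₗ[R] C ⧸ V, ∃ s ∈ T, ∃ r : R, s • φ = r • V.mkQ
  acyclic : ∀ i, TTorsion T (ExtMod R (i + 1) C (C ⧸ V))

theorem smul_mkQ_eq_zero {V : Submodule R C} {r : R} : r • V.mkQ = 0 ↔ ∀ c, r • c ∈ V := by
  rw [LinearMap.ext_iff]
  exact forall_congr' fun c ↦ Submodule.Quotient.mk_eq_zero V (x := r • c)

theorem LSemidual.regular [IsNoetherianRing R] [Module.Finite R C]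
    (hC : Function.Injective (algebraMap R (Module.End R C))) {U : Ideal R} {V : Submodule R C}
    (h : LSemidual T U V) {x : R} (hx : ∀ y : R, x • y ∈ U → ∃ s ∈ T, s • y ∈ U) (c : C)
    (hc : x • c ∈ V) : ∃ s ∈ T, s • c ∈ V := by
  have key : TTorsion T (LinearMap.ker (LinearMap.lsmul R (C ⧸ V) x)) := by
    refine ttorsion_of_ttorsion_linearMap hC fun φ ↦ ?_
    obtain ⟨s, hs, r, hr⟩ := h.homothety (Submodule.subtype _ ∘ₗ φ)
    have h1 : (x * r) • V.mkQ = 0 := by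
      rw [mul_smul, ← hr]
      ext c
      rw [LinearMap.smul_apply, LinearMap.smul_apply, smul_comm]
      have : x • (φ c : C ⧸ V) = 0 := (φ c).2
      simp [this]
    obtain ⟨s', hs', h2⟩ := h.faithful _ (smul_mkQ_eq_zero.mp h1)
    obtain ⟨t, ht, h3⟩ := hx (s' * r) (by rwa [smul_eq_mul, mul_left_comm])
    have h4 := smul_mkQ_eq_zero.mpr (h.smul_mem _ h3)
    refine ⟨t * s' * s, T.mul_mem (T.mul_mem ht hs') hs, ?_⟩
    ext c
    have h5 : ((t * s' * s) • (Submodule.subtype _ ∘ₗ φ)) = 0 := by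
      rw [mul_smul, hr, smul_smul, mul_assoc, ← smul_eq_mul t, h4]
    exact LinearMap.congr_fun h5 c
  obtain ⟨s, hs, h'⟩ := key ⟨V.mkQ c, (Submodule.Quotient.mk_eq_zero V).mpr hc⟩
  exact ⟨s, hs, (Submodule.Quotient.mk_eq_zero V).mp (congrArg Subtype.val h')⟩

theorem LSemidual.quotient [IsNoetherianRing R] [Module.Finite R C] {U : Ideal R}
    {V : Submodule R C} (h : LSemidual T U V) {x : R}
    (hx : ∀ c : C, x • c ∈ V → ∃ s ∈ T, s • c ∈ V) :
    LSemidual T (U ⊔ mulRange R x) (V ⊔ mulRange C x) := by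
  have hK := ttorsion_ker_lsmul V x hx
  have hex := exact_lsmul_quotMulFactor V x
  have hsurj := quotMulFactor_surjective V x
  have hcomp : quotMulFactor V x ∘ₗ V.mkQ = (V ⊔ mulRange C x).mkQ := rfl
  refine ⟨fun r hr c ↦ ?_, fun r hr ↦ ?_, fun φ ↦ ?_, fun i ↦ ?_⟩
  · obtain ⟨u, hu, w, rfl⟩ := mem_sup_mulRange.mp hr
    refine mem_sup_mulRange.mpr ⟨u • c, h.smul_mem u hu c, w • c, ?_⟩
    rw [add_smul, smul_assoc]
  · have h0 : quotMulFactor V x ∘ₗ (r • V.mkQ) = 0 := by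
      rw [LinearMap.comp_smul, hcomp, smul_mkQ_eq_zero.mpr hr]
    obtain ⟨s, hs, φ', hφ'⟩ := exists_factor_smul hex hK _ h0
    obtain ⟨s', hs', r', hr'⟩ := h.homothety φ'
    have h1 : (s' * s * r - x * r') • V.mkQ = 0 := by
      ext c
      have e₁ : s' • φ' c = r' • V.mkQ c := LinearMap.congr_fun hr' c
      have e₂ : x • φ' c = s • r • V.mkQ c := LinearMap.congr_fun hφ' c
      rw [LinearMap.smul_apply, sub_smul, mul_smul x, ← e₁, mul_smul, mul_smul, ← e₂,
        smul_comm s' x, sub_self, LinearMap.zero_apply]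
    obtain ⟨t, ht, h2⟩ := h.faithful _ (smul_mkQ_eq_zero.mp h1)
    refine ⟨t * s' * s, T.mul_mem (T.mul_mem ht hs') hs, mem_sup_mulRange.mpr ⟨_, h2, t * r', ?_⟩⟩
    simp only [smul_eq_mul]
    ring
  · obtain ⟨s, hs, φ', hφ'⟩ := exists_lift_smul hex hsurj hK (h.acyclic 0) φ
    obtain ⟨s', hs', r, hr⟩ := h.homothety φ'
    refine ⟨s' * s, T.mul_mem hs' hs, r, ?_⟩
    rw [mul_smul, ← hφ', ← LinearMap.comp_smul, hr, LinearMap.comp_smul, hcomp]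
  · exact ttorsion_ext_right_of_exact hex hsurj hK (i + 1) (h.acyclic i) (h.acyclic (i + 1))

theorem LSemidual.lreg [IsNoetherianRing R] [Module.Finite R C]
    (hC : Function.Injective (algebraMap R (Module.End R C))) {xs : List R} {U : Ideal R}
    {V : Submodule R C} (h : LSemidual T U V) (hxs : LReg T xs U) : LReg T xs V := by
  induction xs generalizing U V with
  | nil => trivial
  | cons x xs ih =>
    have hx := h.regular hC hxs.1
    exact ⟨hx, ih (h.quotient hx) hxs.2⟩

theorem IsDual.lreg [IsNoetherianRing R] (hC : IsDual R C) {xs : List R}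
    (hxs : LReg T xs (⊥ : Ideal R)) : LReg T xs (⊥ : Submodule R C) := by
  have := hC.finite
  refine LSemidual.lreg hC.bijective.1 ⟨?_, ?_, ?_, ?_⟩ hxs
  · rintro r hr c
    rw [Ideal.mem_bot.mp hr, zero_smul]
    exact zero_mem _
  · intro r hr
    refine ⟨1, T.one_mem, ?_⟩
    rw [one_mul, Ideal.mem_bot]
    apply hC.bijective.1
    ext c
    simpa using hr c
  · intro φ
    let e := Submodule.quotEquivOfEqBot (⊥ : Submodule R C) rfl
    obtain ⟨r, hr⟩ := hC.bijective.2 (e.toLinearMap ∘ₗ φ)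
    refine ⟨1, T.one_mem, r, ?_⟩
    ext c
    apply e.injective
    have := LinearMap.congr_fun hr c
    simpa [e] using this.symm
  · intro i
    have := hC.acyclic i
    have : Subsingleton (ExtMod R (i + 1) C (C ⧸ (⊥ : Submodule R C))) :=
      (extPushEquiv (i + 1) C
        (Submodule.quotEquivOfEqBot (⊥ : Submodule R C) rfl)).injective.subsingleton
    exact .of_subsingleton

end Semidualizing

/-! ### Vanishing of `Ext` on maximal Cohen-Macaulay modules -/

section Vanishing

variable {R : Type u} [CommRing R] {T : Submonoid R}
variable {N : Type u} [AddCommGroup N] [Module R N] {D : Type u} [AddCommGroup D] [Module R D]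

theorem supRange_smul_mem (xs : List R) {U : Ideal R} {V : Submodule R N}
    (h : ∀ r ∈ U, ∀ y, r • y ∈ V) : ∀ r ∈ supRange xs U, ∀ y, r • y ∈ supRange xs V := by
  induction xs generalizing U V with
  | nil => exact h
  | cons x xs ih =>
    refine ih fun r hr y ↦ ?_
    obtain ⟨u, hu, w, rfl⟩ := mem_sup_mulRange.mp hr
    exact mem_sup_mulRange.mpr ⟨u • y, h u hu y, w • y, by rw [add_smul, smul_assoc]⟩

theorem supRange_le {m U : Ideal R} {xs : List R} (hxs : ∀ x ∈ xs, x ∈ m) (hU : U ≤ m) :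
    supRange xs U ≤ m := by
  induction xs generalizing U with
  | nil => exact hU
  | cons x xs ih =>
    refine ih (fun y hy ↦ hxs y (List.mem_cons_of_mem _ hy)) (sup_le hU ?_)
    rintro _ ⟨y, rfl⟩
    exact m.mul_mem_right y (hxs x List.mem_cons_self)

theorem LReg.ttorsion_ext_supRange [IsNoetherianRing R] [Module.Finite R N] {xs : List R}
    {U : Submodule R N} (hxs : LReg T xs U) (c : ℕ)
    (h : ∀ i, c ≤ i → TTorsion T (ExtMod R (i + 1) (N ⧸ U) D)) :
    ∀ i, c + xs.length ≤ i → TTorsion T (ExtMod R (i + 1) (N ⧸ supRange xs U) D) := by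
  induction xs generalizing U c with
  | nil => exact h
  | cons x xs ih =>
    intro i hi
    refine ih hxs.2 (c + 1) (fun i hi ↦ ?_) i (by simp at hi; omega)
    obtain ⟨i, rfl⟩ : ∃ j, i = j + 1 := ⟨i - 1, by omega⟩
    exact ttorsion_ext_left_of_exact (exact_lsmul_quotMulFactor U x) (quotMulFactor_surjective U x)
      (ttorsion_ker_lsmul U x hxs.1) i (h i (by omega)) (h (i + 1) (by omega))

theorem LReg.ttorsion_ext_of_supRange [IsNoetherianRing R] [Module.Finite R N]
    [Module.Finite R D] {m : Ideal R} [m.IsMaximal] {xs : List R} (hm : ∀ x ∈ xs, x ∈ m)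
    {U : Submodule R N} (hxs : LReg m.primeCompl xs U) (c : ℕ)
    (h : ∀ i, c + xs.length ≤ i →
      TTorsion m.primeCompl (ExtMod R (i + 1) (N ⧸ supRange xs U) D)) :
    ∀ i, c ≤ i → TTorsion m.primeCompl (ExtMod R (i + 1) (N ⧸ U) D) := by
  induction xs generalizing U c with
  | nil => exact h
  | cons x xs ih =>
    intro i hi
    have hm' : ∀ x ∈ xs, x ∈ m := fun y hy ↦ hm y (List.mem_cons_of_mem _ hy)
    have ih' := ih hm' hxs.2 (c + 1) (fun i hi ↦ h i (by simp; omega)) (i + 1) (by omega)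
    refine .of_smul_mem_range (hm x List.mem_cons_self) fun z ↦ ?_
    obtain ⟨s, hs, y, hy⟩ := exists_smul_eq_extPull (exact_lsmul_quotMulFactor U x)
      (quotMulFactor_surjective U x) (ttorsion_ker_lsmul U x hxs.1) (i + 1) ih' z
    exact ⟨s, hs, y, by rw [hy, extPull_lsmul]⟩

/-- The module `N` is killed by `s m ^ k` for some `s ∉ m`. -/
def LFiniteLength (m : Ideal R) [m.IsPrime] (N : Type u) [AddCommGroup N] [Module R N] : Prop :=
  ∃ s ∈ m.primeCompl, ∃ k : ℕ, ∀ r ∈ m ^ k, ∀ y : N, s • r • y = 0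

theorem exists_socle {m a : Ideal R} [IsNoetherianRing R] [m.IsPrime] (ha : a ≤ m)
    (h : LFiniteLength m (R ⧸ a)) : ∃ u : R, u ∉ a ∧ ∀ r ∈ m, r * u ∈ a := by
  have hex : ∃ k : ℕ, ∃ s ∈ m.primeCompl, ∀ r ∈ m ^ k, s • r ∈ a := by
    obtain ⟨s, hs, k, h⟩ := h
    refine ⟨k, s, hs, fun r hr ↦ ?_⟩
    have : s • r • (1 : R) ∈ a :=
      (Submodule.Quotient.mk_eq_zero a).mp (h r hr (Submodule.Quotient.mk 1))
    simpa using this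
  classical
  obtain ⟨s, hs, hk⟩ := Nat.find_spec hex
  have hmin := fun {j} ↦ Nat.find_min hex (m := j)
  generalize Nat.find hex = k at hk hmin
  cases k with
  | zero =>
    have := ha (hk 1 (by simp))
    exact absurd (by simpa using this) hs
  | succ k =>
    have : ∃ v ∈ m ^ k, ∀ t ∈ m.primeCompl, t • v ∉ a := by
      by_contra! hcon
      obtain ⟨t, ht, h'⟩ := exists_smul_mem_of_fg (T := m.primeCompl) a (m ^ k)
        (IsNoetherian.noetherian _) hcon
      exact hmin k.lt_succ_self ⟨t, ht, h'⟩
    obtain ⟨v, hv, hva⟩ := this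
    refine ⟨s • v, hva s hs, fun r hr ↦ ?_⟩
    have := hk (r * v) (by rw [pow_succ']; exact Ideal.mul_mem_mul hr hv)
    simpa [mul_left_comm] using this

theorem ttorsion_ext_of_lFiniteLength [IsNoetherianRing R] {m : Ideal R} [m.IsMaximal] (i : ℕ)
    (hm : TTorsion m.primeCompl (ExtMod R i (R ⧸ m) D)) [Module.Finite R N]
    (hN : LFiniteLength m N) : TTorsion m.primeCompl (ExtMod R i N D) := by
  revert hN
  refine IsNoetherianRing.induction_on_isQuotientEquivQuotientPrime R (M := N) ‹_›
    (motive := fun N _ _ _ ↦ LFiniteLength m N → TTorsion m.primeCompl (ExtMod R i N D))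
    ?_ ?_ ?_
  · intro N _ _ _ _ _
    exact .ext_left .of_subsingleton i
  · rintro N _ _ _ p e ⟨s, hs, k, h⟩
    refine .of_injective (Y := ExtMod R i (R ⧸ p.1) D) ?_ (extPullEquiv i D e.symm).toLinearMap
      (extPullEquiv i D e.symm).injective
    have hsp : ∀ r ∈ m ^ k, s * r ∈ p.1 := fun r hr ↦ by
      have := congrArg e (h r hr (e.symm (Submodule.Quotient.mk 1)))
      rw [map_smul, map_smul, e.apply_symm_apply, map_zero] at this
      refine (Submodule.Quotient.mk_eq_zero p.1).mp ?_
      rw [← this, ← Submodule.Quotient.mk_smul, ← Submodule.Quotient.mk_smul]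
      simp
    by_cases hs' : s ∈ p.1
    · refine .of_smul_eq_zero hs (ext_smul_eq_zero_left (fun y ↦ ?_) i)
      obtain ⟨y, rfl⟩ := Submodule.mkQ_surjective _ y
      exact (Submodule.Quotient.mk_eq_zero p.1).mpr (p.1.mul_mem_right y hs')
    · have hle : m ≤ p.1 := p.2.le_of_pow_le (n := k) fun r hr ↦
        (p.2.mem_or_mem (hsp r hr)).resolve_left hs'
      have := Ideal.IsMaximal.eq_of_le ‹m.IsMaximal› p.2.ne_top hle
      rwa [← this]
  · rintro N₁ _ _ _ N₂ _ _ _ N₃ _ _ _ f g hf hg hfg h₁ h₃ ⟨s, hs, k, h⟩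
    refine .of_exact (extPull_exact i D hf hfg hg) (h₃ ⟨s, hs, k, fun r hr y ↦ ?_⟩)
      (h₁ ⟨s, hs, k, fun r hr y ↦ hf ?_⟩)
    · obtain ⟨y, rfl⟩ := hg y
      rw [← map_smul, ← map_smul, h r hr, map_zero]
    · rw [map_smul, map_smul, h r hr, map_zero]

theorem ExtBounded.ttorsion_ext_of_lFiniteLength [IsNoetherianRing R] {m : Ideal R} [m.IsMaximal]
    (hD : ExtBounded R D) {a : Ideal R} (ha : a ≤ m) (hfl : LFiniteLength m (R ⧸ a)) (d : ℕ)
    (had : ∀ i, d ≤ i → TTorsion m.primeCompl (ExtMod R (i + 1) (R ⧸ a) D))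
    [Module.Finite R N] (hN : LFiniteLength m N) (i : ℕ) (hi : d ≤ i) :
    TTorsion m.primeCompl (ExtMod R (i + 1) N D) := by
  obtain ⟨b, hb⟩ := hD
  suffices H : ∀ (j : ℕ) (N : Type u) [AddCommGroup N] [Module R N] [Module.Finite R N],
      LFiniteLength m N → ∀ i, d ≤ i → b < i + 1 + j →
        TTorsion m.primeCompl (ExtMod R (i + 1) N D) from
    H b N hN i hi (by omega)
  intro j
  induction j with
  | zero =>
    intro N _ _ _ _ i _ hi
    have := hb N (i + 1) hi
    exact .of_subsingleton
  | succ j ih =>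
    intro N _ _ _ hN i hdi hi
    refine _root_.ttorsion_ext_of_lFiniteLength (i + 1) ?_ hN
    obtain ⟨u, hua, hu⟩ := exists_socle ha hfl
    let f : (R ⧸ m) →ₗ[R] (R ⧸ a) := m.liftQ (LinearMap.toSpanSingleton R (R ⧸ a)
      (Submodule.Quotient.mk u)) fun r hr ↦ (Submodule.Quotient.mk_eq_zero a).mpr (hu r hr)
    have hf : Function.Injective f := by
      rw [injective_iff_map_eq_zero]
      intro y hy
      obtain ⟨r, rfl⟩ := Submodule.mkQ_surjective _ y
      have hr : r * u ∈ a := (Submodule.Quotient.mk_eq_zero a).mp hy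
      refine (Submodule.Quotient.mk_eq_zero m).mpr ?_
      by_contra hrm
      obtain ⟨t, y, hy, hty⟩ := Ideal.IsMaximal.exists_inv ‹m.IsMaximal› hrm
      apply hua
      rw [← one_mul u, ← hty, add_mul, mul_assoc]
      exact a.add_mem (a.mul_mem_left t hr) (hu y hy)
    obtain ⟨δ, h, -⟩ := exists_extPull_connecting (i + 1) D hf
      (LinearMap.exact_map_mkQ_range f) (Submodule.mkQ_surjective _)
    refine .of_exact h (had i hdi) (ih _ ?_ (i + 1) (by omega) (by omega))
    obtain ⟨s, hs, k, h⟩ := hfl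
    refine ⟨s, hs, k, fun r hr y ↦ ?_⟩
    obtain ⟨y, rfl⟩ := Submodule.mkQ_surjective _ y
    rw [← map_smul, ← map_smul, h r hr, map_zero]

/-- The data of a system of parameters that is a regular sequence, locally at `m`. -/
def LCohenMacaulay (m : Ideal R) [m.IsPrime] : Prop :=
  ∃ xs : List R, (∀ x ∈ xs, x ∈ m) ∧ LReg m.primeCompl xs (⊥ : Ideal R) ∧
    LFiniteLength m (R ⧸ supRange xs (⊥ : Ideal R))

/-- A module is maximal Cohen-Macaulay. -/
def IsMCM (R : Type u) [CommRing R] (N : Type u) [AddCommGroup N] [Module R N] : Prop :=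
  ∀ (m : Ideal R) [m.IsMaximal], ∀ xs : List R, (∀ x ∈ xs, x ∈ m) →
    LReg m.primeCompl xs (⊥ : Ideal R) → LReg m.primeCompl xs (⊥ : Submodule R N)

theorem IsMCM.extAcyclic [IsNoetherianRing R] [Module.Finite R D] [Module.Finite R N]
    (hR : ∀ (m : Ideal R) [m.IsMaximal], LCohenMacaulay m) (hD : ExtBounded R D)
    (hN : IsMCM R N) : ExtAcyclic R N D := by
  refine fun i ↦ subsingleton_of_forall_ttorsion (R := R) fun m _ ↦ ?_
  obtain ⟨xs, hxm, hreg, hfl⟩ := hR m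
  have hbase : ∀ i, xs.length ≤ i →
      TTorsion m.primeCompl (ExtMod R (i + 1) (R ⧸ supRange xs (⊥ : Ideal R)) D) := by
    refine fun i hi ↦ hreg.ttorsion_ext_supRange 0 (fun i _ ↦ ?_) i (by omega)
    have : Subsingleton (ExtMod R (i + 1) R D) := ext_subsingleton_of_projective i
    have : Subsingleton (ExtMod R (i + 1) (R ⧸ (⊥ : Ideal R)) D) :=
      (extPullEquiv (i + 1) D
        (Submodule.quotEquivOfEqBot (⊥ : Ideal R) rfl).symm).injective.subsingleton
    exact .of_subsingleton
  have h := (hN m xs hxm hreg).ttorsion_ext_of_supRange hxm (D := D) 0 (fun i hi ↦ ?_) i (by omega)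
  · exact .of_injective h (extPullEquiv (i + 1) D
      (Submodule.quotEquivOfEqBot (⊥ : Submodule R N) rfl)).toLinearMap
      (extPullEquiv (i + 1) D _).injective
  · refine hD.ttorsion_ext_of_lFiniteLength (supRange_le hxm bot_le) hfl xs.length hbase ?_ i
      (by omega)
    obtain ⟨s, hs, k, h⟩ := hfl
    refine ⟨s, hs, k, fun r hr y ↦ ?_⟩
    obtain ⟨y, rfl⟩ := Submodule.mkQ_surjective _ y
    have h' : s • r • (1 : R) ∈ supRange xs (⊥ : Ideal R) :=
      (Submodule.Quotient.mk_eq_zero _).mp (h r hr (Submodule.Quotient.mk 1))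
    rw [← map_smul, ← map_smul, smul_smul, ← mul_one (s * r), mul_assoc]
    refine (Submodule.Quotient.mk_eq_zero _).mpr (supRange_smul_mem xs ?_ _ h' y)
    intro r hr y
    rw [Ideal.mem_bot.mp hr, zero_smul]
    exact zero_mem _

end Vanishing

/-! ### Cohen-Macaulay rings -/

section CohenMacaulay

theorem mulRange_eq_span {A : Type*} [CommRing A] (x : A) : mulRange A x = Ideal.span {x} := by
  ext y
  rw [Ideal.mem_span_singleton]
  exact ⟨fun ⟨z, hz⟩ ↦ ⟨z, hz.symm⟩, fun ⟨z, hz⟩ ↦ ⟨z, hz.symm⟩⟩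

theorem supRange_eq_sup_ofList {A : Type*} [CommRing A] (rs : List A) (U : Ideal A) :
    supRange rs U = U ⊔ Ideal.ofList rs := by
  induction rs generalizing U with
  | nil => simp [supRange]
  | cons r rs ih => rw [supRange, ih, Ideal.ofList_cons, mulRange_eq_span, sup_assoc]

theorem lreg_of_forall_take {A : Type*} [CommRing A] (rs : List A) (U : Ideal A)
    (h : ∀ (i : ℕ) (hi : i < rs.length) (a : A), rs[i] * a ∈ U ⊔ Ideal.ofList (rs.take i) →
      a ∈ U ⊔ Ideal.ofList (rs.take i)) : LReg (⊥ : Submonoid A) rs U := by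
  induction rs generalizing U with
  | nil => trivial
  | cons r rs ih =>
    refine ⟨fun y hy ↦ ⟨1, Submonoid.one_mem _, ?_⟩, ih _ fun i hi a ha ↦ ?_⟩
    · simpa using h 0 (by simp) y (by simpa using hy)
    · have := h (i + 1) (by simpa using hi) a
      simp only [List.take_succ_cons, Ideal.ofList_cons, ← sup_assoc, List.getElem_cons_succ] at this
      rw [mulRange_eq_span] at ha ⊢
      exact this ha

theorem exists_lreg_of_localization {R : Type u} [CommRing R] (m : Ideal R) [m.IsPrime]
    (rs : List (Localization.AtPrime m)) (hrs : ∀ r ∈ rs, ¬IsUnit r) (U : Ideal R)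
    (h : LReg (⊥ : Submonoid (Localization.AtPrime m)) rs
      (U.map (algebraMap R (Localization.AtPrime m)))) :
    ∃ xs : List R, (∀ x ∈ xs, x ∈ m) ∧ LReg m.primeCompl xs U ∧
      Ideal.map (algebraMap R (Localization.AtPrime m)) (supRange xs U) =
        supRange rs (U.map (algebraMap R (Localization.AtPrime m))) := by
  induction rs generalizing U with
  | nil => exact ⟨[], by simp, trivial, rfl⟩
  | cons r rs ih =>
    obtain ⟨⟨x, s⟩, hx⟩ := IsLocalization.surj m.primeCompl r
    have hs := IsLocalization.map_units (Localization.AtPrime m) s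
    have hxr : (Ideal.span {x}).map (algebraMap R (Localization.AtPrime m)) = Ideal.span {r} := by
      rw [Ideal.map_span, Set.image_singleton, ← hx]
      exact Ideal.span_singleton_mul_right_unit hs r
    have hU : (U ⊔ mulRange R x).map (algebraMap R (Localization.AtPrime m)) =
        U.map (algebraMap R (Localization.AtPrime m)) ⊔ mulRange _ r := by
      rw [Ideal.map_sup, mulRange_eq_span, mulRange_eq_span, hxr]
    obtain ⟨xs, hxs, hreg, hmap⟩ := ih (fun r hr ↦ hrs r (List.mem_cons_of_mem _ hr))
      (U ⊔ mulRange R x) (by rw [hU]; exact h.2)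
    refine ⟨x :: xs, ?_, ⟨fun y hy ↦ ?_, hreg⟩, ?_⟩
    · rintro y (_ | ⟨_, hy⟩)
      · by_contra hxm
        have hu := IsLocalization.map_units (Localization.AtPrime m) (⟨x, hxm⟩ : m.primeCompl)
        rw [← hx] at hu
        exact hrs r List.mem_cons_self (isUnit_of_mul_isUnit_left hu)
      · exact hxs y hy
    · have h1 := Ideal.mem_map_of_mem (algebraMap R (Localization.AtPrime m)) hy
      rw [smul_eq_mul, map_mul, ← hx, mul_assoc] at h1
      obtain ⟨t, ht, h2⟩ := h.1 _ h1
      rw [Submonoid.mem_bot.mp ht, one_smul, Ideal.unit_mul_mem_iff_mem _ hs,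
        IsLocalization.algebraMap_mem_map_algebraMap_iff m.primeCompl] at h2
      exact h2
    · rw [supRange, hmap, hU]
      rfl

theorem IsCMLocalRing.exists_regular_parameters {A : Type*} [CommRing A] [IsLocalRing A]
    (h : IsCMLocalRing A) : ∃ rs : List A, (∀ r ∈ rs, ¬IsUnit r) ∧
      LReg (⊥ : Submonoid A) rs (⊥ : Ideal A) ∧
      ∃ k : ℕ, IsLocalRing.maximalIdeal A ^ k ≤ supRange rs (⊥ : Ideal A) := by
  obtain ⟨-, hN, rs, ⟨hreg, hne⟩, hrs, hdim⟩ := h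
  refine ⟨rs, hrs, lreg_of_forall_take _ _ fun i hi a ha ↦ ?_, ?_⟩
  · rw [bot_sup_eq] at ha ⊢
    exact hreg i hi a ha
  have hR : RingTheory.Sequence.IsRegular A rs := by
    refine ⟨⟨fun i hi ↦ ?_⟩, ?_⟩
    · rw [isSMulRegular_iff_right_eq_zero_of_smul]
      intro y hy
      obtain ⟨y, rfl⟩ := Submodule.mkQ_surjective _ y
      have := (Submodule.Quotient.mk_eq_zero _).mp hy
      rw [smul_eq_mul, Ideal.mul_top] at this
      refine (Submodule.Quotient.mk_eq_zero _).mpr ?_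
      rw [smul_eq_mul, Ideal.mul_top]
      exact hreg i hi y this
    · rw [smul_eq_mul, Ideal.mul_top]
      exact hne.symm
  have hd := ringKrullDim_add_length_eq_ringKrullDim_of_isRegular rs hR
  rw [← hdim] at hd
  have h0 : Ring.KrullDimLE 0 (A ⧸ Ideal.ofList rs) := by
    rw [Ring.krullDimLE_iff]
    refine (ENat.WithBot.add_le_add_natCast_right_iff (c := rs.length)).mp ?_
    rw [Nat.cast_zero, zero_add]
    exact hd.le
  rw [Ring.krullDimLE_zero_iff] at h0
  rw [supRange_eq_sup_ofList, bot_sup_eq]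
  refine Ideal.exists_pow_le_of_le_radical_of_fg ?_ (IsNoetherian.noetherian _)
  rw [Ideal.radical_eq_sInf]
  refine le_sInf fun P ⟨hP, hPp⟩ ↦ ?_
  have hPm : (P.map (Ideal.Quotient.mk (Ideal.ofList rs))).IsPrime :=
    Ideal.map_isPrime_of_surjective Ideal.Quotient.mk_surjective (by rwa [Ideal.mk_ker])
  have hmax := h0 _ hPm
  have := Ideal.comap_isMaximal_of_surjective (Ideal.Quotient.mk (Ideal.ofList rs))
    Ideal.Quotient.mk_surjective (K := P.map (Ideal.Quotient.mk (Ideal.ofList rs)))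
  rw [Ideal.comap_map_of_surjective _ Ideal.Quotient.mk_surjective, ← RingHom.ker_eq_comap_bot,
    Ideal.mk_ker, sup_eq_left.mpr hP] at this
  exact (IsLocalRing.eq_maximalIdeal this).ge

theorem IsCMRing.lCohenMacaulay {R : Type u} [CommRing R] (h : IsCMRing R) (m : Ideal R)
    [m.IsMaximal] : LCohenMacaulay m := by
  have := h.1
  obtain ⟨rs, hrs, hreg, k, hk⟩ := (h.2 m inferInstance).exists_regular_parameters
  rw [← Ideal.map_bot (f := algebraMap R (Localization.AtPrime m))] at hreg hk
  obtain ⟨xs, hxs, hxreg, hmap⟩ := exists_lreg_of_localization m rs hrs ⊥ hreg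
  refine ⟨xs, hxs, hxreg, ?_⟩
  rw [← hmap, ← Localization.AtPrime.map_eq_maximalIdeal, ← Ideal.map_pow] at hk
  obtain ⟨s, hs, h'⟩ := exists_smul_mem_of_fg (T := m.primeCompl) (supRange xs (⊥ : Ideal R))
    (m ^ k) (IsNoetherian.noetherian _) fun r hr ↦
      (IsLocalization.algebraMap_mem_map_algebraMap_iff m.primeCompl
        (Localization.AtPrime m) _ r).mp (hk (Ideal.mem_map_of_mem _ hr))
  refine ⟨s, hs, k, fun r hr y ↦ ?_⟩
  obtain ⟨y, rfl⟩ := Submodule.mkQ_surjective _ y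
  refine (Submodule.Quotient.mk_eq_zero _).mpr ?_
  change s • (r * y) ∈ _
  rw [← smul_mul_assoc]
  exact Ideal.mul_mem_right y _ (h' r hr)

end CohenMacaulay

/-! ### Associated primes of local cohomology -/

section LocalCohomology

open Limits localCohomology

variable {R : Type u} [CommRing R]

/-- The annihilator of `z` is the ideal `P`. -/
def HasAnn {M : Type*} [AddCommGroup M] [Module R M] (P : Ideal R) (z : M) : Prop :=
  ∀ r : R, r • z = 0 ↔ r ∈ P

theorem mem_associatedPrimes_iff_hasAnn [IsNoetherianRing R] {M : Type*} [AddCommGroup M]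
    [Module R M] {P : Ideal R} :
    P ∈ associatedPrimes R M ↔ P.IsPrime ∧ ∃ z : M, HasAnn P z := by
  change IsAssociatedPrime P M ↔ _
  rw [isAssociatedPrime_iff]
  refine and_congr_right fun _ ↦ exists_congr fun z ↦ ?_
  rw [HasAnn, SetLike.ext_iff]
  simp [Submodule.mem_colon_singleton, iff_comm]

theorem HasAnn.of_injective {M N : Type*} [AddCommGroup M] [Module R M] [AddCommGroup N]
    [Module R N] {P : Ideal R} {z : M} (h : HasAnn P z) (f : M →ₗ[R] N)
    (hf : Function.Injective f) : HasAnn P (f z) := fun r ↦ by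
  rw [← map_smul, map_eq_zero_iff f hf, h r]

theorem HasAnn.exists_of_sum_eq {ι : Type*} (s : Finset ι) {M : Type*} [AddCommGroup M]
    [Module R M] {N : ι → Type*} [∀ i, AddCommGroup (N i)] [∀ i, Module R (N i)] {P : Ideal R}
    (hP : P.IsPrime) {z : M} (h : HasAnn P z) (f : ∀ i, M →ₗ[R] N i) (g : ∀ i, N i →ₗ[R] M)
    (hz : ∑ i ∈ s, g i (f i z) = z) : ∃ i ∈ s, HasAnn P (f i z) := by
  have hle : s.inf (fun i ↦ LinearMap.ker (LinearMap.toSpanSingleton R (N i) (f i z))) ≤ P := by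
    intro r hr
    rw [Submodule.mem_finsetInf] at hr
    rw [← h r, ← hz, Finset.smul_sum]
    refine Finset.sum_eq_zero fun i hi ↦ ?_
    have := hr i hi
    rw [LinearMap.mem_ker, LinearMap.toSpanSingleton_apply] at this
    rw [← map_smul, this, map_zero]
  obtain ⟨i, hi, hPi⟩ := (Ideal.IsPrime.inf_le' hP).mp hle
  refine ⟨i, hi, fun r ↦ ⟨fun hr ↦ hPi ?_, fun hr ↦ ?_⟩⟩
  · rwa [LinearMap.mem_ker, LinearMap.toSpanSingleton_apply]
  · rw [← map_smul, (h r).mpr hr, map_zero]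

theorem exists_hasAnn_map_of_isColimit [IsNoetherianRing R] {J : Type u} [SmallCategory J]
    [IsFiltered J] (K : J ⥤ ModuleCat.{u} R) {c : Cocone K} (hc : IsColimit c) {P : Ideal R}
    {z : c.pt} (hz : HasAnn P z) :
    ∃ (j : J) (y : K.obj j), ∀ (k : J) (f : j ⟶ k), HasAnn P (K.map f y) := by
  obtain ⟨i, x, rfl⟩ := Concrete.isColimit_exists_rep K hc z
  obtain ⟨s, rfl⟩ : P.FG := IsNoetherian.noetherian P
  have hkill (r : R) (hr : r ∈ s) : ∃ (k : J) (f : i ⟶ k), r • K.map f x = 0 := by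
    have h0 : c.ι.app i (r • x) = c.ι.app i 0 := by
      rw [map_smul, map_zero]; exact (hz r).mpr (Ideal.subset_span hr)
    obtain ⟨k, f, g, h⟩ := (Concrete.isColimit_rep_eq_iff_exists K hc _ _).mp h0
    exact ⟨k, f, by rw [← map_smul, h, map_zero]⟩
  have hall : ∃ (k : J) (f : i ⟶ k), ∀ r ∈ s, r • K.map f x = 0 := by
    clear hz
    induction s using Finset.cons_induction with
    | empty => exact ⟨i, 𝟙 i, fun r hr ↦ absurd hr (Finset.notMem_empty r)⟩
    | cons a s ha ih =>
      obtain ⟨k, f, hf⟩ := ih fun r hr ↦ hkill r (Finset.mem_cons_of_mem hr)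
      obtain ⟨l, g, hg⟩ := hkill a (Finset.mem_cons_self a s)
      obtain ⟨m, u, v, huv⟩ := IsFiltered.span f g
      refine ⟨m, f ≫ u, fun r hr ↦ ?_⟩
      obtain rfl | hr := Finset.mem_cons.mp hr
      · rw [huv, K.map_comp, ModuleCat.comp_apply, ← map_smul, hg, map_zero]
      · rw [K.map_comp, ModuleCat.comp_apply, ← map_smul, hf r hr, map_zero]
  obtain ⟨j, f, hf⟩ := hall
  refine ⟨j, K.map f x, fun k g r ↦ ⟨fun hr ↦ (hz r).mp ?_, fun hr ↦ ?_⟩⟩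
  · rw [← c.w (f ≫ g), ModuleCat.comp_apply, K.map_comp, ModuleCat.comp_apply, ← map_smul, hr,
      map_zero]
  · have : Ideal.span (s : Set R) ≤
        LinearMap.ker (LinearMap.toSpanSingleton R _ (K.map g (K.map f x))) := by
      rw [Ideal.span_le]
      intro a ha
      rw [SetLike.mem_coe, LinearMap.mem_ker, LinearMap.toSpanSingleton_apply, ← map_smul, hf a ha, map_zero]
    exact this hr

theorem exists_hasAnn_ext_of_mem_associatedPrimes_localCohomology [IsNoetherianRing R]
    {I : Ideal R} {n : ℕ} {X : ModuleCat.{u} R} {P : Ideal R}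
    (hP : P ∈ associatedPrimes R ((localCohomology I n).obj X)) :
    ∃ c : ℕ, ∀ J : Ideal R, J ≤ I ^ c → I ≤ J.radical →
      ∃ z : ((_root_.Ext R (ModuleCat.{u} R) n).obj
        (Opposite.op (ModuleCat.of R (R ⧸ J)))).obj X, HasAnn P z := by
  obtain ⟨-, z, hz⟩ := mem_associatedPrimes_iff_hasAnn.mp hP
  have hcof : IsCofiltered (SelfLERadical I) :=
    IsCofiltered.of_initial (idealPowersToSelfLERadical I)
  have hcolim := isColimitOfPreserves ((evaluation (ModuleCat.{u} R) (ModuleCat.{u} R)).obj X)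
    (colimit.isColimit (diagram (selfLERadicalDiagram I) n))
  let e : (localCohomology I n).obj X ≅ (localCohomology.ofSelfLERadical I n).obj X :=
    (isoSelfLERadical I n).app X |>.symm
  have hz' := hz.of_injective e.toLinearEquiv.toLinearMap e.toLinearEquiv.injective
  obtain ⟨j, y, hy⟩ := exists_hasAnn_map_of_isColimit _ hcolim hz'
  obtain ⟨c, hc⟩ := Ideal.exists_pow_le_of_le_radical_of_fg j.unop.2 (IsNoetherian.noetherian I)
  refine ⟨c, fun J hJ hIJ ↦ ?_⟩
  let k : SelfLERadical I := ⟨J, hIJ⟩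
  let f : k ⟶ j.unop := ObjectProperty.homMk (homOfLE (hJ.trans hc))
  exact ⟨_, hy (Opposite.op k) f.op⟩

end LocalCohomology

/-! ### Canonical modules and the Frobenius -/

section Frobenius

variable {R : Type u} [CommRing R] {D : Type u} [AddCommGroup D] [Module R D]

theorem IsCanonicalModule.isDual (h : IsCanonicalModule R D) : IsDual R D := by
  obtain ⟨hfin, ⟨b, hb⟩, hbij, hac⟩ := h
  refine ⟨hfin, ⟨b, fun M _ _ _ i hi ↦ ?_⟩, hbij, fun i ↦ ?_⟩
  · obtain ⟨e⟩ := nonempty_extFunctor_linearEquiv i (ModuleCat.of R M) (ModuleCat.of R D)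
    exact @Function.Injective.subsingleton _ _ _ e.symm.injective (hb (ModuleCat.of R M) i hi)
  · obtain ⟨e⟩ := nonempty_extFunctor_linearEquiv (i + 1) (ModuleCat.of R D) (ModuleCat.of R D)
    exact @Function.Injective.subsingleton _ _ _ e.symm.injective (hac (i + 1) i.succ_pos)

theorem IsDual.isMCM [IsNoetherianRing R] (hD : IsDual R D) : IsMCM R D :=
  fun _ _ _ _ h ↦ hD.lreg h

theorem IsMCM.frobenius_res {q : ℕ} (hq : q ≠ 0) (F : R →+* R) (hF : ∀ r, F r = r ^ q)
    (h : IsMCM R D) : IsMCM R (Res F D) :=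
  fun m _ xs hxs hreg ↦ (h m xs hxs hreg).frobenius_res hq F hF

theorem isMCM_self : IsMCM R R := fun _ _ _ _ h ↦ h

theorem IsDual.extAcyclic_frobenius_res [IsNoetherianRing R]
    (hR : ∀ (m : Ideal R) [m.IsMaximal], LCohenMacaulay m) (hD : IsDual R D) {q : ℕ} (hq : q ≠ 0)
    (F : R →+* R) (hF : ∀ r, F r = r ^ q) (hfin : Module.Finite R (Res F R)) :
    ExtAcyclic R (Res F R) D := by
  have := hD.finite
  exact (isMCM_self.frobenius_res hq F hF).extAcyclic hR hD.bounded

/-- A canonical module is a retract of a finite power of its coextension along the Frobenius. -/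
theorem IsDual.exists_coext_retract [IsNoetherianRing R]
    (hR : ∀ (m : Ideal R) [m.IsMaximal], LCohenMacaulay m) (hD : IsDual R D) {q : ℕ} (hq : q ≠ 0)
    (F : R →+* R) (hF : ∀ r, F r = r ^ q) (hfin : Module.Finite R (Res F R)) :
    ∃ (k : ℕ) (f : D →ₗ[R] (Fin k → Coext F D)) (g : (Fin k → Coext F D) →ₗ[R] D),
      g ∘ₗ f = LinearMap.id := by
  have := hD.finite
  have hac := hD.extAcyclic_frobenius_res hR hq F hF hfin
  have hC := hD.coext F hfin hac
  have := hC.finite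
  have := Res.finite F hfin (X := D)
  refine hC.exists_retract hD.bounded (fun i ↦ ?_) (hC.isMCM.extAcyclic hR hD.bounded)
  obtain ⟨e, -⟩ := exists_ext_coext_addEquiv F D hac (i + 1) D
  have := (hD.isMCM.frobenius_res hq F hF).extAcyclic hR hD.bounded i
  exact e.injective.subsingleton

theorem exists_hasAnn_ext_res [IsNoetherianRing R]
    (hR : ∀ (m : Ideal R) [m.IsMaximal], LCohenMacaulay m) (hD : IsDual R D) {q : ℕ} (hq : q ≠ 0)
    (F : R →+* R) (hF : ∀ r, F r = r ^ q) (hfin : Module.Finite R (Res F R)) {P : Ideal R}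
    (hP : P.IsPrime) (n : ℕ) {N : Type u} [AddCommGroup N] [Module R N] [Module.Finite R N]
    {z : ExtMod R n N D} (hz : HasAnn P z) : ∃ w : ExtMod R n (Res F N) D, HasAnn P w := by
  obtain ⟨k, f, g, hgf⟩ := hD.exists_coext_retract hR hq F hF hfin
  have hid : ∑ j, (g ∘ₗ LinearMap.single R (fun _ ↦ Coext F D) j) ∘ₗ (LinearMap.proj j ∘ₗ f) =
      LinearMap.id := by
    rw [← hgf]
    refine LinearMap.ext fun x ↦ ?_
    simp only [LinearMap.sum_apply, LinearMap.comp_apply, ← map_sum]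
    congr 1
    exact Finset.univ_sum_single (f x)
  have hsum : ∑ j, extPush n N (g ∘ₗ LinearMap.single R (fun _ ↦ Coext F D) j)
      (extPush n N (LinearMap.proj j ∘ₗ f) z) = z := by
    simp only [← extPush_comp, ← LinearMap.sum_apply, ← extPush_sum]
    rw [hid, extPush_id]
  obtain ⟨j, -, hj⟩ := hz.exists_of_sum_eq _ hP _ _ hsum
  obtain ⟨e, he⟩ := exists_ext_coext_addEquiv F D (hD.extAcyclic_frobenius_res hR hq F hF hfin) n N
  refine ⟨e (extPush n N (LinearMap.proj j ∘ₗ f) z), fun r ↦ ?_⟩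
  rw [← he, map_eq_zero_iff e e.injective, hj, hF, hP.pow_mem_iff_mem q (Nat.pos_of_ne_zero hq)]

/-- The map `A/IA → B/IB` induced by `f : A → B`. -/
def modMap (I : Ideal R) {A B : Type u} [AddCommGroup A] [Module R A] [AddCommGroup B]
    [Module R B] (f : A →ₗ[R] B) :
    (A ⧸ (I • ⊤ : Submodule R A)) →ₗ[R] (B ⧸ (I • ⊤ : Submodule R B)) :=
  Submodule.mapQ _ _ f (Submodule.smul_top_le_comap_smul_top I f)

theorem exists_hasAnn_ext_mod {ι : Type*} [Fintype ι] (I : Ideal R) {A : Type u}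
    [AddCommGroup A] [Module R A] {N : ι → Type u} [∀ i, AddCommGroup (N i)] [∀ i, Module R (N i)]
    (f : ∀ i, A →ₗ[R] N i) (g : ∀ i, N i →ₗ[R] A) (hfg : ∀ x, ∑ i, g i (f i x) = x)
    {P : Ideal R} (hP : P.IsPrime) (n : ℕ)
    {z : ExtMod R n (A ⧸ (I • ⊤ : Submodule R A)) D} (hz : HasAnn P z) :
    ∃ (i : ι) (w : ExtMod R n (N i ⧸ (I • ⊤ : Submodule R (N i))) D), HasAnn P w := by
  have hid : ∑ i, modMap I (g i) ∘ₗ modMap I (f i) = LinearMap.id := by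
    refine LinearMap.ext fun x ↦ ?_
    obtain ⟨x, rfl⟩ := Submodule.mkQ_surjective _ x
    simp only [modMap, LinearMap.sum_apply, LinearMap.comp_apply, Submodule.mkQ_apply,
      Submodule.mapQ_apply, LinearMap.id_apply]
    conv_rhs => rw [← hfg x]
    exact (map_sum (Submodule.mkQ _) _ _).symm
  have hsum : ∑ i, extPull n D (modMap I (f i)) (extPull n D (modMap I (g i)) z) = z := by
    simp only [← extPull_comp, ← LinearMap.sum_apply, ← extPull_sum]
    rw [hid, extPull_id]
  obtain ⟨i, -, hi⟩ := hz.exists_of_sum_eq _ hP _ _ hsum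
  exact ⟨i, _, hi⟩

theorem smul_top_eq_ker_res_mkQ (F : R →+* R) (I : Ideal R) :
    (I • ⊤ : Submodule R (Res F R)) =
      LinearMap.ker (Res.map F (Submodule.mkQ (I.map F))) := by
  apply le_antisymm
  · refine Submodule.smul_le.mpr fun r hr x _ ↦ ?_
    obtain ⟨x, rfl⟩ := (Res.of F).surjective x
    rw [LinearMap.mem_ker, Res.smul_of, Res.map_of, Submodule.mkQ_apply, smul_eq_mul,
      (Submodule.Quotient.mk_eq_zero _).mpr (Ideal.mul_mem_right _ _ (Ideal.mem_map_of_mem F hr)),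
      map_zero]
  · intro x hx
    obtain ⟨x, rfl⟩ := (Res.of F).surjective x
    rw [LinearMap.mem_ker, Res.map_of, map_eq_zero_iff _ (Res.of F).injective,
      Submodule.mkQ_apply, Submodule.Quotient.mk_eq_zero] at hx
    induction hx using Submodule.span_induction with
    | mem x hx =>
      obtain ⟨r, hr, rfl⟩ := hx
      have : Res.of F (F r) = r • Res.of F 1 := by rw [Res.smul_of, smul_eq_mul, mul_one]
      rw [this]
      exact Submodule.smul_mem_smul hr Submodule.mem_top
    | zero => rw [map_zero]; exact zero_mem _
    | add x y _ _ hx hy => rw [map_add]; exact add_mem hx hy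
    | smul a x _ hx => exact Submodule.smul_top_le_comap_smul_top I (Coext.mulRes F a) hx

/-- `F_*(R / I^{[q]}) = F_*R / I F_*R`. -/
noncomputable def resQuotEquiv (F : R →+* R) (I : Ideal R) :
    (Res F R ⧸ (I • ⊤ : Submodule R (Res F R))) ≃ₗ[R] Res F (R ⧸ I.map F) :=
  (Submodule.quotEquivOfEq _ _ (smul_top_eq_ker_res_mkQ F I)).trans
    (LinearMap.quotKerEquivOfSurjective _ fun x ↦ by
      obtain ⟨y, hy⟩ := Submodule.mkQ_surjective _ ((Res.of F).symm x)
      exact ⟨Res.of F y, by rw [Res.map_of, hy, AddEquiv.apply_symm_apply]⟩)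

theorem exists_hasAnn_ext_of_mem_associatedPrimes [IsNoetherianRing R]
    (hR : ∀ (m : Ideal R) [m.IsMaximal], LCohenMacaulay m) (hD : IsDual R D)
    {p : ℕ} (hp : p.Prime) [CharP R p] {t : ℕ} {M : Fin t → Type u} [∀ i, AddCommGroup (M i)]
    [∀ i, Module R (M i)] [∀ i, Module.Finite R (M i)]
    (hFFRT : ∀ e : ℕ, ∃ (m : Fin t → ℕ) (ψ : R ≃+ ⨁ i : Fin t, (Fin (m i) → M i)),
      ∀ r y : R, ψ (r ^ p ^ e * y) = r • ψ y)
    {I : Ideal R} {n : ℕ} {P : Ideal R}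
    (hP : P ∈ associatedPrimes R ((localCohomology I n).obj (ModuleCat.of R D))) :
    ∃ (i : Fin t) (w : ExtMod R n (M i ⧸ (I • ⊤ : Submodule R (M i))) D), HasAnn P w := by
  have hPprime : P.IsPrime := (mem_associatedPrimes_iff_hasAnn.mp hP).1
  have : ExpChar R p := ExpChar.prime hp
  obtain ⟨c, hc⟩ := exists_hasAnn_ext_of_mem_associatedPrimes_localCohomology hP
  let F : R →+* R := iterateFrobenius R p c
  have hF (r : R) : F r = r ^ p ^ c := iterateFrobenius_def p c r
  have hq : p ^ c ≠ 0 := pow_ne_zero c hp.ne_zero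
  obtain ⟨m, ψ, hψ⟩ := hFFRT c
  let Ψ : Res F R ≃ₗ[R] ⨁ i : Fin t, (Fin (m i) → M i) :=
    { (Res.of F).symm.trans ψ with
      map_smul' := fun r x ↦ by
        obtain ⟨x, rfl⟩ := (Res.of F).surjective x
        change ψ (F r * x) = r • ψ x
        rw [hF, hψ] }
  have hfin : Module.Finite R (Res F R) :=
    have : Module.Finite R (⨁ i : Fin t, (Fin (m i) → M i)) :=
      Module.Finite.equiv (DirectSum.linearEquivFunOnFintype R (Fin t) _).symm
    Module.Finite.equiv Ψ.symm
  have hle : I.map F ≤ I ^ c := by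
    rw [Ideal.map_le_iff_le_comap]
    intro r hr
    rw [Ideal.mem_comap, hF]
    exact Ideal.pow_le_pow_right (Nat.lt_pow_self hp.one_lt).le (Ideal.pow_mem_pow hr _)
  have hrad : I ≤ (I.map F).radical := fun r hr ↦
    ⟨p ^ c, by rw [← hF]; exact Ideal.mem_map_of_mem F hr⟩
  obtain ⟨z, hz⟩ := hc _ hle hrad
  obtain ⟨e⟩ := nonempty_extFunctor_linearEquiv n (ModuleCat.of R (R ⧸ I.map F))
    (ModuleCat.of R D)
  obtain ⟨w, hw⟩ := exists_hasAnn_ext_res hR hD hq F hF hfin hPprime n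
    (hz.of_injective e.toLinearMap e.injective)
  have hw' := hw.of_injective (extPullEquiv n D (resQuotEquiv F I)).toLinearMap
    (extPullEquiv n D (resQuotEquiv F I)).injective
  obtain ⟨⟨i, j⟩, v, hv⟩ := exists_hasAnn_ext_mod (ι := Σ i, Fin (m i)) (N := fun s ↦ M s.1) I
    (fun s ↦ LinearMap.proj s.2 ∘ₗ DirectSum.component R (Fin t) _ s.1 ∘ₗ Ψ.toLinearMap)
    (fun s ↦ Ψ.symm.toLinearMap ∘ₗ DirectSum.lof R (Fin t) (fun i ↦ Fin (m i) → M i) s.1 ∘ₗ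
      LinearMap.single R (fun _ ↦ M s.1) s.2)
    (fun x ↦ by
      simp only [LinearMap.comp_apply, Fintype.sum_sigma, LinearEquiv.coe_coe, ← map_sum]
      rw [LinearEquiv.symm_apply_eq]
      generalize Ψ x = y
      simp only [LinearMap.proj_apply, LinearMap.coe_single]
      refine (Finset.sum_congr rfl fun i _ ↦ ?_).trans (DirectSum.sum_univ_of y)
      exact (map_sum (DirectSum.lof R (Fin t) (fun i ↦ Fin (m i) → M i) i) _ _).symm.trans
        (congrArg _ (Finset.univ_sum_single (y i))))
    hPprime n hw'
  exact ⟨i, v, hv⟩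

end Frobenius

/-- Let `R` be a Cohen-Macaulay ring of prime characteristic `p` with
finite F-representation type by finitely generated `R`-modules `M_1, …, M_t`, admitting a
canonical module `ω_R`.  Let `I` be an ideal of `R` and `n` an integer.  Then
`Ass_R H_I^n(ω_R) ⊆ ⋃_i Ass_R Ext_R^n(M_i/IM_i, ω_R)`.  In particular, `H_I^n(ω_R)` has
only a finite number of associated primes. -/
theorem stmt3 {R : Type u} [CommRing R] (hCM : IsCMRing R)
    (p : ℕ) (hp : p.Prime) [CharP R p]
    -- finite F-representation type by finitely generated modules `M_1, …, M_t`: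
    (t : ℕ) (M : Fin t → Type u) [∀ i, AddCommGroup (M i)] [∀ i, Module R (M i)]
    (hfg : ∀ i, Module.Finite R (M i))
    (hFFRT : ∀ e : ℕ, ∃ (m : Fin t → ℕ)
      (ψ : R ≃+ ⨁ i : Fin t, (Fin (m i) → M i)),
        ∀ r y : R, ψ (r ^ p ^ e * y) = r • ψ y)
    -- a canonical module `ω_R`:
    (ω : Type u) [AddCommGroup ω] [Module R ω] (hω : IsCanonicalModule R ω)
    (I : Ideal R) (n : ℕ) :
    associatedPrimes R ((localCohomology I n).obj (ModuleCat.of R ω)) ⊆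
      (⋃ i : Fin t, associatedPrimes R
        (extCat R n (ModuleCat.of R ((M i) ⧸ (I • (⊤ : Submodule R (M i)))))
          (ModuleCat.of R ω))) ∧
    (associatedPrimes R ((localCohomology I n).obj (ModuleCat.of R ω))).Finite := by
  have : IsNoetherianRing R := hCM.1
  have hsub : associatedPrimes R ((localCohomology I n).obj (ModuleCat.of R ω)) ⊆
      (⋃ i : Fin t, associatedPrimes R
        (extCat R n (ModuleCat.of R ((M i) ⧸ (I • (⊤ : Submodule R (M i)))))
          (ModuleCat.of R ω))) := by
    intro P hP
    obtain ⟨i, w, hw⟩ := exists_hasAnn_ext_of_mem_associatedPrimes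
      (fun m _ ↦ hCM.lCohenMacaulay m) hω.isDual hp hFFRT hP
    obtain ⟨e⟩ := nonempty_extFunctor_linearEquiv n
      (ModuleCat.of R (M i ⧸ (I • ⊤ : Submodule R (M i)))) (ModuleCat.of R ω)
    refine Set.mem_iUnion.mpr ⟨i, mem_associatedPrimes_iff_hasAnn.mpr
      ⟨(mem_associatedPrimes_iff_hasAnn.mp hP).1, e.symm w, ?_⟩⟩
    exact hw.of_injective e.symm.toLinearMap e.symm.injective
  refine ⟨hsub, (Set.finite_iUnion fun i ↦ ?_).subset hsub⟩
  obtain ⟨e⟩ := nonempty_extFunctor_linearEquiv n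
    (ModuleCat.of R (M i ⧸ (I • ⊤ : Submodule R (M i)))) (ModuleCat.of R ω)
  have := hω.1
  have hfin : Module.Finite R (extCat R n
      (ModuleCat.of R (M i ⧸ (I • ⊤ : Submodule R (M i)))) (ModuleCat.of R ω)) :=
    Module.Finite.equiv e.symm
  exact associatedPrimes.finite R _
end
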